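/- There is c* > 0 such that for every C₀ ≥ 1/c* and every σ ∈ (0, c*] there is C > 0 such that the following holds for all sufficiently large n. Let d ≥ C·log n, let δ > 0 with d ≤ n^σ and δ ≤ n^σ, and let λ satisfy (log n)^{−3} ≤ λ ≤ c* and λ·δ ≥ C₀·log n. Let K ∈ 𝒦_d(n) and let F be a graph on [n] satisfying: (D1) (1−λ)δ ≤ d_{F∖K}(v) ≤ (1+λ)δ for every v ∈ [n]; (D2) for every v ∈ [n], Σ_{u∈N_{F∖K}(v)} Σ_{u'∈N_K(u)} d_{F∖K}(u') = (1 ± λ/log n)·d_{F∖K}(v)·δ·d; (D3) for each U ⊆ [n], if there is U' ⊆ [n] with |U'| ≤ 4|U|/δ and U ⊆ U' ∪ N_{F∖K}(U'), then |E_{≥2,K}(U)| + e_K(U) ≤ (λ/log n)·d·|U| whenever |U| ≤ λn/(10⁶·d·log n), and |E_{≥2,K}(U)| + e_K(U) ≤ λ·d·|U| whenever |U| ≤ λn/(10⁶·d); (D4) for each U ⊆ [n] with |U| ≤ λn/(100·δ·log n), if there is U' ⊆ [n] with |U'| ≤ 4|U|/d and U ⊆ U' ∪ N_K(U'), then |E_{≥2,F∖K}(U)|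 + e_{F∖K}(U) ≤ (λ/log n)·δ·|U|; (D5) for each U ⊆ [n] with |U| ≤ 100·log n, |{v ∈ [n]∖U : d_{F∖K}(v,U) ≥ 10}| ≤ 100·log n; (D6) for all disjoint U, V ⊆ [n] with |U|, |V| ≥ λn/10⁸, e_{F∖K}(U,V) ≥ (1−λ)·(δ/n)·|U|·|V|. Let ℓ₀ be the smallest integer with δ^{ℓ₀−1}·d^{ℓ₀−1} ≥ n. Then for each pair of distinct x, y ∈ [n], each Z ⊆ [n] with |Z| ≤ 40·log n, and each integer ℓ with 10·ℓ₀ ≤ ℓ ≤ 10·log n, the number of (F∖K, K)-alternating x,y-paths of length 2ℓ with no internal vertex in Z is at least (1 − C₀·λ − |(Z ∪ {x}) ∩ N_K(y)|/d)·d^ℓ·δ^ℓ/n. (Lemma 6.2.) -/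

import Mathlib

open scoped Classical ENNReal

noncomputable section

namespace Sandwich

variable {n : ℕ}

/-- The degree of the vertex `v` in the graph `G`. -/
def deg (G : SimpleGraph (Fin n)) (v : Fin n) : ℕ := Nat.card (G.neighborSet v)

/-- `G` is a `d`-regular graph. -/
def IsRegularGraph (G : SimpleGraph (Fin n)) (d : ℕ) : Prop := ∀ v, deg G v = d

/-- The number of edges of `G`. -/
def edgeCount (G : SimpleGraph (Fin n)) : ℕ := G.edgeSet.ncard

/-- The probability of the event `P` under the probability mass function `μ`. -/
def prEvent {α : Type*} (μ : PMF α) (P : α → Prop) : ℝ≥0∞ := ∑' a, if P a then μ a else 0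

/-- `μ` is the uniform distribution on the set `S`. -/
def IsUniformOn {α : Type*} (μ : PMF α) (S : Set α) : Prop :=
  ∀ a, μ a = if a ∈ S then (S.ncard : ℝ≥0∞)⁻¹ else 0

/-- `P` lists the `k+1` vertices of a `(G₁,G₂)`-alternating path of length `k`: the vertices
are distinct and consecutive vertices are joined by an edge of `G₁` (for steps of even index)
or of `G₂` (for steps of odd index). -/
def IsAltSeq (G₁ G₂ : SimpleGraph (Fin n)) (k : ℕ) (P : Fin (k + 1) → Fin n) : Prop :=
  Function.Injective P ∧
    ∀ i : Fin k, if (i : ℕ) % 2 = 0 then G₁.Adj (P i.castSucc) (P i.succ)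
      else G₂.Adj (P i.castSucc) (P i.succ)

/-- The number of `(G₁,G₂)`-alternating `x,y`-paths of length `k` with no internal vertex
in `Z`. -/
def altPathCount (G₁ G₂ : SimpleGraph (Fin n)) (k : ℕ) (x y : Fin n) (Z : Set (Fin n)) : ℕ :=
  Nat.card {P : Fin (k + 1) → Fin n // IsAltSeq G₁ G₂ k P ∧ P 0 = x ∧ P (Fin.last k) = y ∧
    ∀ i : Fin (k + 1), i ≠ 0 → i ≠ Fin.last k → P i ∉ Z}

/-- The number of `(G₁,G₂)`-alternating paths of length `k` starting at `x`. -/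
def altStartCount (G₁ G₂ : SimpleGraph (Fin n)) (k : ℕ) (x : Fin n) : ℕ :=
  Nat.card {P : Fin (k + 1) → Fin n // IsAltSeq G₁ G₂ k P ∧ P 0 = x}

/-- The external neighbourhood `N_G(U)` of a set of vertices `U`. -/
def nbhd (G : SimpleGraph (Fin n)) (U : Set (Fin n)) : Set (Fin n) :=
  {v | v ∉ U ∧ ∃ u ∈ U, G.Adj u v}

/-- `e_G(U)`, the number of edges of `G` with both endpoints in `U`. -/
def edgesWithin (G : SimpleGraph (Fin n)) (U : Set (Fin n)) : ℕ :=
  {e ∈ G.edgeSet | ∀ v ∈ e, v ∈ U}.ncard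

/-- `e_G(U,V) = |{(u,v) : u ∈ U, v ∈ V, uv ∈ E(G)}|`. -/
def edgesBetween (G : SimpleGraph (Fin n)) (U V : Set (Fin n)) : ℕ :=
  {p : Fin n × Fin n | p.1 ∈ U ∧ p.2 ∈ V ∧ G.Adj p.1 p.2}.ncard

/-- `|E_{≥2,G}(U)|`, the number of edges `xy ∈ E(G)` with `x ∈ U`, `y ∉ U` such that some
`x' ∈ U ∖ {x}` also satisfies `x'y ∈ E(G)`. -/
def E2count (G : SimpleGraph (Fin n)) (U : Set (Fin n)) : ℕ :=
  {e : Sym2 (Fin n) | e ∈ G.edgeSet ∧ ∃ x y, e = s(x, y) ∧ x ∈ U ∧ y ∉ U ∧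
    ∃ x' ∈ U, x' ≠ x ∧ G.Adj x' y}.ncard

/-- `Σ_{u ∈ N_{F∖K}(v)} Σ_{u' ∈ N_K(u)} d_{F∖K}(u')`. -/
def doubleDegSum (F K : SimpleGraph (Fin n)) (v : Fin n) : ℝ :=
  ∑ u : Fin n, if (F \ K).Adj v u then
    ∑ u' : Fin n, if K.Adj u u' then (deg (F \ K) u' : ℝ) else 0
  else 0

/-- `μ` is the law of the binomial random graph `G(n,p)`. -/
def IsGnp (μ : PMF (SimpleGraph (Fin n))) (p : ℝ) : Prop :=
  ∀ G, μ G = ENNReal.ofReal (p ^ edgeCount G * (1 - p) ^ (n.choose 2 - edgeCount G))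

/-- `μ` is the law of `G(n,p)`, where `p` is truncated to `[0,1]` (so that `G(n,p)` is the
empty graph for `p ≤ 0` and the complete graph for `p ≥ 1`). -/
def IsGnpLaw (μ : PMF (SimpleGraph (Fin n))) (p : ℝ) : Prop :=
  IsGnp μ (max 0 (min p 1))

/-- `μ` is the law of `K + E`, where `E` includes each pair not in `E(K)` independently with
probability `p`. -/
def IsAddGnp (μ : PMF (SimpleGraph (Fin n))) (K : SimpleGraph (Fin n)) (p : ℝ) : Prop :=
  ∀ F, μ F = if K ≤ F then
      ENNReal.ofReal (p ^ (edgeCount F - edgeCount K) * (1 - p) ^ (n.choose 2 - edgeCount F))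
    else 0

/-- `ν` is the joint law of `(K, F)` where `K ~ G_d(n)` is a uniformly random `d`-regular graph
and `F = K + E`, `E` including each pair not in `E(K)` independently with probability `p`. -/
def IsRegAddGnp (ν : PMF (SimpleGraph (Fin n) × SimpleGraph (Fin n))) (d : ℕ) (p : ℝ) : Prop :=
  ∀ w, ν w = if IsRegularGraph w.1 d ∧ w.1 ≤ w.2 then
      ({G : SimpleGraph (Fin n) | IsRegularGraph G d}.ncard : ℝ≥0∞)⁻¹ *
        ENNReal.ofReal (p ^ (edgeCount w.2 - edgeCount w.1) *
          (1 - p) ^ (n.choose 2 - edgeCount w.2))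
    else 0

/-- `ν` is the joint law of an independent pair `(K, F)` with `K ~ G_d(n)` and `F ~ G(n,q)`. -/
def IsRegIndepGnp (ν : PMF (SimpleGraph (Fin n) × SimpleGraph (Fin n))) (d : ℕ) (q : ℝ) :
    Prop :=
  ∀ w, ν w = (if IsRegularGraph w.1 d then
      ({G : SimpleGraph (Fin n) | IsRegularGraph G d}.ncard : ℝ≥0∞)⁻¹ else 0) *
      ENNReal.ofReal (q ^ edgeCount w.2 * (1 - q) ^ (n.choose 2 - edgeCount w.2))

/-- The graph used in step `i` of a `(G,K)`-alternating walk. -/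
def altGraph (G K : SimpleGraph (Fin n)) (i : ℕ) : SimpleGraph (Fin n) :=
  if i % 2 = 0 then G else K

/-- The neighbourhood of `v` as a finset. -/
def nb (H : SimpleGraph (Fin n)) (v : Fin n) : Finset (Fin n) := Finset.univ.filter (H.Adj v)

theorem mem_nb {H : SimpleGraph (Fin n)} {u v : Fin n} : u ∈ nb H v ↔ H.Adj v u := by
  simp [nb]

theorem mem_nb_comm {H : SimpleGraph (Fin n)} {u v : Fin n} : u ∈ nb H v ↔ v ∈ nb H u := by
  simp [nb, H.adj_comm]

theorem sum_nb_comm (H : SimpleGraph (Fin n)) (f : Fin n → Fin n → ℝ) :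
    ∑ v, ∑ u ∈ nb H v, f v u = ∑ u, ∑ v ∈ nb H u, f v u :=
  Finset.sum_comm' (by simp [mem_nb, H.adj_comm])

/-- The sum of `f u l` over the alternating walks with `k` steps starting at `v`, the first step
using the graph of index `s`. Here `u` is the last vertex of the walk and `l` lists the earlier
vertices, latest first, followed by the list `l` given as an argument. -/
def walkSum (G K : SimpleGraph (Fin n)) :
    ℕ → ℕ → (Fin n → List (Fin n) → ℝ) → Fin n → List (Fin n) → ℝ
  | _, 0, f, v, l => f v l
  | s, k + 1, f, v, l => ∑ u ∈ nb (altGraph G K s) v, walkSum G K (s + 1) k f u (v :: l)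

/-- `walkSum` for functions of the last vertex only. -/
def walkOp (G K : SimpleGraph (Fin n)) (s k : ℕ) (f : Fin n → ℝ) (v : Fin n) : ℝ :=
  walkSum G K s k (fun u _ => f u) v []

section Basic

variable {G K : SimpleGraph (Fin n)}

theorem altGraph_congr {i j : ℕ} (h : i % 2 = j % 2) : altGraph G K i = altGraph G K j := by
  simp [altGraph, h]

theorem walkSum_zero (s : ℕ) (f : Fin n → List (Fin n) → ℝ) (v : Fin n) (l : List (Fin n)) :
    walkSum G K s 0 f v l = f v l := rfl

theorem walkSum_succ (s k : ℕ) (f : Fin n → List (Fin n) → ℝ) (v : Fin n) (l : List (Fin n)) :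
    walkSum G K s (k + 1) f v l =
      ∑ u ∈ nb (altGraph G K s) v, walkSum G K (s + 1) k f u (v :: l) := rfl

theorem walkSum_add (i j : ℕ) (f : Fin n → List (Fin n) → ℝ) :
    ∀ (s : ℕ) (v : Fin n) (l : List (Fin n)),
      walkSum G K s (i + j) f v l = walkSum G K s i (walkSum G K (s + i) j f) v l := by
  induction i with
  | zero => intro s v l; simp [walkSum_zero]
  | succ i ih =>
    intro s v l
    rw [show i + 1 + j = i + j + 1 by ring, walkSum_succ, walkSum_succ]
    refine Finset.sum_congr rfl fun u _ => ?_
    rw [ih, show s + 1 + i = s + (i + 1) by ring]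

theorem walkSum_congr_mod (k : ℕ) (f : Fin n → List (Fin n) → ℝ) :
    ∀ (s s' : ℕ), s % 2 = s' % 2 → ∀ (v : Fin n) (l : List (Fin n)),
      walkSum G K s k f v l = walkSum G K s' k f v l := by
  induction k with
  | zero => intro s s' _ v l; rfl
  | succ k ih =>
    intro s s' h v l
    rw [walkSum_succ, walkSum_succ, altGraph_congr h]
    exact Finset.sum_congr rfl fun u _ => ih _ _ (by omega) _ _

theorem walkSum_mono (k : ℕ) {f g : Fin n → List (Fin n) → ℝ} :
    ∀ (s : ℕ) (v : Fin n) (l : List (Fin n)),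
      (∀ u l', l'.length = k + l.length → f u l' ≤ g u l') →
      walkSum G K s k f v l ≤ walkSum G K s k g v l := by
  induction k with
  | zero => intro s v l h; exact h _ _ (by simp)
  | succ k ih =>
    intro s v l h
    rw [walkSum_succ, walkSum_succ]
    exact Finset.sum_le_sum fun u _ => ih _ _ _ fun u l' hl => h _ _ (by simp at hl; omega)

theorem walkSum_mono' (s k : ℕ) {f g : Fin n → List (Fin n) → ℝ} (v : Fin n) (l : List (Fin n))
    (h : ∀ u l', f u l' ≤ g u l') : walkSum G K s k f v l ≤ walkSum G K s k g v l :=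
  walkSum_mono k s v l fun u l' _ => h u l'

theorem walkSum_finset_sum {ι : Type*} (I : Finset ι) (k : ℕ)
    (f : ι → Fin n → List (Fin n) → ℝ) :
    ∀ (s : ℕ) (v : Fin n) (l : List (Fin n)),
      walkSum G K s k (fun u l => ∑ i ∈ I, f i u l) v l = ∑ i ∈ I, walkSum G K s k (f i) v l := by
  induction k with
  | zero => intro s v l; rfl
  | succ k ih =>
    intro s v l
    simp only [walkSum_succ, ih]
    exact Finset.sum_comm

theorem walkSum_const_mul (c : ℝ) (k : ℕ) (f : Fin n → List (Fin n) → ℝ) :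
    ∀ (s : ℕ) (v : Fin n) (l : List (Fin n)),
      walkSum G K s k (fun u l => c * f u l) v l = c * walkSum G K s k f v l := by
  induction k with
  | zero => intro s v l; rfl
  | succ k ih =>
    intro s v l
    simp only [walkSum_succ, ih, Finset.mul_sum]

theorem walkSum_add_fun (k : ℕ) (f g : Fin n → List (Fin n) → ℝ) :
    ∀ (s : ℕ) (v : Fin n) (l : List (Fin n)),
      walkSum G K s k (fun u l => f u l + g u l) v l =
        walkSum G K s k f v l + walkSum G K s k g v l := by
  induction k with
  | zero => intro s v l; rfl
  | succ k ih =>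
    intro s v l
    simp only [walkSum_succ, ih, Finset.sum_add_distrib]

theorem walkSum_sub_fun (s k : ℕ) (f g : Fin n → List (Fin n) → ℝ) (v : Fin n)
    (l : List (Fin n)) :
    walkSum G K s k (fun u l => f u l - g u l) v l =
      walkSum G K s k f v l - walkSum G K s k g v l := by
  have h := walkSum_add_fun (G := G) (K := K) k f (fun u l => (-1) * g u l) s v l
  rw [walkSum_const_mul] at h
  simp only [neg_one_mul, ← sub_eq_add_neg] at h
  exact h

theorem walkSum_nonneg (s k : ℕ) {f : Fin n → List (Fin n) → ℝ} (v : Fin n) (l : List (Fin n))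
    (h : ∀ u l', 0 ≤ f u l') : 0 ≤ walkSum G K s k f v l := by
  have h1 := walkSum_mono' (G := G) (K := K) (f := fun u l => 0 * f u l) (g := f) s k v l
    (by intro u l; simpa using h u l)
  rw [walkSum_const_mul] at h1
  simpa using h1

theorem walkSum_eq_walkOp (k : ℕ) (f : Fin n → ℝ) :
    ∀ (s : ℕ) (v : Fin n) (l : List (Fin n)),
      walkSum G K s k (fun u _ => f u) v l = walkOp G K s k f v := by
  have key : ∀ (s : ℕ) (v : Fin n) (l l' : List (Fin n)),
      walkSum G K s k (fun u _ => f u) v l = walkSum G K s k (fun u _ => f u) v l' := by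
    induction k with
    | zero => intro s v l l'; rfl
    | succ k ih =>
      intro s v l l'
      simp only [walkSum_succ]
      exact Finset.sum_congr rfl fun u _ => ih _ _ _ _
  exact fun s v l => key s v l []

theorem walkOp_zero (s : ℕ) (f : Fin n → ℝ) (v : Fin n) : walkOp G K s 0 f v = f v := rfl

theorem walkOp_succ (s k : ℕ) (f : Fin n → ℝ) (v : Fin n) :
    walkOp G K s (k + 1) f v = ∑ u ∈ nb (altGraph G K s) v, walkOp G K (s + 1) k f u := by
  rw [walkOp, walkSum_succ]
  exact Finset.sum_congr rfl fun u _ => walkSum_eq_walkOp _ _ _ _ _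

theorem walkOp_add (s i j : ℕ) (f : Fin n → ℝ) (v : Fin n) :
    walkOp G K s (i + j) f v = walkOp G K s i (walkOp G K (s + i) j f) v := by
  have h : walkSum G K (s + i) j (fun u _ => f u) = fun u _ => walkOp G K (s + i) j f u := by
    funext u l
    exact walkSum_eq_walkOp _ _ _ _ _
  rw [walkOp, walkSum_add, h]
  rfl

theorem walkOp_congr_mod {s s' : ℕ} (h : s % 2 = s' % 2) (k : ℕ) (f : Fin n → ℝ) (v : Fin n) :
    walkOp G K s k f v = walkOp G K s' k f v :=
  walkSum_congr_mod k _ s s' h v []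

theorem walkOp_mono (s k : ℕ) {f g : Fin n → ℝ} (h : ∀ u, f u ≤ g u) (v : Fin n) :
    walkOp G K s k f v ≤ walkOp G K s k g v :=
  walkSum_mono' s k v [] fun u _ => h u

theorem walkOp_nonneg (s k : ℕ) {f : Fin n → ℝ} (h : ∀ u, 0 ≤ f u) (v : Fin n) :
    0 ≤ walkOp G K s k f v :=
  walkSum_nonneg s k v [] fun u _ => h u

theorem walkOp_const_mul (c : ℝ) (s k : ℕ) (f : Fin n → ℝ) (v : Fin n) :
    walkOp G K s k (fun u => c * f u) v = c * walkOp G K s k f v :=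
  walkSum_const_mul c k (fun u _ => f u) s v []

theorem walkOp_finset_sum {ι : Type*} (I : Finset ι) (s k : ℕ) (f : ι → Fin n → ℝ) (v : Fin n) :
    walkOp G K s k (fun u => ∑ i ∈ I, f i u) v = ∑ i ∈ I, walkOp G K s k (f i) v :=
  walkSum_finset_sum I k (fun i u _ => f i u) s v []

theorem walkOp_le_of_le (s k : ℕ) {f : Fin n → ℝ} {c : ℝ} (h : ∀ u, f u ≤ c) (v : Fin n) :
    walkOp G K s k f v ≤ c * walkOp G K s k (fun _ => 1) v := by
  rw [← walkOp_const_mul]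
  exact walkOp_mono s k (by simpa using h) v

theorem walkSum_le_of_le (s k : ℕ) {f : Fin n → List (Fin n) → ℝ} {c : ℝ} (v : Fin n)
    (l : List (Fin n)) (h : ∀ u l', l'.length = k + l.length → f u l' ≤ c) :
    walkSum G K s k f v l ≤ c * walkOp G K s k (fun _ => 1) v := by
  rw [← walkSum_eq_walkOp k _ s v l, ← walkSum_const_mul]
  exact walkSum_mono k s v l (by simpa using h)

theorem sum_mul_walkOp (k : ℕ) (g : Fin n → ℝ) :
    ∀ (s : ℕ) (f : Fin n → ℝ), ∑ v, f v * walkOp G K s k g v =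
      ∑ v, walkOp G K (s + k + 1) k f v * g v := by
  induction k with
  | zero => intro s f; rfl
  | succ k ih =>
    intro s f
    have h1 : ∑ v, f v * walkOp G K s (k + 1) g v =
        ∑ v, (∑ u ∈ nb (altGraph G K s) v, f u) * walkOp G K (s + 1) k g v := by
      simp only [walkOp_succ, Finset.mul_sum, Finset.sum_mul]
      exact sum_nb_comm _ _
    rw [h1, ih]
    refine Finset.sum_congr rfl fun v _ => ?_
    congr 1
    rw [walkOp_add, walkOp_congr_mod (s := s + 1 + k + 1) (s' := s + (k + 1) + 1) (by omega)]
    congr 1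
    ext u
    rw [walkOp_succ]
    simp only [walkOp_zero]
    rw [altGraph_congr (i := s + (k + 1) + 1 + k) (j := s) (by omega)]

/-- The states reached by the walks counted by `walkSum`. -/
def walkSet (G K : SimpleGraph (Fin n)) :
    ℕ → ℕ → Fin n → List (Fin n) → Finset (Fin n × List (Fin n))
  | _, 0, v, l => {(v, l)}
  | s, k + 1, v, l => (nb (altGraph G K s) v).biUnion fun u => walkSet G K (s + 1) k u (v :: l)

theorem walkSet_suffix (k : ℕ) : ∀ (s : ℕ) (v : Fin n) (l : List (Fin n))
    (w : Fin n × List (Fin n)), w ∈ walkSet G K s k v l →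
      (v :: l) <:+ (w.1 :: w.2) ∧ w.2.length = k + l.length := by
  induction k with
  | zero =>
    intro s v l w hw
    simp only [walkSet, Finset.mem_singleton] at hw
    simp [hw]
  | succ k ih =>
    intro s v l w hw
    simp only [walkSet, Finset.mem_biUnion] at hw
    obtain ⟨u, _, hw⟩ := hw
    obtain ⟨h1, h2⟩ := ih _ _ _ _ hw
    refine ⟨(List.suffix_cons u (v :: l)).trans h1, ?_⟩
    simp at h2
    omega

theorem walkSum_eq_sum_walkSet (k : ℕ) (f : Fin n → List (Fin n) → ℝ) :
    ∀ (s : ℕ) (v : Fin n) (l : List (Fin n)),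
      walkSum G K s k f v l = ∑ w ∈ walkSet G K s k v l, f w.1 w.2 := by
  induction k with
  | zero => intro s v l; simp [walkSet, walkSum_zero]
  | succ k ih =>
    intro s v l
    rw [walkSum_succ, walkSet, Finset.sum_biUnion]
    · exact Finset.sum_congr rfl fun u _ => ih _ _ _
    · intro u _ u' _ huu
      rw [Function.onFun, Finset.disjoint_left]
      intro w hw hw'
      have h1 := (walkSet_suffix _ _ _ _ _ hw).1
      have h2 := (walkSet_suffix _ _ _ _ _ hw').1
      have h3 := (List.suffix_of_suffix_length_le h1 h2 (by simp)).eq_of_length (by simp)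
      simp only [List.cons.injEq] at h3
      exact huu h3.1

end Basic

/-- The vertices outside `U` with exactly one neighbour in `U`. -/
def uniq (H : SimpleGraph (Fin n)) (U : Finset (Fin n)) : Finset (Fin n) :=
  Finset.univ.filter fun z => z ∉ U ∧ (nb H z ∩ U).card = 1

/-- The number of pairs `(x, z)` with `x ∈ U` and `z` adjacent to `x` such that `z` lies in `U` or
has another neighbour in `U`. -/
def disc (H : SimpleGraph (Fin n)) (U : Finset (Fin n)) : ℝ :=
  ∑ x ∈ U, ((nb H x \ uniq H U).card : ℝ)

/-- The pseudorandomness conditions on a pair of graphs `G`, `K` used to count alternating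
paths. -/
structure IsPseudo (G K : SimpleGraph (Fin n)) (d : ℕ) (δ lam L : ℝ) (q : ℕ) : Prop where
  lam_pos : 0 < lam
  lam_le : lam ≤ 1 / 10 ^ 10
  one_le_L : 1 ≤ L
  d_large : 10 ^ 10 * L ≤ d
  δ_large : 10 ^ 10 * L ≤ lam * δ
  n_large : 10 ^ 20 * (d : ℝ) ^ 3 * δ ^ 3 * L ≤ lam * n
  q_le : (q : ℝ) ≤ L
  n_le : (n : ℝ) ≤ (d * δ) ^ q
  degK : ∀ v, (nb K v).card = d
  degG_ge : ∀ v, (1 - lam) * δ ≤ (nb G v).card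
  degG_le : ∀ v, ((nb G v).card : ℝ) ≤ (1 + lam) * δ
  two_step_ge : ∀ v, (1 - lam / L) * (d * δ) * (nb G v).card ≤
    ∑ u ∈ nb G v, ∑ u' ∈ nb K u, ((nb G u').card : ℝ)
  two_step_le : ∀ v, ∑ u ∈ nb G v, ∑ u' ∈ nb K u, ((nb G u').card : ℝ) ≤
    (1 + lam / L) * (d * δ) * (nb G v).card
  disc_K : ∀ U U' : Finset (Fin n), δ * U'.card ≤ 4 * U.card → U ⊆ U' ∪ U'.biUnion (nb G) →
    (U.card : ℝ) ≤ lam * n / (10 ^ 6 * d * L) → disc K U ≤ 2 * (lam / L) * d * U.card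
  disc_K' : ∀ U U' : Finset (Fin n), δ * U'.card ≤ 4 * U.card → U ⊆ U' ∪ U'.biUnion (nb G) →
    (U.card : ℝ) ≤ lam * n / (10 ^ 6 * d) → disc K U ≤ 2 * lam * d * U.card
  disc_G : ∀ U U' : Finset (Fin n), (d : ℝ) * U'.card ≤ 4 * U.card →
    U ⊆ U' ∪ U'.biUnion (nb K) → (U.card : ℝ) ≤ lam * n / (100 * δ * L) →
    disc G U ≤ 2 * (lam / L) * δ * U.card
  mix : ∀ U V : Finset (Fin n), Disjoint U V → lam * n / 10 ^ 8 ≤ U.card →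
    lam * n / 10 ^ 8 ≤ V.card →
    (1 - lam) * (δ / n) * U.card * V.card ≤ ∑ v ∈ V, ((nb G v ∩ U).card : ℝ)

/-- The approximate number of alternating walks of length `k` whose first step has index `s`. -/
def prodDeg (d : ℕ) (δ : ℝ) : ℕ → ℕ → ℝ
  | _, 0 => 1
  | s, k + 1 => (if s % 2 = 0 then δ else d) * prodDeg d δ (s + 1) k

section ProdDeg

variable {d : ℕ} {δ : ℝ}

theorem prodDeg_congr_mod (k : ℕ) : ∀ {s s' : ℕ}, s % 2 = s' % 2 →
    prodDeg d δ s k = prodDeg d δ s' k := by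
  induction k with
  | zero => intro s s' _; rfl
  | succ k ih =>
    intro s s' h
    simp only [prodDeg]
    rw [h, ih (s := s + 1) (s' := s' + 1) (by omega)]

theorem prodDeg_add (i j : ℕ) : ∀ s : ℕ,
    prodDeg d δ s (i + j) = prodDeg d δ s i * prodDeg d δ (s + i) j := by
  induction i with
  | zero => intro s; simp [prodDeg]
  | succ i ih =>
    intro s
    rw [show i + 1 + j = i + j + 1 by ring]
    simp only [prodDeg]
    rw [ih, show s + 1 + i = s + (i + 1) by ring, mul_assoc]

theorem prodDeg_two (s : ℕ) : prodDeg d δ s 2 = d * δ := by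
  rcases Nat.mod_two_eq_zero_or_one s with h | h
  · have : (s + 1) % 2 ≠ 0 := by omega
    simp [prodDeg, h, this, mul_comm]
  · have : (s + 1) % 2 = 0 := by omega
    simp [prodDeg, h, this]

theorem prodDeg_two_mul (s m : ℕ) : prodDeg d δ s (2 * m) = (d * δ) ^ m := by
  induction m with
  | zero => simp [prodDeg]
  | succ m ih =>
    rw [show 2 * (m + 1) = 2 * m + 2 by ring, prodDeg_add, ih, prodDeg_two, pow_succ]

theorem prodDeg_nonneg (hδ : 0 ≤ δ) (k : ℕ) : ∀ s, 0 ≤ prodDeg d δ s k := by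
  induction k with
  | zero => intro s; simp [prodDeg]
  | succ k ih =>
    intro s
    simp only [prodDeg]
    have := ih (s + 1)
    split_ifs <;> positivity

end ProdDeg

theorem one_add_pow_le {x : ℝ} (hx : 0 ≤ x) (m : ℕ) (h : m * x ≤ 1 / 2) :
    (1 + x) ^ m ≤ 1 + 2 * (m * x) := by
  induction m with
  | zero => simp
  | succ m ih =>
    push_cast at h ⊢
    have hm : (m : ℝ) * x ≤ 1 / 2 := by nlinarith
    have h1 := ih hm
    have h2 : 0 ≤ (m : ℝ) * x := by positivity
    rw [pow_succ]
    nlinarith [mul_le_mul_of_nonneg_right h1 (by positivity : 0 ≤ 1 + x)]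

theorem le_one_sub_pow {x : ℝ} (hx1 : x ≤ 1) (m : ℕ) : 1 - m * x ≤ (1 - x) ^ m := by
  have := one_add_mul_le_pow (a := -x) (by linarith) m
  simpa [sub_eq_add_neg] using this

namespace IsPseudo

variable {G K : SimpleGraph (Fin n)} {d : ℕ} {δ lam L : ℝ} {q : ℕ}

theorem L_pos (h : IsPseudo G K d δ lam L q) : 0 < L := by linarith [h.one_le_L]

theorem d_pos (h : IsPseudo G K d δ lam L q) : (0 : ℝ) < d := by
  linarith [h.one_le_L, h.d_large]

theorem δ_big (h : IsPseudo G K d δ lam L q) : 10 ^ 20 * L ≤ δ := by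
  have h1 := h.δ_large
  have h2 := h.lam_le
  have h3 := h.lam_pos
  have h4 := h.one_le_L
  have hδ : 0 < δ := by
    by_contra hc
    nlinarith
  nlinarith

theorem δ_pos (h : IsPseudo G K d δ lam L q) : 0 < δ := by
  linarith [h.one_le_L, h.δ_big]

theorem D_pos (h : IsPseudo G K d δ lam L q) : 0 < d * δ := mul_pos h.d_pos h.δ_pos

theorem eta_pos (h : IsPseudo G K d δ lam L q) : 0 < lam / L := div_pos h.lam_pos h.L_pos

theorem eta_le (h : IsPseudo G K d δ lam L q) : lam / L ≤ lam :=
  div_le_self h.lam_pos.le h.one_le_L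

theorem mul_eta_le (h : IsPseudo G K d δ lam L q) {x c : ℝ} (hx : x ≤ c * L) :
    x * (lam / L) ≤ c * lam := by
  have := mul_le_mul_of_nonneg_right hx h.eta_pos.le
  have h2 := h.L_pos.ne'
  calc x * (lam / L) ≤ c * L * (lam / L) := this
    _ = c * lam := by field_simp

theorem card_nb_K (h : IsPseudo G K d δ lam L q) (v : Fin n) : ((nb K v).card : ℝ) = d := by
  rw [h.degK]

theorem walkOp_degree (h : IsPseudo G K d δ lam L q) (m : ℕ) : ∀ v,
    (1 - lam / L) ^ m * (d * δ) ^ m * (nb G v).card ≤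
        walkOp G K 0 (2 * m) (fun u => ((nb G u).card : ℝ)) v ∧
      walkOp G K 0 (2 * m) (fun u => ((nb G u).card : ℝ)) v ≤
        (1 + lam / L) ^ m * (d * δ) ^ m * (nb G v).card := by
  have he : lam / L ≤ 1 := by linarith [h.eta_le, h.lam_le]
  have he0 := h.eta_pos
  have hD := h.D_pos
  have h2 : ∀ v, walkOp G K 0 2 (fun u => ((nb G u).card : ℝ)) v =
      ∑ u ∈ nb G v, ∑ u' ∈ nb K u, ((nb G u').card : ℝ) := by
    intro v
    simp [walkOp_succ, walkOp_zero, altGraph]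
  induction m with
  | zero => intro v; simp [walkOp_zero]
  | succ m ih =>
    intro v
    have h3 : walkOp G K 0 (2 * (m + 1)) (fun u => ((nb G u).card : ℝ)) v =
        walkOp G K 0 2 (walkOp G K 0 (2 * m) (fun u => ((nb G u).card : ℝ))) v := by
      rw [show 2 * (m + 1) = 2 + 2 * m by ring, walkOp_add]
      congr 1
      ext u
      exact walkOp_congr_mod (by omega) _ _ _
    rw [h3]
    constructor
    · refine le_trans ?_ (walkOp_mono 0 2 (fun u => (ih u).1) v)
      rw [walkOp_const_mul, h2]
      have := mul_le_mul_of_nonneg_left (h.two_step_ge v)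
        (by have : 0 ≤ 1 - lam / L := by linarith
            positivity : 0 ≤ (1 - lam / L) ^ m * (d * δ) ^ m)
      refine le_trans (le_of_eq ?_) this
      ring
    · refine le_trans (walkOp_mono 0 2 (fun u => (ih u).2) v) ?_
      rw [walkOp_const_mul, h2]
      have := mul_le_mul_of_nonneg_left (h.two_step_le v)
        (by positivity : 0 ≤ (1 + lam / L) ^ m * (d * δ) ^ m)
      refine le_trans this (le_of_eq ?_)
      ring

theorem walkOp_degree_bounds (h : IsPseudo G K d δ lam L q) (m : ℕ) (hm : (m : ℝ) ≤ 13 * L)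
    (v : Fin n) :
    (1 - 30 * lam) * ((d * δ) ^ m * δ) ≤
        walkOp G K 0 (2 * m) (fun u => ((nb G u).card : ℝ)) v ∧
      walkOp G K 0 (2 * m) (fun u => ((nb G u).card : ℝ)) v ≤
        (1 + 30 * lam) * ((d * δ) ^ m * δ) := by
  have h1 := h.walkOp_degree m v
  have he : lam / L ≤ 1 := by linarith [h.eta_le, h.lam_le]
  have he0 := h.eta_pos
  have hD := h.D_pos
  have hl := h.lam_pos
  have hl' := h.lam_le
  have hδ := h.δ_pos
  have hm' := h.mul_eta_le hm
  have h2 := one_add_pow_le he0.le m (by linarith)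
  have h3 := le_one_sub_pow he m
  have hDm : 0 < (d * δ : ℝ) ^ m := by positivity
  constructor
  · refine le_trans ?_ h1.1
    have h4 : (1 - 13 * lam) * ((d * δ) ^ m * ((1 - lam) * δ)) ≤
        (1 - lam / L) ^ m * ((d * δ) ^ m * (nb G v).card) := by
      have h5 := h.degG_ge v
      have h6 : 0 ≤ (1 - lam) * δ := by
        have : 0 ≤ 1 - lam := by linarith
        positivity
      have h7 : 1 - 13 * lam ≤ (1 - lam / L) ^ m := by linarith
      have h8 : 0 ≤ 1 - 13 * lam := by linarith
      gcongr
    refine le_trans ?_ (h4.trans (le_of_eq (by ring)))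
    have : 1 - 30 * lam ≤ (1 - 13 * lam) * (1 - lam) := by nlinarith
    calc _ ≤ ((1 - 13 * lam) * (1 - lam)) * ((d * δ) ^ m * δ) := by gcongr
      _ = _ := by ring
  · refine h1.2.trans ?_
    have h4 : (1 + lam / L) ^ m * ((d * δ) ^ m * (nb G v).card) ≤
        (1 + 26 * lam) * ((d * δ) ^ m * ((1 + lam) * δ)) := by
      have h5 := h.degG_le v
      have h7 : (1 + lam / L) ^ m ≤ 1 + 26 * lam := by linarith
      gcongr
    refine (le_of_eq (by ring)).trans (h4.trans ?_)
    have : (1 + 26 * lam) * (1 + lam) ≤ 1 + 30 * lam := by nlinarith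
    calc _ = ((1 + 26 * lam) * (1 + lam)) * ((d * δ) ^ m * δ) := by ring
      _ ≤ _ := by gcongr

theorem walkOp_one (h : IsPseudo G K d δ lam L q) (s k : ℕ) (hk : (k : ℝ) ≤ 25 * L)
    (v : Fin n) :
    (1 - 30 * lam) * prodDeg d δ s k ≤ walkOp G K s k (fun _ => 1) v ∧
      walkOp G K s k (fun _ => 1) v ≤ (1 + 30 * lam) * prodDeg d δ s k := by
  have hl := h.lam_pos
  have hL := h.one_le_L
  have hd := h.d_pos
  have even : ∀ (k : ℕ), (k : ℝ) ≤ 25 * L → ∀ v,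
      (1 - 30 * lam) * prodDeg d δ 0 k ≤ walkOp G K 0 k (fun _ => 1) v ∧
      walkOp G K 0 k (fun _ => 1) v ≤ (1 + 30 * lam) * prodDeg d δ 0 k := by
    intro k hk v
    rcases Nat.even_or_odd' k with ⟨m, rfl | rfl⟩
    · rcases m with _ | m
      · simp [walkOp_zero, prodDeg]
        exact hl.le
      · have h1 : walkOp G K 0 (2 * (m + 1)) (fun _ => 1) v =
            d * walkOp G K 0 (2 * m) (fun u => ((nb G u).card : ℝ)) v := by
          rw [show 2 * (m + 1) = 2 * m + 2 by ring, walkOp_add, ← walkOp_const_mul]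
          congr 1
          ext u
          have h0 : (0 + 2 * m) % 2 = 0 := by omega
          have h1 : (0 + 2 * m + 1) % 2 ≠ 0 := by omega
          simp only [walkOp_succ, walkOp_zero, altGraph, h0, h1, if_true, if_false]
          simp [h.degK, mul_comm]
        have h2 := h.walkOp_degree_bounds m (by push_cast at hk; linarith) v
        rw [h1, prodDeg_two_mul, pow_succ]
        constructor
        · calc _ = d * ((1 - 30 * lam) * ((d * δ) ^ m * δ)) := by ring
            _ ≤ _ := by gcongr; exact h2.1
        · calc _ ≤ d * ((1 + 30 * lam) * ((d * δ) ^ m * δ)) := by gcongr; exact h2.2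
            _ = _ := by ring
    · have h1 : walkOp G K 0 (2 * m + 1) (fun _ => 1) v =
          walkOp G K 0 (2 * m) (fun u => ((nb G u).card : ℝ)) v := by
        rw [walkOp_add]
        congr 1
        ext u
        have h0 : (0 + 2 * m) % 2 = 0 := by omega
        simp only [walkOp_succ, walkOp_zero, altGraph, h0, if_true]
        simp
      have h2 := h.walkOp_degree_bounds m (by push_cast at hk; linarith) v
      have h3 : prodDeg d δ 0 (2 * m + 1) = (d * δ) ^ m * δ := by
        have h0 : (0 + 2 * m) % 2 = 0 := by omega
        rw [prodDeg_add, prodDeg_two_mul]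
        simp [prodDeg]
      rw [h1, h3]
      exact h2
  rcases Nat.mod_two_eq_zero_or_one s with hs | hs
  · rw [walkOp_congr_mod (s' := 0) (by omega), prodDeg_congr_mod (s' := 0) k (by omega)]
    exact even k hk v
  · rcases k with _ | k
    · simp [walkOp_zero, prodDeg]
      exact hl.le
    · have h1 : walkOp G K s (k + 1) (fun _ => 1) v =
          ∑ u ∈ nb K v, walkOp G K 0 k (fun _ => 1) u := by
        rw [walkOp_succ]
        have : altGraph G K s = K := by simp [altGraph, hs]
        rw [this]
        exact Finset.sum_congr rfl fun u _ => walkOp_congr_mod (by omega) _ _ _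
      have h2 : prodDeg d δ s (k + 1) = d * prodDeg d δ 0 k := by
        simp only [prodDeg, hs, one_ne_zero, if_false]
        rw [prodDeg_congr_mod (s' := 0) k (by omega)]
      have hk' : (k : ℝ) ≤ 25 * L := by push_cast at hk; linarith
      rw [h1, h2, ← h.card_nb_K v, ← nsmul_eq_mul]
      constructor
      · rw [mul_smul_comm]
        exact Finset.card_nsmul_le_sum _ _ _ fun u _ => (even k hk' u).1
      · rw [mul_smul_comm]
        exact Finset.sum_le_card_nsmul _ _ _ fun u _ => (even k hk' u).2

theorem walkOp_one_le (h : IsPseudo G K d δ lam L q) (s k : ℕ) (hk : (k : ℝ) ≤ 25 * L)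
    (v : Fin n) : walkOp G K s k (fun _ => 1) v ≤ 2 * prodDeg d δ s k := by
  have h1 := (h.walkOp_one s k hk v).2
  have h2 := prodDeg_nonneg (d := d) h.δ_pos.le k s
  have := h.lam_le
  nlinarith

end IsPseudo

theorem disc_nonneg (H : SimpleGraph (Fin n)) (U : Finset (Fin n)) : 0 ≤ disc H U :=
  Finset.sum_nonneg fun _ _ => by positivity

theorem disc_singleton (H : SimpleGraph (Fin n)) (s : Fin n) : disc H {s} = 0 := by
  simp only [disc, Finset.sum_singleton, Nat.cast_eq_zero, Finset.card_eq_zero,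
    Finset.sdiff_eq_empty_iff_subset]
  intro z hz
  have h1 : s ∈ nb H z := mem_nb_comm.mp hz
  have h2 : z ≠ s := by
    rintro rfl
    simp [nb] at hz
  simp [uniq, h2, Finset.inter_singleton_of_mem h1]

theorem sum_card_inter_comm (H : SimpleGraph (Fin n)) (U A : Finset (Fin n)) :
    ∑ x ∈ U, ((nb H x ∩ A).card : ℝ) = ∑ z ∈ A, ((nb H z ∩ U).card : ℝ) := by
  have h1 : ∀ (x : Fin n) (B : Finset (Fin n)),
      ((nb H x ∩ B).card : ℝ) = ∑ z ∈ B, if H.Adj x z then (1 : ℝ) else 0 := by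
    intro x B
    rw [Finset.sum_boole, Finset.inter_comm]
    congr 2
    ext z
    simp [mem_nb]
  simp only [h1]
  rw [Finset.sum_comm]
  simp only [H.adj_comm]

theorem sum_card_nb_inter_uniq (H : SimpleGraph (Fin n)) (U A : Finset (Fin n))
    (hA : A ⊆ uniq H U) : ∑ x ∈ U, ((nb H x ∩ A).card : ℝ) = A.card := by
  rw [sum_card_inter_comm, Finset.sum_congr rfl (g := fun _ => (1 : ℝ))]
  · simp
  · intro z hz
    have := hA hz
    simp only [uniq, Finset.mem_filter] at this
    rw [this.2.2]
    simp

theorem sum_card_nb_inter_le (H : SimpleGraph (Fin n)) (U A : Finset (Fin n)) :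
    ∑ x ∈ U, ((nb H x ∩ A).card : ℝ) ≤ A.card + disc H U := by
  have h1 : ∀ x ∈ U, ((nb H x ∩ A).card : ℝ) ≤
      ((nb H x ∩ (A ∩ uniq H U)).card : ℝ) + ((nb H x \ uniq H U).card : ℝ) := by
    intro x _
    rw [← Nat.cast_add]
    refine Nat.cast_le.mpr (le_trans (Finset.card_le_card ?_) (Finset.card_union_le _ _))
    intro z
    simp only [Finset.mem_inter, Finset.mem_union, Finset.mem_sdiff]
    tauto
  refine (Finset.sum_le_sum h1).trans ?_
  rw [Finset.sum_add_distrib, sum_card_nb_inter_uniq H U _ Finset.inter_subset_right]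
  have : ((A ∩ uniq H U).card : ℝ) ≤ A.card :=
    Nat.cast_le.mpr (Finset.card_le_card Finset.inter_subset_left)
  simpa [disc] using this

namespace IsPseudo

variable {G K : SimpleGraph (Fin n)} {d : ℕ} {δ lam L : ℝ} {q : ℕ}

theorem one_le_d (h : IsPseudo G K d δ lam L q) : (1 : ℝ) ≤ d := by
  linarith [h.one_le_L, h.d_large]

theorem one_le_δ (h : IsPseudo G K d δ lam L q) : 1 ≤ δ := by
  linarith [h.one_le_L, h.δ_big]

theorem card_nb_G_le (h : IsPseudo G K d δ lam L q) (v : Fin n) :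
    ((nb G v).card : ℝ) ≤ 2 * δ := by
  have h1 := h.degG_le v
  have h2 := h.lam_le
  have h3 := h.δ_pos
  nlinarith

theorem n_bound (h : IsPseudo G K d δ lam L q) {a b c : ℕ} (ha : a ≤ 3) (hb : b ≤ 3) (hc : c ≤ 1) :
    10 ^ 20 * (d : ℝ) ^ a * δ ^ b * L ^ c ≤ lam * n := by
  refine le_trans ?_ h.n_large
  have h1 := pow_le_pow_right₀ h.one_le_d ha
  have h2 := pow_le_pow_right₀ h.one_le_δ hb
  have h3 := pow_le_pow_right₀ h.one_le_L hc
  have := h.δ_pos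
  have := h.L_pos
  rw [pow_one] at h3
  gcongr

theorem disc_nb (h : IsPseudo G K d δ lam L q) (s : ℕ) (v : Fin n) :
    disc (altGraph G K (s + 1)) (nb (altGraph G K s) v) ≤ 3 * (lam / L) * (d * δ) := by
  have hL := h.L_pos
  have hδ := h.δ_pos
  have hd := h.d_pos
  have hη := h.eta_pos
  rcases Nat.mod_two_eq_zero_or_one s with hs | hs
  · have h0 : (s + 1) % 2 ≠ 0 := by omega
    simp only [altGraph, hs, h0, if_true, if_false]
    have h1 := h.card_nb_G_le v
    have h2 := h.degG_ge v
    have h3 := h.lam_le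
    refine (h.disc_K (nb G v) {v} ?_ ?_ ?_).trans ?_
    · simp
      nlinarith
    · simp
    · rw [le_div_iff₀ (by positivity)]
      have h4 := h.n_bound (a := 1) (b := 1) (c := 1) (by norm_num) (by norm_num) le_rfl
      have h5 : ((nb G v).card : ℝ) * (10 ^ 6 * d * L) ≤ 2 * δ * (10 ^ 6 * d * L) := by gcongr
      have h6 : 0 < d * δ * L := by positivity
      nlinarith
    · have h5 := h.degG_le v
      calc _ ≤ 2 * (lam / L) * d * ((1 + lam) * δ) := by gcongr
        _ = (2 * (1 + lam)) * ((lam / L) * (d * δ)) := by ring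
        _ ≤ 3 * ((lam / L) * (d * δ)) := by gcongr; linarith
        _ = _ := by ring
  · have h0 : (s + 1) % 2 = 0 := by omega
    simp only [altGraph, hs, h0, if_true, one_ne_zero, if_false]
    refine (h.disc_G (nb K v) {v} ?_ ?_ ?_).trans ?_
    · simp [h.degK]
      linarith
    · simp
    · rw [h.card_nb_K, le_div_iff₀ (by positivity)]
      have h4 := h.n_bound (a := 1) (b := 1) (c := 1) (by norm_num) (by norm_num) le_rfl
      have h6 : 0 < d * δ * L := by positivity
      nlinarith
    · rw [h.card_nb_K]
      have h6 : 0 < (lam / L) * (d * δ) := by positivity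
      nlinarith

theorem two_step_hit (h : IsPseudo G K d δ lam L q) (s : ℕ) (A : Finset (Fin n)) (v : Fin n) :
    walkOp G K s 2 (fun u => if u ∈ A then 1 else 0) v ≤ A.card + 3 * (lam / L) * (d * δ) := by
  have h1 : walkOp G K s 2 (fun u => if u ∈ A then (1 : ℝ) else 0) v =
      ∑ x ∈ nb (altGraph G K s) v, ((nb (altGraph G K (s + 1)) x ∩ A).card : ℝ) := by
    simp [walkOp_succ, walkOp_zero]
  rw [h1]
  have h2 := sum_card_nb_inter_le (altGraph G K (s + 1)) (nb (altGraph G K s) v) A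
  linarith [h.disc_nb s v]

theorem small_le (h : IsPseudo G K d δ lam L q) : 100 * L ≤ 3 * (lam / L) * (d * δ) := by
  have hL := h.L_pos
  have h1 := h.d_large
  have h2 := h.δ_large
  have h3 : 10 ^ 10 * L * (10 ^ 10 * L) ≤ d * (lam * δ) := by
    have := h.d_pos
    gcongr
  have h5 : 3 * (lam / L) * (d * δ) = 3 * (d * (lam * δ)) / L := by field_simp
  rw [h5, le_div_iff₀ hL]
  nlinarith [mul_pos hL hL]

theorem two_step_hit_small (h : IsPseudo G K d δ lam L q) (s : ℕ) (A : Finset (Fin n))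
    (hA : (A.card : ℝ) ≤ 100 * L) (v : Fin n) :
    walkOp G K s 2 (fun u => if u ∈ A then 1 else 0) v ≤ 6 * (lam / L) * (d * δ) := by
  linarith [h.two_step_hit s A v, h.small_le]

end IsPseudo

/-- The number of hits along a walk, where `hf u l` counts a hit at a vertex `u` reached after the
vertices in the list `l`. -/
def cum (hf : Fin n → List (Fin n) → ℝ) : List (Fin n) → ℝ
  | [] => 0
  | u :: l => hf u l + cum hf l

/-- The hit function of a set `S`. -/
def hitSet (S : Finset (Fin n)) (u : Fin n) (_ : List (Fin n)) : ℝ := if u ∈ S then 1 else 0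

/-- The hit function of a set `S` together with the earlier vertices of the walk. -/
def hitMem (S : Finset (Fin n)) (u : Fin n) (l : List (Fin n)) : ℝ :=
  if u ∈ l ∨ u ∈ S then 1 else 0

theorem hitSet_nonneg (S : Finset (Fin n)) (u : Fin n) (l : List (Fin n)) : 0 ≤ hitSet S u l := by
  unfold hitSet; split_ifs <;> norm_num

theorem hitMem_nonneg (S : Finset (Fin n)) (u : Fin n) (l : List (Fin n)) : 0 ≤ hitMem S u l := by
  unfold hitMem; split_ifs <;> norm_num

theorem cum_nonneg {hf : Fin n → List (Fin n) → ℝ} (h : ∀ u l, 0 ≤ hf u l) (l : List (Fin n)) :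
    0 ≤ cum hf l := by
  induction l with
  | nil => exact le_rfl
  | cons u l ih => exact add_nonneg (h u l) ih

theorem one_le_cum_hitSet {S : Finset (Fin n)} {l : List (Fin n)} (h : ∃ u ∈ l, u ∈ S) :
    1 ≤ cum (hitSet S) l := by
  induction l with
  | nil => simp at h
  | cons u l ih =>
    have h0 := cum_nonneg (hitSet_nonneg S) l
    have h1 := hitSet_nonneg S u l
    rw [cum]
    by_cases hu : u ∈ S
    · simp only [hitSet, hu, if_true]; linarith
    · have := ih (by simpa [hu] using h)
      linarith

theorem cum_hitSet_eq_zero {S : Finset (Fin n)} {l : List (Fin n)} (h : ∀ u ∈ l, u ∉ S) :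
    cum (hitSet S) l = 0 := by
  induction l with
  | nil => rfl
  | cons u l ih =>
    rw [cum, ih fun v hv => h v (by simp [hv])]
    simp [hitSet, h u (by simp)]

theorem one_le_cum_hitMem {S : Finset (Fin n)} {l : List (Fin n)}
    (h : ¬ (l.Nodup ∧ ∀ u ∈ l, u ∉ S)) : 1 ≤ cum (hitMem S) l := by
  induction l with
  | nil => simp at h
  | cons u l ih =>
    have h0 := cum_nonneg (hitMem_nonneg S) l
    have h1 := hitMem_nonneg S u l
    rw [cum]
    by_cases hu : u ∈ l ∨ u ∈ S
    · simp only [hitMem, hu, if_true]; linarith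
    · have := ih (fun hl => h (by
        rw [not_or] at hu
        simp only [List.nodup_cons, List.mem_cons, forall_eq_or_imp]
        exact ⟨⟨hu.1, hl.1⟩, hu.2, hl.2⟩))
      linarith

section Walk

variable {G K : SimpleGraph (Fin n)}

theorem walkSum_mul_cum (hf : Fin n → List (Fin n) → ℝ) (a : Fin n → ℝ) (k : ℕ) :
    ∀ (s : ℕ) (v : Fin n) (l : List (Fin n)),
      walkSum G K s k (fun u l' => a u * cum hf (u :: l')) v l =
        cum hf (v :: l) * walkOp G K s k a v +
          ∑ i ∈ Finset.range k, walkSum G K s (i + 1)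
            (fun u l' => hf u l' * walkOp G K (s + (i + 1)) (k - (i + 1)) a u) v l := by
  induction k with
  | zero => intro s v l; simp [walkSum_zero, walkOp_zero, mul_comm]
  | succ k ih =>
    intro s v l
    rw [walkSum_succ]
    simp only [ih]
    rw [Finset.sum_range_succ', Finset.sum_add_distrib, walkOp_succ, Finset.mul_sum]
    have h1 : ∀ u, cum hf (u :: v :: l) * walkOp G K (s + 1) k a u =
        cum hf (v :: l) * walkOp G K (s + 1) k a u + hf u (v :: l) * walkOp G K (s + 1) k a u := by
      intro u
      rw [cum.eq_2 hf u]
      ring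
    simp only [h1]
    rw [Finset.sum_add_distrib, Finset.sum_comm, add_assoc, add_comm (∑ u ∈ _, hf u _ * _)]
    congr 2
    refine Finset.sum_congr rfl fun i _ => ?_
    rw [walkSum_succ]
    refine Finset.sum_congr rfl fun u _ => ?_
    congr 1
    funext w l'
    rw [show s + 1 + (i + 1) = s + (i + 1 + 1) by ring,
      show k + 1 - (i + 1 + 1) = k - (i + 1) by omega]

theorem walkSum_hitMem_one_le (S : Finset (Fin n)) (s : ℕ) (v : Fin n) (l : List (Fin n)) :
    walkSum G K s 1 (hitMem S) v l ≤ S.card + l.length + 1 := by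
  rw [walkSum_succ]
  simp only [walkSum_zero, hitMem, Finset.sum_boole]
  have h1 : (nb (altGraph G K s) v).filter (fun u => u ∈ v :: l ∨ u ∈ S) ⊆
      S ∪ (v :: l).toFinset := by
    intro u
    simp only [Finset.mem_filter, Finset.mem_union, List.mem_toFinset]
    tauto
  have h2 := (Finset.card_le_card h1).trans (Finset.card_union_le _ _)
  have h3 := List.toFinset_card_le (v :: l)
  simp only [List.length_cons] at h3
  exact_mod_cast h2.trans (by omega)

theorem walkSum_hitSet_one_le (S : Finset (Fin n)) (s : ℕ) (v : Fin n) (l : List (Fin n)) :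
    walkSum G K s 1 (hitSet S) v l ≤ S.card := by
  rw [walkSum_succ]
  simp only [walkSum_zero, hitSet, Finset.sum_boole, Nat.cast_le]
  exact Finset.card_le_card (by intro u; simp)

theorem walkSum_hitMem_two_le (S : Finset (Fin n)) (s : ℕ) (v : Fin n) (l : List (Fin n)) :
    walkSum G K s 2 (hitMem S) v l ≤
      walkOp G K s 2 (fun u => if u ∈ S ∪ (v :: l).toFinset then 1 else 0) v := by
  simp only [walkSum_succ, walkOp_succ, walkSum_zero, walkOp_zero]
  refine Finset.sum_le_sum fun u _ => Finset.sum_le_sum fun w hw => ?_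
  have hwu : w ≠ u := by
    rintro rfl
    simp [nb] at hw
  simp only [hitMem, Finset.mem_union, List.mem_toFinset, List.mem_cons, hwu, false_or]
  split_ifs <;> first | exact le_rfl | exact zero_le_one | (exfalso; tauto)

end Walk

namespace IsPseudo

variable {G K : SimpleGraph (Fin n)} {d : ℕ} {δ lam L : ℝ} {q : ℕ}

theorem walkSum_cum_le (h : IsPseudo G K d δ lam L q) {hf : Fin n → List (Fin n) → ℝ}
    (h0 : ∀ u l, 0 ≤ hf u l) {k : ℕ} (hk : (k : ℝ) ≤ 25 * L) (v : Fin n) (l : List (Fin n))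
    {B T : ℝ} (hT0 : 0 ≤ T) (hB : walkSum G K 0 1 hf v l ≤ B)
    (hT : ∀ s v' l', l'.length ≤ k + l.length → walkSum G K s 2 hf v' l' ≤ T) :
    walkSum G K 0 k (fun u l' => cum hf (u :: l')) v l ≤
      (2 * cum hf (v :: l) + (2 * B / δ + 100 * L * T / (d * δ))) * prodDeg d δ 0 k := by
  have hδ := h.δ_pos
  have hd := h.d_pos
  have hL := h.L_pos
  have hB0 : 0 ≤ B := le_trans (walkSum_nonneg 0 1 v l h0) hB
  have h1 := walkSum_mul_cum (G := G) (K := K) hf (fun _ => 1) k 0 v l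
  simp only [one_mul, zero_add] at h1
  rw [h1]
  have hP : ∀ k s, 0 ≤ prodDeg d δ s k := fun k s => prodDeg_nonneg hδ.le k s
  have h2 : cum hf (v :: l) * walkOp G K 0 k (fun _ => 1) v ≤
      2 * cum hf (v :: l) * prodDeg d δ 0 k := by
    have := mul_le_mul_of_nonneg_left (h.walkOp_one_le 0 k hk v) (cum_nonneg h0 (v :: l))
    linarith
  have h3 : ∀ i < k, walkSum G K 0 (i + 1)
      (fun u l' => hf u l' * walkOp G K (i + 1) (k - (i + 1)) (fun _ => 1) u) v l ≤
      2 * prodDeg d δ (i + 1) (k - (i + 1)) * walkSum G K 0 (i + 1) hf v l := by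
    intro i hi
    rw [← walkSum_const_mul]
    refine walkSum_mono' _ _ _ _ fun u l' => ?_
    rw [mul_comm (2 * _)]
    refine mul_le_mul_of_nonneg_left (h.walkOp_one_le _ _ ?_ u) (h0 u l')
    refine le_trans ?_ hk
    exact_mod_cast Nat.sub_le _ _
  have h4 : ∀ i < k, walkSum G K 0 (i + 1)
      (fun u l' => hf u l' * walkOp G K (i + 1) (k - (i + 1)) (fun _ => 1) u) v l ≤
      ((if i = 0 then 2 * B / δ else 0) + 4 * T / (d * δ)) * prodDeg d δ 0 k := by
    intro i hi
    refine (h3 i hi).trans ?_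
    have h5 : prodDeg d δ 0 k = prodDeg d δ 0 (i + 1) * prodDeg d δ (i + 1) (k - (i + 1)) := by
      conv_lhs => rw [show k = (i + 1) + (k - (i + 1)) by omega]
      rw [prodDeg_add, zero_add]
    have hPi := hP (k - (i + 1)) (i + 1)
    rcases i with _ | i
    · rw [h5]
      simp only [zero_add, if_true] at hPi ⊢
      have h6 : prodDeg d δ 0 1 = δ := by simp [prodDeg]
      rw [h6]
      have h7 : 0 ≤ 4 * T / (d * δ) * (δ * prodDeg d δ 1 (k - 1)) := by positivity
      calc 2 * prodDeg d δ 1 (k - 1) * walkSum G K 0 1 hf v l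
          ≤ 2 * prodDeg d δ 1 (k - 1) * B := by gcongr
        _ = 2 * B / δ * (δ * prodDeg d δ 1 (k - 1)) := by field_simp
        _ ≤ _ := by linarith
    · simp only [Nat.add_eq_zero_iff, one_ne_zero, and_false, if_false, zero_add]
      have h6 : walkSum G K 0 (i + 1 + 1) hf v l ≤ T * (2 * prodDeg d δ 0 i) := by
        rw [show i + 1 + 1 = i + 2 by ring, walkSum_add]
        refine (walkSum_le_of_le 0 i v l fun u l' hl' => hT _ _ _ (by omega)).trans ?_
        refine mul_le_mul_of_nonneg_left (h.walkOp_one_le _ _ ?_ v) hT0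
        refine le_trans ?_ hk
        exact_mod_cast (by omega)
      have h7 : prodDeg d δ 0 (i + 1 + 1) = prodDeg d δ 0 i * (d * δ) := by
        rw [show i + 1 + 1 = i + 2 by ring, prodDeg_add, prodDeg_two]
      rw [h5, h7]
      calc _ ≤ 2 * prodDeg d δ (i + 1 + 1) (k - (i + 1 + 1)) * (T * (2 * prodDeg d δ 0 i)) := by
            gcongr
        _ = _ := by field_simp; ring
  have h5 := Finset.sum_le_sum fun i (hi : i ∈ Finset.range k) => h4 i (Finset.mem_range.mp hi)
  rw [← Finset.sum_mul, Finset.sum_add_distrib] at h5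
  have h6 : ∑ i ∈ Finset.range k, (if i = 0 then 2 * B / δ else 0) ≤ 2 * B / δ := by
    rw [Finset.sum_ite_eq' (Finset.range k) 0 fun _ => 2 * B / δ]
    split_ifs
    · exact le_rfl
    · positivity
  have h7 : ∑ i ∈ Finset.range k, 4 * T / (d * δ) ≤ 100 * L * T / (d * δ) := by
    rw [Finset.sum_const, Finset.card_range, nsmul_eq_mul]
    calc (k : ℝ) * (4 * T / (d * δ)) ≤ 25 * L * (4 * T / (d * δ)) := by gcongr
      _ = _ := by ring
  have h8 := mul_le_mul_of_nonneg_right (add_le_add h6 h7) (hP k 0)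
  linarith

theorem cum_const (h : IsPseudo G K d δ lam L q) :
    100 * L * (6 * (lam / L) * (d * δ)) / (d * δ) = 600 * lam := by
  have := h.δ_pos
  have := h.d_pos
  have := h.L_pos
  field_simp
  ring

theorem small_div_le (h : IsPseudo G K d δ lam L q) : 2 * (100 * L) / δ ≤ lam := by
  rw [div_le_iff₀ h.δ_pos]
  linarith [h.δ_large, h.L_pos]

theorem walkSum_cum_hitMem_le (h : IsPseudo G K d δ lam L q) (S : Finset (Fin n)) {k : ℕ}
    (v : Fin n) (l : List (Fin n)) (hk : (k : ℝ) ≤ 25 * L)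
    (hS : (S.card + (k + l.length) + 1 : ℝ) ≤ 100 * L) :
    walkSum G K 0 k (fun u l' => cum (hitMem S) (u :: l')) v l ≤
      (2 * cum (hitMem S) (v :: l) + 601 * lam) * prodDeg d δ 0 k := by
  have h1 := h.walkSum_cum_le (hitMem_nonneg S) hk v l
    (B := 100 * L) (T := 6 * (lam / L) * (d * δ)) (by
      have := h.eta_pos
      have := h.D_pos
      positivity)
    ((walkSum_hitMem_one_le S 0 v l).trans (by linarith [Nat.cast_nonneg (α := ℝ) k]))
    (fun s v' l' hl' => (walkSum_hitMem_two_le S s v' l').trans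
      (h.two_step_hit_small s _ (by
        have h2 := Finset.card_union_le S (v' :: l').toFinset
        have h3 := List.toFinset_card_le (v' :: l')
        simp only [List.length_cons] at h3
        have h4 : (S ∪ (v' :: l').toFinset).card ≤ S.card + (k + l.length) + 1 := by omega
        have h5 : ((S ∪ (v' :: l').toFinset).card : ℝ) ≤ S.card + (k + l.length) + 1 := by
          exact_mod_cast h4
        linarith) v'))
  rw [h.cum_const] at h1
  refine h1.trans (mul_le_mul_of_nonneg_right ?_ (prodDeg_nonneg h.δ_pos.le _ _))
  linarith [h.small_div_le]

theorem walkSum_cum_hitSet_le (h : IsPseudo G K d δ lam L q) (S : Finset (Fin n)) {k : ℕ}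
    (v : Fin n) (l : List (Fin n)) (hk : (k : ℝ) ≤ 25 * L) (hS : (S.card : ℝ) ≤ 100 * L) :
    walkSum G K 0 k (fun u l' => cum (hitSet S) (u :: l')) v l ≤
      (2 * cum (hitSet S) (v :: l) + 601 * lam) * prodDeg d δ 0 k := by
  have h1 := h.walkSum_cum_le (hitSet_nonneg S) hk v l
    (B := 100 * L) (T := 6 * (lam / L) * (d * δ)) (by
      have := h.eta_pos
      have := h.D_pos
      positivity)
    ((walkSum_hitSet_one_le S 0 v l).trans hS)
    (fun s v' l' hl' => (walkSum_eq_walkOp 2 (fun u => if u ∈ S then 1 else 0) s v' l').le.trans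
      (h.two_step_hit_small s S hS v'))
  rw [h.cum_const] at h1
  refine h1.trans (mul_le_mul_of_nonneg_right ?_ (prodDeg_nonneg h.δ_pos.le _ _))
  linarith [h.small_div_le]

theorem walkSum_cum_hitSet_le_of_card_le_d (h : IsPseudo G K d δ lam L q) (S : Finset (Fin n))
    {k : ℕ} (v : Fin n) (l : List (Fin n)) (hk : (k : ℝ) ≤ 25 * L) (hS : S.card ≤ d) :
    walkSum G K 0 k (fun u l' => cum (hitSet S) (u :: l')) v l ≤
      (2 * cum (hitSet S) (v :: l) + 601 * lam * d) * prodDeg d δ 0 k := by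
  have hS' : (S.card : ℝ) ≤ d := by exact_mod_cast hS
  have hd := h.one_le_d
  have hδ := h.δ_pos
  have hL := h.L_pos
  have hl := h.lam_pos
  have hlδ := h.δ_large
  have hL1 := h.one_le_L
  have h1 := h.walkSum_cum_le (hitSet_nonneg S) hk v l
    (B := d) (T := 6 * (lam / L) * (d * δ)) (by
      have := h.eta_pos
      have := h.D_pos
      positivity)
    ((walkSum_hitSet_one_le S 0 v l).trans hS')
    (fun s v' l' hl' => (walkSum_eq_walkOp 2 (fun u => if u ∈ S then 1 else 0) s v' l').le.trans
      ((h.two_step_hit s S v').trans (by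
        have h2 : (d : ℝ) ≤ 3 * (lam / L) * (d * δ) := by
          have h3 : 3 * (lam / L) * (d * δ) = (3 * (lam * δ) / L) * d := by ring
          have h4 : 1 ≤ 3 * (lam * δ) / L := by
            rw [le_div_iff₀ hL]; linarith
          rw [h3]
          nlinarith
        linarith)))
  rw [h.cum_const] at h1
  refine h1.trans (mul_le_mul_of_nonneg_right ?_ (prodDeg_nonneg h.δ_pos.le _ _))
  have h5 : 2 * d / δ ≤ lam * d := by
    rw [div_le_iff₀ hδ]
    nlinarith
  nlinarith

end IsPseudo

/-- The neighbour in `U` of a vertex `z`; it is unique if `z ∈ uniq H U`. -/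
def par (H : SimpleGraph (Fin n)) (U : Finset (Fin n)) (z : Fin n) : Fin n :=
  if h : (nb H z ∩ U).Nonempty then h.choose else z

/-- The memory of a vertex reached from `U`, where `π` gives the memory of the vertices in `U`. -/
def nextMem (H : SimpleGraph (Fin n)) (U : Finset (Fin n)) (π : Fin n → List (Fin n))
    (z : Fin n) : List (Fin n) := par H U z :: π (par H U z)

theorem inter_eq_par {H : SimpleGraph (Fin n)} {U : Finset (Fin n)} {z : Fin n}
    (hz : z ∈ uniq H U) : nb H z ∩ U = {par H U z} := by
  simp only [uniq, Finset.mem_filter, Finset.mem_univ, true_and] at hz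
  obtain ⟨x, hx⟩ := Finset.card_eq_one.mp hz.2
  have h : (nb H z ∩ U).Nonempty := by rw [hx]; simp
  have h1 : par H U z ∈ nb H z ∩ U := by
    rw [par, dif_pos h]
    exact h.choose_spec
  rw [hx] at h1 ⊢
  rw [Finset.mem_singleton.mp h1]

theorem par_mem {H : SimpleGraph (Fin n)} {U : Finset (Fin n)} {z : Fin n}
    (hz : z ∈ uniq H U) : par H U z ∈ U ∧ z ∈ nb H (par H U z) := by
  have : par H U z ∈ nb H z ∩ U := by rw [inter_eq_par hz]; simp
  exact ⟨(Finset.mem_inter.mp this).2, mem_nb_comm.mp (Finset.mem_inter.mp this).1⟩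

theorem uniq_subset_biUnion (H : SimpleGraph (Fin n)) (U : Finset (Fin n)) :
    uniq H U ⊆ U ∪ U.biUnion (nb H) := by
  intro z hz
  have := par_mem hz
  simp only [Finset.mem_union, Finset.mem_biUnion]
  exact Or.inr ⟨_, this⟩

theorem sum_inter_comm (H : SimpleGraph (Fin n)) (U A : Finset (Fin n))
    (f : Fin n → Fin n → ℝ) :
    ∑ x ∈ U, ∑ z ∈ nb H x ∩ A, f x z = ∑ z ∈ A, ∑ x ∈ nb H z ∩ U, f x z := by
  refine Finset.sum_comm' fun x z => ?_
  simp only [Finset.mem_inter]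
  rw [mem_nb_comm (u := z)]
  tauto

theorem sum_par {H : SimpleGraph (Fin n)} {U A : Finset (Fin n)} (hA : A ⊆ uniq H U)
    (f : Fin n → Fin n → ℝ) :
    ∑ z ∈ A, f (par H U z) z = ∑ x ∈ U, ∑ z ∈ nb H x ∩ A, f x z := by
  rw [sum_inter_comm]
  refine Finset.sum_congr rfl fun z hz => ?_
  rw [inter_eq_par (hA hz), Finset.sum_singleton]

/-- The states `(z, π' z)` with `z ∈ U'` are reached by distinct walks of length `k` from the states
`(z, π z)` with `z ∈ U`. -/
def Grows (G K : SimpleGraph (Fin n)) (s k : ℕ) (U : Finset (Fin n)) (π : Fin n → List (Fin n))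
    (U' : Finset (Fin n)) (π' : Fin n → List (Fin n)) : Prop :=
  ∀ φ : Fin n → List (Fin n) → ℝ, (∀ u l, 0 ≤ φ u l) →
    ∑ z ∈ U', φ z (π' z) ≤ ∑ z ∈ U, walkSum G K s k φ z (π z)

section Grows

variable {G K : SimpleGraph (Fin n)}

theorem Grows.refl (s : ℕ) (U : Finset (Fin n)) (π : Fin n → List (Fin n)) :
    Grows G K s 0 U π U π := fun _ _ => le_rfl

theorem Grows.trans {s s' i j : ℕ} {U U' U'' : Finset (Fin n)} {π π' π'' : Fin n → List (Fin n)}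
    (h : Grows G K s i U π U' π') (h' : Grows G K s' j U' π' U'' π'')
    (hs : s' % 2 = (s + i) % 2) : Grows G K s (i + j) U π U'' π'' := by
  intro φ hφ
  refine (h' φ hφ).trans ?_
  refine (h (walkSum G K s' j φ) fun u l => walkSum_nonneg _ _ _ _ hφ).trans (le_of_eq ?_)
  refine Finset.sum_congr rfl fun z _ => ?_
  rw [walkSum_add]
  congr 1
  funext u l
  exact walkSum_congr_mod _ _ _ _ hs _ _

theorem grows_uniq (s : ℕ) (U : Finset (Fin n)) (π : Fin n → List (Fin n)) :
    Grows G K s 1 U π (uniq (altGraph G K s) U) (nextMem (altGraph G K s) U π) := by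
  intro φ hφ
  have h := sum_par (H := altGraph G K s) (U := U) (A := uniq (altGraph G K s) U) subset_rfl
    fun x z => φ z (x :: π x)
  simp only [nextMem]
  rw [h]
  refine Finset.sum_le_sum fun x _ => ?_
  rw [walkSum_succ]
  exact Finset.sum_le_sum_of_subset_of_nonneg Finset.inter_subset_left fun _ _ _ => hφ _ _

end Grows

theorem sum_nb_le_sum_uniq (H : SimpleGraph (Fin n)) (U : Finset (Fin n)) (φ : Fin n → ℝ) {c : ℝ}
    (hφ : ∀ z, φ z ≤ c) :
    ∑ x ∈ U, ∑ z ∈ nb H x, φ z ≤ ∑ z ∈ uniq H U, φ z + c * disc H U := by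
  have h1 := sum_par (H := H) (U := U) (A := uniq H U) subset_rfl fun _ z => φ z
  rw [h1, disc, Finset.mul_sum, ← Finset.sum_add_distrib]
  refine Finset.sum_le_sum fun x _ => ?_
  rw [← Finset.sum_inter_add_sum_sdiff (nb H x) (uniq H U)]
  gcongr
  have := Finset.sum_le_card_nsmul (nb H x \ uniq H U) φ c fun z _ => hφ z
  rw [nsmul_eq_mul, mul_comm] at this
  exact this

theorem sum_uniq_le_sum_nb (H : SimpleGraph (Fin n)) (U : Finset (Fin n)) (φ : Fin n → ℝ)
    (hφ : ∀ z, 0 ≤ φ z) : ∑ z ∈ uniq H U, φ z ≤ ∑ x ∈ U, ∑ z ∈ nb H x, φ z := by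
  rw [sum_par (H := H) (U := U) (A := uniq H U) subset_rfl fun _ z => φ z]
  exact Finset.sum_le_sum fun x _ =>
    Finset.sum_le_sum_of_subset_of_nonneg Finset.inter_subset_left fun _ _ _ => hφ _

theorem sum_card_nb_eq (H : SimpleGraph (Fin n)) (U : Finset (Fin n)) :
    ∑ x ∈ U, ((nb H x).card : ℝ) = (uniq H U).card + disc H U := by
  rw [← sum_card_nb_inter_uniq H U (uniq H U) subset_rfl, disc, ← Finset.sum_add_distrib]
  refine Finset.sum_congr rfl fun x _ => ?_
  rw [← Nat.cast_add, Finset.card_inter_add_card_sdiff]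

/-- The sum of the degrees of the vertices in `U`. -/
def degSum (G : SimpleGraph (Fin n)) (U : Finset (Fin n)) : ℝ := ∑ x ∈ U, ((nb G x).card : ℝ)

namespace IsPseudo

variable {G K : SimpleGraph (Fin n)} {d : ℕ} {δ lam L : ℝ} {q : ℕ}

theorem degSum_ge (h : IsPseudo G K d δ lam L q) (U : Finset (Fin n)) :
    (1 - lam) * δ * U.card ≤ degSum G U := by
  have := Finset.card_nsmul_le_sum U _ _ fun x _ => h.degG_ge x
  rw [nsmul_eq_mul, mul_comm] at this
  exact this

theorem degSum_le (h : IsPseudo G K d δ lam L q) (U : Finset (Fin n)) :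
    degSum G U ≤ (1 + lam) * δ * U.card := by
  have := Finset.sum_le_card_nsmul U _ _ fun x _ => h.degG_le x
  rw [nsmul_eq_mul, mul_comm] at this
  exact this

theorem card_uniq_G (h : IsPseudo G K d δ lam L q) {U : Finset (Fin n)} {η : ℝ} (hη : η ≤ lam)
    (hU : disc G U ≤ 2 * η * δ * U.card) :
    ((uniq G U).card : ℝ) ≤ degSum G U ∧ (1 - 3 * lam) * degSum G U ≤ (uniq G U).card ∧
      (1 - 3 * lam) * δ * U.card ≤ (uniq G U).card ∧ δ * U.card ≤ 4 * (uniq G U).card := by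
  have h1 := sum_card_nb_eq G U
  have h2 := h.degSum_ge U
  have h3 := disc_nonneg G U
  have h4 := h.lam_pos
  have h5 := h.lam_le
  have h6 := h.δ_pos
  have h7 : 0 ≤ δ * U.card := by positivity
  change degSum G U = _ at h1
  have h8 : disc G U ≤ 2 * lam * (δ * U.card) := by
    calc _ ≤ 2 * η * δ * U.card := hU
      _ ≤ 2 * lam * δ * U.card := by gcongr
      _ = _ := by ring
  have h9 : 2 * (δ * U.card) ≤ 3 * degSum G U := by nlinarith
  have h10 : 0 ≤ degSum G U := by linarith
  refine ⟨by linarith, by nlinarith, by nlinarith, by nlinarith⟩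

theorem card_uniq_K (h : IsPseudo G K d δ lam L q) {U : Finset (Fin n)} {η : ℝ} (hη : η ≤ lam)
    (hU : disc K U ≤ 2 * η * d * U.card) :
    ((uniq K U).card : ℝ) ≤ d * U.card ∧ (1 - 2 * lam) * (d * U.card) ≤ (uniq K U).card ∧
      d * U.card ≤ 2 * ((uniq K U).card : ℝ) := by
  have h1 := sum_card_nb_eq K U
  have h3 := disc_nonneg K U
  have h4 := h.lam_pos
  have h5 := h.lam_le
  have h6 := h.d_pos
  have h7 : 0 ≤ (d : ℝ) * U.card := by positivity
  have h8 : disc K U ≤ 2 * lam * (d * U.card) := by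
    calc _ ≤ 2 * η * d * U.card := hU
      _ ≤ 2 * lam * d * U.card := by gcongr
      _ = _ := by ring
  simp only [h.card_nb_K, Finset.sum_const, nsmul_eq_mul] at h1
  refine ⟨by linarith, by linarith, by nlinarith⟩

theorem degSum_uniq (h : IsPseudo G K d δ lam L q) {U : Finset (Fin n)} {η : ℝ} (hη : η ≤ lam)
    (hη' : lam / L ≤ η) (hU : disc G U ≤ 2 * η * δ * U.card)
    (hU' : disc K (uniq G U) ≤ 2 * η * d * (uniq G U).card) :
    (1 - 6 * η) * (d * δ) * degSum G U ≤ degSum G (uniq K (uniq G U)) ∧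
      degSum G (uniq K (uniq G U)) ≤ (1 + lam / L) * (d * δ) * degSum G U := by
  have hδ := h.δ_pos
  have hd := h.d_pos
  have hl := h.lam_pos
  have hl' := h.lam_le
  have he := h.eta_pos
  have hK : ∀ p, ∑ z ∈ nb K p, ((nb G z).card : ℝ) ≤ d * ((1 + lam) * δ) := by
    intro p
    have := Finset.sum_le_card_nsmul (nb K p) _ _ fun x _ => h.degG_le x
    rw [nsmul_eq_mul, h.card_nb_K] at this
    exact this
  constructor
  · have h1 : (1 - lam / L) * (d * δ) * degSum G U ≤
        ∑ x ∈ U, ∑ u ∈ nb G x, ∑ u' ∈ nb K u, ((nb G u').card : ℝ) := by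
      rw [degSum, Finset.mul_sum]
      exact Finset.sum_le_sum fun x _ => h.two_step_ge x
    have h2 := sum_nb_le_sum_uniq G U (fun u => ∑ u' ∈ nb K u, ((nb G u').card : ℝ)) hK
    have h3 := sum_nb_le_sum_uniq K (uniq G U) (fun u => ((nb G u).card : ℝ)) h.degG_le
    have h4 := (h.card_uniq_G hη hU).1
    have h5 := h.degSum_ge U
    have h6 : disc G U * (d * ((1 + lam) * δ)) ≤
        2 * η * (1 + 3 * lam) * (d * δ * degSum G U) := by
      have h7 : δ * U.card * (1 + lam) ≤ (1 + 3 * lam) * degSum G U := by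
        have : 0 ≤ δ * U.card := by positivity
        have h0 : 1 + lam ≤ (1 + 3 * lam) * (1 - lam) := by nlinarith
        calc δ * U.card * (1 + lam) ≤ δ * U.card * ((1 + 3 * lam) * (1 - lam)) := by gcongr
          _ = (1 + 3 * lam) * ((1 - lam) * δ * U.card) := by ring
          _ ≤ _ := by gcongr
      calc _ ≤ 2 * η * δ * U.card * (d * ((1 + lam) * δ)) := by gcongr
        _ = 2 * η * (d * δ) * (δ * U.card * (1 + lam)) := by ring
        _ ≤ 2 * η * (d * δ) * ((1 + 3 * lam) * degSum G U) := by
            have : 0 < η := by linarith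
            gcongr
        _ = _ := by ring
    have h8 : disc K (uniq G U) * ((1 + lam) * δ) ≤
        2 * η * (1 + 3 * lam) * (d * δ * degSum G U) := by
      have : 0 < η := by linarith
      have : 0 ≤ degSum G U := le_trans (by positivity) h4
      calc _ ≤ 2 * η * d * degSum G U * ((1 + lam) * δ) := by
            refine mul_le_mul_of_nonneg_right (hU'.trans ?_) (by positivity)
            gcongr
        _ = 2 * η * (1 + lam) * (d * δ * degSum G U) := by ring
        _ ≤ _ := by gcongr; linarith
    have h9 : 0 ≤ d * δ * degSum G U := by
      have : 0 ≤ degSum G U := le_trans (by positivity) h4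
      positivity
    change _ ≤ degSum G (uniq K (uniq G U)) + _ at h3
    have h10 : (1 - 6 * η) * (d * δ * degSum G U) ≤
        (1 - lam / L) * (d * δ * degSum G U) -
          2 * (2 * η * (1 + 3 * lam) * (d * δ * degSum G U)) := by
      have : 1 - 6 * η ≤ 1 - lam / L - 2 * (2 * η * (1 + 3 * lam)) := by nlinarith
      calc _ ≤ (1 - lam / L - 2 * (2 * η * (1 + 3 * lam))) * (d * δ * degSum G U) := by gcongr
        _ = _ := by ring
    linarith
  · have h1 := sum_uniq_le_sum_nb K (uniq G U) (fun u => ((nb G u).card : ℝ))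
      fun _ => by positivity
    have h2 := sum_uniq_le_sum_nb G U (fun u => ∑ u' ∈ nb K u, ((nb G u').card : ℝ))
      fun _ => by positivity
    refine h1.trans (h2.trans ?_)
    rw [degSum, Finset.mul_sum]
    exact Finset.sum_le_sum fun x _ => h.two_step_le x

end IsPseudo

theorem exists_parts {α : Type*} [DecidableEq α] (s : Finset α) {t : ℕ} (ht : 1 ≤ t) (hs : 3 * t ≤ s.card) :
    ∃ P : Finpartition s, ∀ A ∈ P.parts, t ≤ A.card ∧ A.card ≤ 2 * t := by
  have h1 : 3 ≤ s.card / t := (Nat.le_div_iff_mul_le (by omega)).mpr hs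
  obtain ⟨P, hP, hc⟩ := Finpartition.exists_equipartition_card_eq s (n := s.card / t) (by omega)
    (Nat.div_le_self _ _)
  refine ⟨P, fun A hA => ⟨?_, ?_⟩⟩
  · have := hP.average_le_card_part hA
    rw [hc] at this
    refine le_trans ?_ this
    rw [Nat.le_div_iff_mul_le (by omega), mul_comm]
    exact Nat.div_mul_le_self _ _
  · have := hP.card_part_le_average_add_one hA
    rw [hc] at this
    have h2 : s.card / (s.card / t) < 2 * t := by
      rw [Nat.div_lt_iff_lt_mul (by omega)]
      have h3 : s.card < t * (s.card / t + 1) := Nat.lt_mul_div_succ _ (by omega)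
      nlinarith
    omega

theorem scale_mul_le {n d t : ℕ} {δ lam c A : ℝ}
    (ht : t * (10 ^ 7 * d ^ 2 * δ) ≤ 1.001 * (lam * n))
    (hA : A * (1.001 * c) ≤ 10 ^ 7 * d ^ 2 * δ) : c * (t * A) ≤ lam * n := by
  have : (t : ℝ) * (A * (1.001 * c)) ≤ t * (10 ^ 7 * d ^ 2 * δ) := by gcongr
  nlinarith

namespace IsPseudo

variable {G K : SimpleGraph (Fin n)} {d : ℕ} {δ lam L : ℝ} {q : ℕ}

theorem exists_scale (h : IsPseudo G K d δ lam L q) :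
    ∃ t : ℕ, 1 ≤ t ∧ lam * n ≤ t * (10 ^ 7 * d ^ 2 * δ) ∧
      t * (10 ^ 7 * d ^ 2 * δ) ≤ 1.001 * (lam * n) := by
  have hδ := h.δ_pos
  have hd := h.d_pos
  have hL := h.L_pos
  have hpos : 0 < 10 ^ 7 * (d : ℝ) ^ 2 * δ := by positivity
  have h1 := h.n_bound (a := 2) (b := 1) (c := 0) (by norm_num) (by norm_num) (by norm_num)
  have hX : 0 < lam * n := lt_of_lt_of_le (by positivity) h1
  refine ⟨⌈lam * n / (10 ^ 7 * d ^ 2 * δ)⌉₊, Nat.one_le_iff_ne_zero.mpr ?_, ?_, ?_⟩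
  · exact (Nat.ceil_pos.mpr (by positivity)).ne'
  · rw [← div_le_iff₀ hpos]
    exact Nat.le_ceil _
  · have h2 := (Nat.ceil_lt_add_one (by positivity : 0 ≤ lam * n / (10 ^ 7 * d ^ 2 * δ))).le
    have h3 := mul_le_mul_of_nonneg_right h2 hpos.le
    refine h3.trans ?_
    rw [add_mul, div_mul_cancel₀ _ hpos.ne']
    simp only [pow_one, pow_zero, mul_one] at h1
    nlinarith

theorem grow_step (h : IsPseudo G K d δ lam L q) {t : ℕ}
    (ht : t * (10 ^ 7 * d ^ 2 * δ) ≤ 1.001 * (lam * n)) {U : Finset (Fin n)}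
    (π : Fin n → List (Fin n)) (hU : disc G U ≤ 2 * (lam / L) * δ * U.card)
    (hs : degSum G U ≤ 4.1 * t) :
    ∃ U' π', Grows G K 0 2 U π U' π' ∧
      (1 - 6 * (lam / L)) * (d * δ) * degSum G U ≤ degSum G U' ∧
      degSum G U' ≤ (1 + lam / L) * (d * δ) * degSum G U ∧
      disc G U' ≤ 2 * (lam / L) * δ * U'.card := by
  have hδ := h.δ_pos
  have hd := h.d_pos
  have hL := h.L_pos
  have hη := h.eta_le
  have hLd := h.d_large
  have hLδ := h.δ_big
  have hδ1 := h.one_le_δ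
  obtain ⟨c1, c2, c3, c4⟩ := h.card_uniq_G hη hU
  have hdL : 0 < (d : ℝ) * L := by positivity
  have hK : disc K (uniq G U) ≤ 2 * (lam / L) * d * (uniq G U).card := by
    refine h.disc_K _ U c4 (uniq_subset_biUnion G U) ?_
    rw [le_div_iff₀ (by positivity)]
    have h1 := scale_mul_le ht (c := 4.1) (A := 10 ^ 6 * d * L) (by
      have : d * L ≤ d * (d * δ) := by
        have : L ≤ d * δ := by nlinarith
        gcongr
      nlinarith)
    have h2 : ((uniq G U).card : ℝ) * (10 ^ 6 * d * L) ≤ 4.1 * t * (10 ^ 6 * d * L) := by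
      gcongr
      linarith
    linarith
  obtain ⟨e1, e2, e3⟩ := h.card_uniq_K hη hK
  obtain ⟨f1, f2⟩ := h.degSum_uniq hη le_rfl hU hK
  refine ⟨uniq K (uniq G U), nextMem K (uniq G U) (nextMem G U π), ?_, f1, f2, ?_⟩
  · have g1 := grows_uniq (G := G) (K := K) 0 U π
    have g2 := grows_uniq (G := G) (K := K) 1 (uniq G U) (nextMem G U π)
    exact g1.trans g2 rfl
  · refine h.disc_G _ (uniq G U) (by linarith [Nat.cast_nonneg (α := ℝ) (uniq K (uniq G U)).card])
      (uniq_subset_biUnion K _) ?_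
    rw [le_div_iff₀ (by positivity)]
    have h1 := scale_mul_le ht (c := 4.1) (A := d * (100 * δ * L)) (by
      have : d * δ * L ≤ d * δ * d := by
        have : L ≤ d := by nlinarith
        gcongr
      nlinarith)
    have h2 : ((uniq K (uniq G U)).card : ℝ) * (100 * δ * L) ≤
        d * (4.1 * t) * (100 * δ * L) := by
      gcongr
      refine e1.trans ?_
      gcongr
      linarith
    linarith

theorem grow_chain (h : IsPseudo G K d δ lam L q) {t : ℕ}
    (ht : t * (10 ^ 7 * d ^ 2 * δ) ≤ 1.001 * (lam * n)) {U₀ : Finset (Fin n)}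
    (π₀ : Fin n → List (Fin n)) (hU : disc G U₀ ≤ 2 * (lam / L) * δ * U₀.card) (i : ℕ)
    (hi : i ≤ q) (hs : ∀ i' < i, U₀.card * (d * δ) ^ i' * δ < 4 * t) :
    ∃ U π, Grows G K 0 (2 * i) U₀ π₀ U π ∧
      (1 - 6 * (lam / L)) ^ i * (d * δ) ^ i * degSum G U₀ ≤ degSum G U ∧
      degSum G U ≤ (1 + lam / L) ^ i * (d * δ) ^ i * degSum G U₀ ∧
      disc G U ≤ 2 * (lam / L) * δ * U.card := by
  have hη := h.eta_le
  have hη0 := h.eta_pos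
  have hD := h.D_pos
  have hl := h.lam_le
  have hl0 := h.lam_pos
  induction i with
  | zero => exact ⟨U₀, π₀, Grows.refl _ _ _, by simp, by simp, hU⟩
  | succ i ih =>
    obtain ⟨U, π, g, b1, b2, b3⟩ := ih (by omega) fun i' hi' => hs i' (by omega)
    have h1 : (1 + lam / L) ^ i ≤ 1 + 2 * lam := by
      have h2 : (i : ℝ) * (lam / L) ≤ 1 * lam := by
        refine h.mul_eta_le ?_
        have : (i : ℝ) ≤ q := by exact_mod_cast (by omega)
        linarith [h.q_le]
      have := one_add_pow_le hη0.le i (by linarith)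
      linarith
    have h2 : degSum G U ≤ 4.1 * t := by
      have h3 := h.degSum_le U₀
      have h4 := hs i (by omega)
      have h5 : 0 ≤ (U₀.card : ℝ) * (d * δ) ^ i * δ := by
        have := h.δ_pos
        positivity
      calc degSum G U ≤ (1 + lam / L) ^ i * (d * δ) ^ i * degSum G U₀ := b2
        _ ≤ (1 + 2 * lam) * (d * δ) ^ i * ((1 + lam) * δ * U₀.card) := by
          have : 0 ≤ degSum G U₀ := Finset.sum_nonneg fun _ _ => by positivity
          gcongr
        _ = (1 + 2 * lam) * (1 + lam) * (U₀.card * (d * δ) ^ i * δ) := by ring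
        _ ≤ 1.001 * (U₀.card * (d * δ) ^ i * δ) := by
          gcongr
          nlinarith
        _ ≤ _ := by linarith
    obtain ⟨U', π', g', c1, c2, c3⟩ := h.grow_step ht π b3 h2
    refine ⟨U', π', g.trans g' (by omega), ?_, ?_, c3⟩
    · refine le_trans ?_ c1
      have h6 : 0 ≤ (1 - 6 * (lam / L)) * (d * δ) := by
        have : 0 ≤ 1 - 6 * (lam / L) := by linarith
        positivity
      calc _ = (1 - 6 * (lam / L)) * (d * δ) *
            ((1 - 6 * (lam / L)) ^ i * (d * δ) ^ i * degSum G U₀) := by ring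
        _ ≤ _ := by gcongr
    · refine c2.trans ?_
      calc _ ≤ (1 + lam / L) * (d * δ) *
            ((1 + lam / L) ^ i * (d * δ) ^ i * degSum G U₀) := by gcongr
        _ = _ := by ring

set_option maxHeartbeats 1600000 in
/-- From a set `U` of suitable size, four more steps reach disjoint families of states, each
family being supported on a set of linear size. -/
theorem spread_step (h : IsPseudo G K d δ lam L q) {t : ℕ} (ht1 : 1 ≤ t)
    (ht0 : lam * n ≤ t * (10 ^ 7 * d ^ 2 * δ))
    (ht : t * (10 ^ 7 * d ^ 2 * δ) ≤ 1.001 * (lam * n)) {U : Finset (Fin n)}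
    (π : Fin n → List (Fin n)) (hU : disc G U ≤ 2 * (lam / L) * δ * U.card)
    (hs1 : 3.9 * t ≤ degSum G U) (hs2 : degSum G U ≤ 4.1 * (t * (d * δ))) :
    ∃ (I : Finset (Finset (Fin n))) (S : Finset (Fin n) → Finset (Fin n))
      (π' : Finset (Fin n) → Fin n → List (Fin n)),
      (∀ φ : Fin n → List (Fin n) → ℝ, (∀ u l, 0 ≤ φ u l) →
        ∑ A ∈ I, ∑ z ∈ S A, φ z (π' A z) ≤ ∑ z ∈ U, walkSum G K 0 4 φ z (π z)) ∧
      (∀ A ∈ I, 2 * (lam * n / 10 ^ 8) ≤ (S A).card ∧ ((S A).card : ℝ) ≤ lam * n / 10 ^ 6) ∧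
      (1 - 14 * lam) * (d * δ) * d * degSum G U ≤ ∑ A ∈ I, ((S A).card : ℝ) := by
  have hδ := h.δ_pos
  have hd := h.d_pos
  have hL := h.L_pos
  have hη := h.eta_le
  have hη0 := h.eta_pos
  have hl := h.lam_le
  have hl0 := h.lam_pos
  have hLd := h.d_large
  have hLδ := h.δ_big
  have hδ1 := h.one_le_δ
  obtain ⟨c1, c2, c3, c4⟩ := h.card_uniq_G hη hU
  set Y := uniq G U with hY
  have hKY : disc K Y ≤ 2 * lam * d * Y.card := by
    refine h.disc_K' _ U c4 (uniq_subset_biUnion G U) ?_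
    rw [le_div_iff₀ (by positivity)]
    have h1 := scale_mul_le ht (c := 4.1) (A := d * δ * (10 ^ 6 * d)) (by
      have : 0 < d ^ 2 * δ := by positivity
      nlinarith)
    have h2 : (Y.card : ℝ) * (10 ^ 6 * d) ≤ 4.1 * (t * (d * δ)) * (10 ^ 6 * d) := by
      gcongr
      linarith
    linarith
  obtain ⟨e1, e2, e3⟩ := h.card_uniq_K le_rfl hKY
  set W := uniq K Y with hW
  set Yg := Y.filter fun p => (d : ℝ) ≤ 2 * (nb K p ∩ W).card with hYg
  have hbad : (d : ℝ) * (Y \ Yg).card ≤ 2 * disc K Y := by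
    have h1 : ∀ p ∈ Y \ Yg, (d : ℝ) / 2 ≤ ((nb K p \ W).card : ℝ) := by
      intro p hp
      have h2 : ((nb K p ∩ W).card : ℝ) + (nb K p \ W).card = d := by
        rw [← Nat.cast_add, Finset.card_inter_add_card_sdiff, h.degK]
      simp only [hYg, Finset.mem_sdiff, Finset.mem_filter, not_and, not_le] at hp
      have := hp.2 hp.1
      linarith
    have h2 := Finset.card_nsmul_le_sum _ _ _ h1
    have h3 : ∑ p ∈ Y \ Yg, ((nb K p \ W).card : ℝ) ≤ disc K Y :=
      Finset.sum_le_sum_of_subset_of_nonneg Finset.sdiff_subset fun _ _ _ => by positivity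
    rw [nsmul_eq_mul] at h2
    linarith
  have hbad' : ((Y \ Yg).card : ℝ) ≤ 4 * lam * Y.card := by
    have : (d : ℝ) * (Y \ Yg).card ≤ d * (4 * lam * Y.card) := by linarith
    exact le_of_mul_le_mul_left this hd
  have hYgs : Yg ⊆ Y := Finset.filter_subset _ _
  have hcard : ((Y \ Yg).card : ℝ) + Yg.card = Y.card := by
    rw [← Nat.cast_add, Finset.card_sdiff_add_card_eq_card hYgs]
  have hYg3 : 3 * t ≤ Yg.card := by
    have h1 : (0 : ℝ) ≤ t := by positivity
    have : (3 * t : ℝ) ≤ Yg.card := by nlinarith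
    exact_mod_cast this
  obtain ⟨P, hP⟩ := exists_parts Yg ht1 hYg3
  have hAY : ∀ A ∈ P.parts, A ⊆ Y := fun A hA => (P.le hA).trans hYgs
  set X : Finset (Fin n) → Finset (Fin n) := fun A => W.filter fun z => par K Y z ∈ A with hX
  have hXcard : ∀ A, A ⊆ Y → ((X A).card : ℝ) = ∑ p ∈ A, ((nb K p ∩ W).card : ℝ) := by
    intro A hA
    have h1 := sum_par (H := K) (U := Y) (A := W) subset_rfl fun x _ => if x ∈ A then (1 : ℝ) else 0
    rw [Finset.sum_boole] at h1
    rw [hX]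
    simp only
    rw [h1]
    simp only [Finset.sum_const, nsmul_eq_mul, mul_ite, mul_one, mul_zero]
    rw [Finset.sum_ite_mem, Finset.inter_eq_right.mpr hA]
  have hXlo : ∀ A ∈ P.parts, d * A.card ≤ 2 * ((X A).card : ℝ) := by
    intro A hA
    have h1 : ∀ p ∈ A, (d : ℝ) / 2 ≤ ((nb K p ∩ W).card : ℝ) := by
      intro p hp
      have := P.le hA hp
      simp only [hYg, Finset.mem_filter] at this
      linarith [this.2]
    have h2 := Finset.card_nsmul_le_sum _ _ _ h1
    rw [← hXcard A (hAY A hA), nsmul_eq_mul] at h2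
    linarith
  have hXhi : ∀ A ∈ P.parts, ((X A).card : ℝ) ≤ d * A.card := by
    intro A hA
    rw [hXcard A (hAY A hA), mul_comm, ← nsmul_eq_mul]
    refine Finset.sum_le_card_nsmul _ _ _ fun p _ => ?_
    rw [← h.card_nb_K p]
    exact_mod_cast Finset.card_le_card Finset.inter_subset_left
  have hXG : ∀ A ∈ P.parts, disc G (X A) ≤ 2 * lam * δ * (X A).card := by
    intro A hA
    have h0 : disc G (X A) ≤ 2 * (lam / L) * δ * (X A).card := by
      refine h.disc_G _ A (by linarith [hXlo A hA, Nat.cast_nonneg (α := ℝ) (X A).card]) ?_ ?_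
      · intro z hz
        simp only [hX, Finset.mem_filter] at hz
        have := par_mem hz.1
        simp only [Finset.mem_union, Finset.mem_biUnion]
        exact Or.inr ⟨_, hz.2, this.2⟩
      · rw [le_div_iff₀ (by positivity)]
        have h1 := scale_mul_le ht (c := 2) (A := d * (100 * δ * L)) (by
          have : d * δ * L ≤ d * δ * d := by
            have : L ≤ d := by nlinarith
            gcongr
          nlinarith)
        have h2 : (A.card : ℝ) ≤ 2 * t := by exact_mod_cast (hP A hA).2
        have h3 : ((X A).card : ℝ) * (100 * δ * L) ≤ d * (2 * t) * (100 * δ * L) := by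
          gcongr
          refine (hXhi A hA).trans ?_
          gcongr
        linarith
    refine h0.trans ?_
    gcongr
  have hXK : ∀ A ∈ P.parts, disc K (uniq G (X A)) ≤ 2 * lam * d * (uniq G (X A)).card := by
    intro A hA
    obtain ⟨a1, a2, a3, a4⟩ := h.card_uniq_G le_rfl (hXG A hA)
    refine h.disc_K' _ (X A) a4 (uniq_subset_biUnion G _) ?_
    rw [le_div_iff₀ (by positivity)]
    have h1 := scale_mul_le ht (c := 4) (A := δ * d * (10 ^ 6 * d)) (by
      have : 0 < d ^ 2 * δ := by positivity
      nlinarith)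
    have h2 : (A.card : ℝ) ≤ 2 * t := by exact_mod_cast (hP A hA).2
    have h3 : ((uniq G (X A)).card : ℝ) ≤ 2 * δ * (d * (2 * t)) := by
      refine a1.trans ((h.degSum_le _).trans ?_)
      have := hXhi A hA
      gcongr
      · linarith
      · refine this.trans ?_
        gcongr
    have h4 : ((uniq G (X A)).card : ℝ) * (10 ^ 6 * d) ≤ 2 * δ * (d * (2 * t)) * (10 ^ 6 * d) := by
      gcongr
    linarith
  set S : Finset (Fin n) → Finset (Fin n) := fun A => uniq K (uniq G (X A)) with hS
  have hSlo : ∀ A ∈ P.parts, (1 - 6 * lam) * (d * δ) * (X A).card ≤ ((S A).card : ℝ) := by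
    intro A hA
    obtain ⟨a1, a2, a3, a4⟩ := h.card_uniq_G le_rfl (hXG A hA)
    obtain ⟨b1, b2, b3⟩ := h.card_uniq_K le_rfl (hXK A hA)
    refine le_trans ?_ b2
    have h1 : 0 ≤ (d * δ) * ((X A).card : ℝ) := by positivity
    calc (1 - 6 * lam) * (d * δ) * (X A).card = (1 - 6 * lam) * ((d * δ) * (X A).card) := by ring
      _ ≤ ((1 - 2 * lam) * (1 - 3 * lam)) * ((d * δ) * (X A).card) := by
          gcongr
          nlinarith
      _ = (1 - 2 * lam) * (d * ((1 - 3 * lam) * δ * (X A).card)) := by ring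
      _ ≤ _ := by
          have : 0 ≤ 1 - 2 * lam := by linarith
          gcongr
  have hShi : ∀ A ∈ P.parts, ((S A).card : ℝ) ≤ (1 + lam) * (d * δ) * (X A).card := by
    intro A hA
    obtain ⟨a1, a2, a3, a4⟩ := h.card_uniq_G le_rfl (hXG A hA)
    obtain ⟨b1, b2, b3⟩ := h.card_uniq_K le_rfl (hXK A hA)
    refine b1.trans ?_
    calc (d : ℝ) * (uniq G (X A)).card ≤ d * ((1 + lam) * δ * (X A).card) := by
          gcongr
          exact a1.trans (h.degSum_le _)
      _ = _ := by ring
  refine ⟨P.parts, S, fun A => nextMem K (uniq G (X A)) (nextMem G (X A) (nextMem K Y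
    (nextMem G U π))), ?_, ?_, ?_⟩
  · intro φ hφ
    have g1 := grows_uniq (G := G) (K := K) 0 U π
    have g2 := grows_uniq (G := G) (K := K) 1 (uniq G U) (nextMem G U π)
    have g12 := g1.trans g2 rfl
    have h3 : ∀ A ∈ P.parts, ∑ z ∈ S A, φ z (nextMem K (uniq G (X A)) (nextMem G (X A)
        (nextMem K Y (nextMem G U π))) z) ≤
        ∑ z ∈ X A, walkSum G K 0 2 φ z (nextMem K Y (nextMem G U π) z) := by
      intro A _
      have k1 := grows_uniq (G := G) (K := K) 0 (X A) (nextMem K Y (nextMem G U π))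
      have k2 := grows_uniq (G := G) (K := K) 1 (uniq G (X A))
        (nextMem G (X A) (nextMem K Y (nextMem G U π)))
      exact k1.trans k2 rfl φ hφ
    refine (Finset.sum_le_sum h3).trans ?_
    have h4 : ∀ f : Fin n → ℝ, (∀ z, 0 ≤ f z) →
        ∑ A ∈ P.parts, ∑ z ∈ X A, f z ≤ ∑ z ∈ W, f z := by
      intro f hf
      rw [← Finset.sum_biUnion]
      · refine Finset.sum_le_sum_of_subset_of_nonneg ?_ fun _ _ _ => hf _
        intro z hz
        simp only [Finset.mem_biUnion, hX, Finset.mem_filter] at hz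
        obtain ⟨A, _, hz, _⟩ := hz
        exact hz
      · intro A hA B hB hAB
        rw [Function.onFun, Finset.disjoint_left]
        intro z hz hz'
        simp only [hX, Finset.mem_filter] at hz hz'
        exact Finset.disjoint_left.mp (P.disjoint hA hB hAB) hz.2 hz'.2
    refine (h4 _ fun z => walkSum_nonneg _ _ _ _ hφ).trans ?_
    have h5 := g12 (walkSum G K 0 2 φ) fun u l => walkSum_nonneg _ _ _ _ hφ
    refine h5.trans (le_of_eq (Finset.sum_congr rfl fun z _ => ?_))
    rw [show 4 = 2 + 2 by rfl, walkSum_add 2 2]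
    refine congrArg (fun f => walkSum G K 0 2 f z (π z)) ?_
    funext u l
    exact walkSum_congr_mod _ _ _ _ rfl _ _
  · intro A hA
    have h2 : (A.card : ℝ) ≤ 2 * t := by exact_mod_cast (hP A hA).2
    have h3 : (t : ℝ) ≤ A.card := by exact_mod_cast (hP A hA).1
    have h4 := hXlo A hA
    have h5 := hXhi A hA
    have h6 : (d : ℝ) * t ≤ 2 * ((X A).card : ℝ) := by
      refine le_trans ?_ h4
      gcongr
    have h7 : ((X A).card : ℝ) ≤ d * (2 * t) := by
      refine h5.trans ?_
      gcongr
    have hD := h.D_pos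
    constructor
    · refine le_trans ?_ (hSlo A hA)
      have h8 : 0.4 * ((d * δ) * (d * t)) ≤ (1 - 6 * lam) * (d * δ) * (X A).card := by
        calc 0.4 * ((d * δ) * (d * t)) ≤ 0.4 * ((d * δ) * (2 * (X A).card)) := by gcongr
          _ = 0.8 * (d * δ) * (X A).card := by ring
          _ ≤ _ := by gcongr; linarith
      nlinarith
    · refine (hShi A hA).trans ?_
      have h8 : (1 + lam) * (d * δ) * (X A).card ≤ 1.1 * (d * δ) * (d * (2 * t)) := by
        gcongr
        linarith
      nlinarith
  · have h1 : ∑ A ∈ P.parts, ((X A).card : ℝ) = ∑ p ∈ Yg, ((nb K p ∩ W).card : ℝ) := by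
      have := Finset.sum_biUnion (s := P.parts) (t := id)
        (f := fun p => ((nb K p ∩ W).card : ℝ)) P.disjoint
      rw [P.biUnion_parts] at this
      rw [this]
      exact Finset.sum_congr rfl fun A hA => hXcard A (hAY A hA)
    have h2 : (W.card : ℝ) = ∑ p ∈ Y, ((nb K p ∩ W).card : ℝ) :=
      (sum_card_nb_inter_uniq K Y W subset_rfl).symm
    have h3 : ∑ p ∈ Y \ Yg, ((nb K p ∩ W).card : ℝ) ≤ d / 2 * (Y \ Yg).card := by
      rw [mul_comm, ← nsmul_eq_mul]
      refine Finset.sum_le_card_nsmul _ _ _ fun p hp => ?_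
      simp only [hYg, Finset.mem_sdiff, Finset.mem_filter, not_and, not_le] at hp
      linarith [hp.2 hp.1]
    have h4 := Finset.sum_sdiff (f := fun p => ((nb K p ∩ W).card : ℝ)) hYgs
    have h5 : (1 - 4 * lam) * (d * Y.card) ≤ ∑ A ∈ P.parts, ((X A).card : ℝ) := by
      have : (d : ℝ) / 2 * (Y \ Yg).card ≤ d / 2 * (4 * lam * Y.card) := by gcongr
      linarith
    have hΦ : 0 ≤ degSum G U := le_trans (by positivity) hs1
    calc (1 - 14 * lam) * (d * δ) * d * degSum G U
        = (1 - 14 * lam) * ((d * δ) * d * degSum G U) := by ring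
      _ ≤ ((1 - 6 * lam) * (1 - 4 * lam) * (1 - 3 * lam)) * ((d * δ) * d * degSum G U) := by
          gcongr
          nlinarith [mul_pos hl0 hl0]
      _ = (1 - 6 * lam) * (d * δ) * ((1 - 4 * lam) * (d * ((1 - 3 * lam) * degSum G U))) := by ring
      _ ≤ (1 - 6 * lam) * (d * δ) * ((1 - 4 * lam) * (d * Y.card)) := by
          have : 0 ≤ 1 - 6 * lam := by linarith
          have : 0 ≤ 1 - 4 * lam := by linarith
          gcongr
      _ ≤ (1 - 6 * lam) * (d * δ) * ∑ A ∈ P.parts, ((X A).card : ℝ) := by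
          have : 0 ≤ 1 - 6 * lam := by linarith
          gcongr
      _ = ∑ A ∈ P.parts, (1 - 6 * lam) * (d * δ) * ((X A).card : ℝ) := by rw [Finset.mul_sum]
      _ ≤ _ := Finset.sum_le_sum hSlo

set_option maxHeartbeats 1600000 in
theorem spread (h : IsPseudo G K d δ lam L q) (k : ℕ) (hk1 : 1 ≤ k) (hkd : k ≤ d) :
    ∃ j, j ≤ q + 2 ∧ ∀ U₀ : Finset (Fin n), U₀.card = k →
      disc G U₀ ≤ 2 * (lam / L) * δ * U₀.card → ∀ π₀ : Fin n → List (Fin n),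
      ∃ (I : Finset (Finset (Fin n))) (S : Finset (Fin n) → Finset (Fin n))
        (π' : Finset (Fin n) → Fin n → List (Fin n)),
        (∀ φ : Fin n → List (Fin n) → ℝ, (∀ u l, 0 ≤ φ u l) →
          ∑ A ∈ I, ∑ z ∈ S A, φ z (π' A z) ≤ ∑ z ∈ U₀, walkSum G K 0 (2 * j) φ z (π₀ z)) ∧
        (∀ A ∈ I, 2 * (lam * n / 10 ^ 8) ≤ (S A).card ∧ ((S A).card : ℝ) ≤ lam * n / 10 ^ 6) ∧
        (1 - 50 * lam) * (k * (d * δ) ^ j) ≤ ∑ A ∈ I, ((S A).card : ℝ) := by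
  have hδ := h.δ_pos
  have hd := h.d_pos
  have hd1 := h.one_le_d
  have hη := h.eta_le
  have hη0 := h.eta_pos
  have hl := h.lam_le
  have hl0 := h.lam_pos
  have hδ1 := h.one_le_δ
  have hD := h.D_pos
  obtain ⟨t, ht1, ht0, ht⟩ := h.exists_scale
  have hk1' : (1 : ℝ) ≤ k := by exact_mod_cast hk1
  have hkd' : (k : ℝ) ≤ d := by exact_mod_cast hkd
  have hq : 4 * (t : ℝ) ≤ k * (d * δ) ^ q * δ := by
    have h1 := scale_mul_le ht (c := 4) (A := 1) (by
      have h2 : (1 : ℝ) ≤ d ^ 2 := one_le_pow₀ hd1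
      nlinarith)
    have h2 : (n : ℝ) * lam ≤ n * 1 := by
      gcongr
      linarith
    have h3 : (n : ℝ) ≤ k * (d * δ) ^ q * δ := by
      calc (n : ℝ) ≤ 1 * (d * δ) ^ q * 1 := by simpa using h.n_le
        _ ≤ _ := by gcongr
    linarith
  have hex : ∃ i, 4 * (t : ℝ) ≤ k * (d * δ) ^ i * δ := ⟨q, hq⟩
  obtain ⟨i, hi1, hiq, hi2⟩ : ∃ i, 4 * (t : ℝ) ≤ k * (d * δ) ^ i * δ ∧ i ≤ q ∧
      ∀ i' < i, k * (d * δ) ^ i' * δ < 4 * t :=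
    ⟨Nat.find hex, Nat.find_spec hex, Nat.find_min' hex hq, fun i' hi' =>
      not_le.mp (Nat.find_min hex hi')⟩
  have hi3 : k * (d * δ) ^ i * δ ≤ 4 * (t * (d * δ)) := by
    rcases Nat.eq_zero_or_pos i with h0 | h0
    · rw [h0]
      have h1 : (1 : ℝ) ≤ t := by exact_mod_cast ht1
      have h2 : k * δ ≤ d * δ := by gcongr
      simp only [pow_zero, mul_one]
      nlinarith
    · have h1 := hi2 (i - 1) (by omega)
      have h2 : (d * δ) ^ i = (d * δ) ^ (i - 1) * (d * δ) := by
        rw [← pow_succ, Nat.sub_add_cancel h0]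
      rw [h2]
      nlinarith
  refine ⟨i + 2, by omega, fun U₀ hU₀ hdisc π₀ => ?_⟩
  obtain ⟨U, π, g, b1, b2, b3⟩ := h.grow_chain ht π₀ hdisc i hiq (by rw [hU₀]; exact hi2)
  have hiη : (i : ℝ) * (lam / L) ≤ 1 * lam := by
    refine h.mul_eta_le ?_
    have : (i : ℝ) ≤ q := by exact_mod_cast hiq
    linarith [h.q_le]
  have hup : (1 + lam / L) ^ i ≤ 1 + 2 * lam := by
    have := one_add_pow_le hη0.le i (by linarith)
    linarith
  have hlow : 1 - 6 * lam ≤ (1 - 6 * (lam / L)) ^ i := by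
    have := le_one_sub_pow (x := 6 * (lam / L)) (by linarith) i
    linarith
  have hc0 : 0 ≤ k * (d * δ) ^ i * δ := by positivity
  have hΦ0 : 0 ≤ degSum G U₀ := Finset.sum_nonneg fun _ _ => by positivity
  have s1 : (1 - 8 * lam) * (k * (d * δ) ^ i * δ) ≤ degSum G U := by
    refine le_trans ?_ b1
    have h1 := h.degSum_ge U₀
    rw [hU₀] at h1
    calc (1 - 8 * lam) * (k * (d * δ) ^ i * δ)
        ≤ ((1 - 6 * lam) * (1 - lam)) * (k * (d * δ) ^ i * δ) := by gcongr; nlinarith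
      _ = (1 - 6 * lam) * (d * δ) ^ i * ((1 - lam) * δ * k) := by ring
      _ ≤ _ := by
        have : 0 ≤ 1 - 6 * lam := by linarith
        have : 0 ≤ 1 - lam := by linarith
        have : 0 ≤ (1 - 6 * (lam / L)) ^ i := by linarith
        gcongr
  have s2 : degSum G U ≤ (1 + 4 * lam) * (k * (d * δ) ^ i * δ) := by
    refine b2.trans ?_
    have h1 := h.degSum_le U₀
    rw [hU₀] at h1
    calc _ ≤ (1 + 2 * lam) * (d * δ) ^ i * ((1 + lam) * δ * k) := by gcongr
      _ = ((1 + 2 * lam) * (1 + lam)) * (k * (d * δ) ^ i * δ) := by ring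
      _ ≤ _ := by gcongr; nlinarith
  have htD : 0 ≤ (t : ℝ) * (d * δ) := by positivity
  have ht' : (0 : ℝ) ≤ t := by positivity
  obtain ⟨I, S, π', r1, r2, r3⟩ := h.spread_step ht1 ht0 ht π b3 (by nlinarith) (by nlinarith)
  refine ⟨I, S, π', ?_, r2, ?_⟩
  · intro φ hφ
    refine (r1 φ hφ).trans ?_
    refine (g (walkSum G K 0 4 φ) fun u l => walkSum_nonneg _ _ _ _ hφ).trans (le_of_eq ?_)
    refine Finset.sum_congr rfl fun z _ => ?_
    rw [show 2 * (i + 2) = 2 * i + 4 by ring, walkSum_add]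
    refine congrArg (fun f => walkSum G K 0 (2 * i) f z (π₀ z)) ?_
    funext u l
    exact walkSum_congr_mod _ _ _ _ (by omega) _ _
  · refine le_trans ?_ r3
    have h1 : 0 ≤ 1 - 14 * lam := by linarith
    calc (1 - 50 * lam) * (k * (d * δ) ^ (i + 2))
        ≤ ((1 - 14 * lam) * (1 - 8 * lam)) * (k * (d * δ) ^ (i + 2)) := by gcongr; nlinarith
      _ = (1 - 14 * lam) * (d * δ) * d * ((1 - 8 * lam) * (k * (d * δ) ^ i * δ)) := by ring
      _ ≤ _ := by gcongr

theorem n_pos (h : IsPseudo G K d δ lam L q) : 0 < (n : ℝ) := by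
  have h1 := h.n_bound (a := 0) (b := 0) (c := 0) (by norm_num) (by norm_num) (by norm_num)
  have h2 := h.lam_pos
  simp only [pow_zero, mul_one] at h1
  by_contra hc
  nlinarith

theorem sum_ite_mix (h : IsPseudo G K d δ lam L q) {T : Finset (Fin n)}
    (hT : lam * n / 10 ^ 8 ≤ T.card) (hT' : (T.card : ℝ) ≤ lam * n / 10 ^ 6) :
    (1 - 2 * lam) * δ * T.card ≤ ∑ v, if v ∉ T ∧
      (1 - lam) * (δ / n) * T.card ≤ (nb G v ∩ T).card then (1 - lam) * (δ / n) * T.card else 0 := by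
  have hl := h.lam_le
  have hl0 := h.lam_pos
  have hδ := h.δ_pos
  have hn := h.n_pos
  set c := (1 - lam) * (δ / n) * T.card with hc
  set A := Finset.univ.filter fun v => v ∉ T ∧ c ≤ (nb G v ∩ T).card with hA
  set B := Finset.univ.filter fun v => v ∉ T ∧ ((nb G v ∩ T).card : ℝ) < c with hB
  have hBc : (B.card : ℝ) ≤ lam * n / 10 ^ 8 := by
    by_contra hlt
    rw [not_le] at hlt
    have hne : B.Nonempty := by
      rw [← Finset.card_pos]
      have : 0 < lam * n / 10 ^ 8 := by positivity
      exact_mod_cast this.trans hlt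
    have h1 := h.mix T B (Finset.disjoint_right.mpr fun v hv => by
      simp only [hB, Finset.mem_filter] at hv
      exact hv.2.1) hT hlt.le
    have h2 : ∑ v ∈ B, ((nb G v ∩ T).card : ℝ) < ∑ v ∈ B, c := by
      refine Finset.sum_lt_sum_of_nonempty hne fun v hv => ?_
      simp only [hB, Finset.mem_filter] at hv
      exact hv.2.2
    rw [Finset.sum_const, nsmul_eq_mul] at h2
    linarith
  have hcov : (n : ℝ) ≤ A.card + (T.card + B.card) := by
    have h1 : (Finset.univ : Finset (Fin n)) ⊆ A ∪ (T ∪ B) := by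
      intro v _
      simp only [Finset.mem_union, hA, hB, Finset.mem_filter, Finset.mem_univ, true_and]
      by_cases hv : v ∈ T
      · exact Or.inr (Or.inl hv)
      · rcases le_or_gt c ((nb G v ∩ T).card : ℝ) with h2 | h2
        · exact Or.inl ⟨hv, h2⟩
        · exact Or.inr (Or.inr ⟨hv, h2⟩)
    have h2 := (Finset.card_le_card h1).trans ((Finset.card_union_le _ _).trans
      (Nat.add_le_add_left (Finset.card_union_le _ _) _))
    rw [Finset.card_univ, Fintype.card_fin] at h2
    exact_mod_cast h2
  have hln : 0 < lam * n := by positivity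
  have hAn : (1 - lam) * n ≤ A.card := by nlinarith
  rw [← Finset.sum_filter, Finset.sum_const, nsmul_eq_mul]
  have hδT : 0 ≤ δ * (T.card : ℝ) := by positivity
  calc (1 - 2 * lam) * δ * T.card = (1 - 2 * lam) * (δ * T.card) := by ring
    _ ≤ ((1 - lam) * (1 - lam)) * (δ * T.card) := by gcongr; nlinarith
    _ = (1 - lam) * n * c := by rw [hc]; field_simp
    _ ≤ A.card * c := by
      have : 0 ≤ 1 - lam := by linarith
      have : 0 ≤ c := by positivity
      gcongr

/-- The walks of length `2 * j` ending in a state satisfying `χ` can be followed by a final step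
to a vertex `v` in a nearly uniform way, after discarding the exceptional ones. -/
theorem exists_uniform_minorant (h : IsPseudo G K d δ lam L q) {k j : ℕ} (hj : j ≤ q + 2)
    {U₀ : Finset (Fin n)} (hk : U₀.card = k) {π₀ : Fin n → List (Fin n)}
    (hsp : ∃ (I : Finset (Finset (Fin n))) (S : Finset (Fin n) → Finset (Fin n))
        (π' : Finset (Fin n) → Fin n → List (Fin n)),
        (∀ φ : Fin n → List (Fin n) → ℝ, (∀ u l, 0 ≤ φ u l) →
          ∑ A ∈ I, ∑ z ∈ S A, φ z (π' A z) ≤ ∑ z ∈ U₀, walkSum G K 0 (2 * j) φ z (π₀ z)) ∧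
        (∀ A ∈ I, 2 * (lam * n / 10 ^ 8) ≤ (S A).card ∧ ((S A).card : ℝ) ≤ lam * n / 10 ^ 6) ∧
        (1 - 50 * lam) * (k * (d * δ) ^ j) ≤ ∑ A ∈ I, ((S A).card : ℝ))
    (χ : Fin n → List (Fin n) → Prop) :
    ∃ g : Fin n → ℝ, (∀ v, 0 ≤ g v) ∧ (∀ v, g v ≤ δ * (k * (d * δ) ^ j) / n) ∧
      (∀ v, g v ≤ ∑ z ∈ U₀, walkSum G K 0 (2 * j)
        (fun u l => if χ u l ∧ G.Adj v u then 1 else 0) z (π₀ z)) ∧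
      (1 - 90 * lam) * (δ * (k * (d * δ) ^ j)) - 2 * δ * ∑ z ∈ U₀, walkSum G K 0 (2 * j)
        (fun u l => if χ u l then 0 else 1) z (π₀ z) ≤ ∑ v, g v := by
  obtain ⟨I, S, π', r1, r2, r3⟩ := hsp
  have hl := h.lam_le
  have hl0 := h.lam_pos
  have hδ := h.δ_pos
  have hn := h.n_pos
  have hD := h.D_pos
  set T : Finset (Fin n) → Finset (Fin n) := fun A => (S A).filter fun z => χ z (π' A z) with hT
  set c : Finset (Fin n) → ℝ := fun A => (1 - lam) * (δ / n) * (T A).card with hc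
  set gA : Finset (Fin n) → Fin n → ℝ := fun A v => if lam * n / 10 ^ 8 ≤ (T A).card then
    (if v ∉ T A ∧ c A ≤ (nb G v ∩ T A).card then c A else 0) else 0 with hgA
  have hTS : ∀ A, T A ⊆ S A := fun A => Finset.filter_subset _ _
  have hTSc : ∀ A, ((T A).card : ℝ) ≤ (S A).card := fun A => by
    exact_mod_cast Finset.card_le_card (hTS A)
  have hl1 : 0 ≤ 1 - lam := by linarith
  have hc0 : ∀ A, 0 ≤ c A := fun A => by simp only [hc]; positivity
  have hgA0 : ∀ A v, 0 ≤ gA A v := by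
    intro A v
    simp only [hgA]
    split_ifs
    exacts [hc0 A, le_rfl, le_rfl]
  have hgAc : ∀ A v, gA A v ≤ δ / n * (S A).card := by
    intro A v
    have h1 : c A ≤ δ / n * (S A).card := by
      calc c A = (1 - lam) * (δ / n * (T A).card) := by simp only [hc]; ring
        _ ≤ 1 * (δ / n * (S A).card) := by
          have := hTSc A
          gcongr
          linarith
        _ = _ := one_mul _
    have h2 : 0 ≤ δ / n * ((S A).card : ℝ) := by positivity
    simp only [hgA]
    split_ifs
    exacts [h1, h2, h2]
  have hgAT : ∀ A v, gA A v ≤ (nb G v ∩ T A).card := by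
    intro A v
    have h2 : (0 : ℝ) ≤ (nb G v ∩ T A).card := by positivity
    simp only [hgA]
    split_ifs with _ h1
    exacts [h1.2, h2, h2]
  have hsum : ∀ A ∈ I, δ * ((1 - 2 * lam) * (S A).card - 2 * (S A \ T A).card) ≤ ∑ v, gA A v := by
    intro A hA
    have h1 : ((S A \ T A).card : ℝ) + (T A).card = (S A).card := by
      rw [← Nat.cast_add, Finset.card_sdiff_add_card_eq_card (hTS A)]
    have h3 : (0 : ℝ) ≤ (S A \ T A).card := by positivity
    by_cases hbig : lam * n / 10 ^ 8 ≤ (T A).card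
    · simp only [hgA, if_pos hbig]
      refine le_trans ?_ (h.sum_ite_mix hbig ((hTSc A).trans (r2 A hA).2))
      rw [mul_comm (1 - 2 * lam) δ, mul_assoc]
      gcongr
      nlinarith
    · refine le_trans ?_ (Finset.sum_nonneg fun v _ => hgA0 A v)
      have h2 := (r2 A hA).1
      have h4 : (1 - 2 * lam) * ((S A).card : ℝ) - 2 * (S A \ T A).card ≤ 0 := by nlinarith
      exact mul_nonpos_of_nonneg_of_nonpos hδ.le h4
  have htot : ∑ A ∈ I, ((S A).card : ℝ) ≤ (1 + 30 * lam) * (k * (d * δ) ^ j) := by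
    have h1 := r1 (fun _ _ => 1) fun _ _ => zero_le_one
    simp only [Finset.sum_const, nsmul_eq_mul, mul_one] at h1
    refine h1.trans ?_
    have h2 : ∀ z ∈ U₀, walkSum G K 0 (2 * j) (fun _ _ => (1 : ℝ)) z (π₀ z) ≤
        (1 + 30 * lam) * (d * δ) ^ j := by
      intro z _
      rw [walkSum_eq_walkOp (2 * j) (fun _ => 1), ← prodDeg_two_mul 0 j]
      refine (h.walkOp_one 0 (2 * j) ?_ z).2
      have h3 : ((2 * j : ℕ) : ℝ) ≤ (2 * (q + 2) : ℕ) := by exact_mod_cast by omega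
      push_cast at h3 ⊢
      linarith [h.q_le, h.one_le_L]
    refine (Finset.sum_le_card_nsmul _ _ _ h2).trans (le_of_eq ?_)
    rw [hk, nsmul_eq_mul]
    ring
  have hmiss : ∑ A ∈ I, ((S A \ T A).card : ℝ) ≤ ∑ z ∈ U₀, walkSum G K 0 (2 * j)
      (fun u l => if χ u l then 0 else 1) z (π₀ z) := by
    refine le_trans (le_of_eq ?_) (r1 _ fun u l => by positivity)
    refine Finset.sum_congr rfl fun A _ => ?_
    simp only [hT, ← Finset.filter_not, Finset.card_filter, ite_not]
    push_cast
    rfl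
  have hX : 0 ≤ k * (d * δ) ^ j := by positivity
  have hl30 : 0 ≤ 1 - 30 * lam := by linarith
  refine ⟨fun v => (1 - 30 * lam) * ∑ A ∈ I, gA A v, ?_, ?_, ?_, ?_⟩
  · intro v
    exact mul_nonneg hl30 (Finset.sum_nonneg fun A _ => hgA0 A v)
  · intro v
    calc (1 - 30 * lam) * ∑ A ∈ I, gA A v ≤ (1 - 30 * lam) * ∑ A ∈ I, δ / n * (S A).card := by
          gcongr with A
          exact hgAc A v
      _ = (1 - 30 * lam) * (δ / n) * ∑ A ∈ I, ((S A).card : ℝ) := by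
          rw [← Finset.mul_sum]
          ring
      _ ≤ (1 - 30 * lam) * (δ / n) * ((1 + 30 * lam) * (k * (d * δ) ^ j)) := by gcongr
      _ = ((1 - 30 * lam) * (1 + 30 * lam)) * (δ * (k * (d * δ) ^ j) / n) := by ring
      _ ≤ 1 * (δ * (k * (d * δ) ^ j) / n) := by gcongr; nlinarith
      _ = _ := one_mul _
  · intro v
    refine le_trans ?_ (r1 _ fun u l => by positivity)
    have h1 : 0 ≤ ∑ A ∈ I, gA A v := Finset.sum_nonneg fun A _ => hgA0 A v
    calc (1 - 30 * lam) * ∑ A ∈ I, gA A v ≤ ∑ A ∈ I, gA A v := by nlinarith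
      _ ≤ _ := by
        refine Finset.sum_le_sum fun A _ => (hgAT A v).trans (le_of_eq ?_)
        rw [Finset.sum_boole]
        congr 2
        ext z
        simp only [hT, Finset.mem_inter, Finset.mem_filter, mem_nb]
        tauto
  · rw [← Finset.mul_sum, Finset.sum_comm]
    set Wb := ∑ z ∈ U₀, walkSum G K 0 (2 * j) (fun u l => if χ u l then 0 else 1) z (π₀ z)
    have hWb : 0 ≤ Wb := le_trans (Finset.sum_nonneg fun _ _ => by positivity) hmiss
    have h1 := Finset.sum_le_sum hsum
    rw [← Finset.mul_sum, Finset.sum_sub_distrib, ← Finset.mul_sum, ← Finset.mul_sum] at h1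
    have h2 : δ * ((1 - 2 * lam) * ((1 - 50 * lam) * (k * (d * δ) ^ j)) - 2 * Wb) ≤
        ∑ A ∈ I, ∑ v, gA A v := by
      refine le_trans ?_ h1
      have : 0 ≤ 1 - 2 * lam := by linarith
      gcongr
    have h3 : 0 ≤ δ * (k * (d * δ) ^ j) := by positivity
    have h4 : 0 ≤ δ * Wb := by positivity
    calc (1 - 90 * lam) * (δ * (k * (d * δ) ^ j)) - 2 * δ * Wb
        ≤ ((1 - 30 * lam) * ((1 - 2 * lam) * (1 - 50 * lam))) * (δ * (k * (d * δ) ^ j)) -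
          (1 - 30 * lam) * (2 * (δ * Wb)) := by
          have h5 : 1 - 90 * lam ≤ (1 - 30 * lam) * ((1 - 2 * lam) * (1 - 50 * lam)) := by
            nlinarith [mul_pos hl0 hl0]
          have h6 := mul_le_mul_of_nonneg_right h5 h3
          nlinarith
      _ = (1 - 30 * lam) *
          (δ * ((1 - 2 * lam) * ((1 - 50 * lam) * (k * (d * δ) ^ j)) - 2 * Wb)) := by ring
      _ ≤ _ := by gcongr

end IsPseudo

theorem walkOp_eq_sum {G K : SimpleGraph (Fin n)} (s k : ℕ) (f : Fin n → ℝ) (v : Fin n) :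
    walkOp G K s (k + 1) f v = ∑ w, f w *
      walkOp G K s k (fun u => if (altGraph G K (s + k)).Adj w u then 1 else 0) v := by
  have h1 : walkOp G K (s + k) 1 f = fun u =>
      ∑ w, f w * (if (altGraph G K (s + k)).Adj w u then 1 else 0) := by
    funext u
    simp only [walkOp_succ, walkOp_zero, mul_ite, mul_one, mul_zero]
    rw [← Finset.sum_filter]
    refine Finset.sum_congr ?_ fun _ _ => rfl
    ext w
    simp [nb, SimpleGraph.adj_comm]
  rw [walkOp_add, h1, walkOp_finset_sum]
  simp only [walkOp_const_mul]

namespace IsPseudo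

variable {G K : SimpleGraph (Fin n)} {d : ℕ} {δ lam L : ℝ} {q : ℕ}

theorem exists_vertex_minorant (h : IsPseudo G K d δ lam L q) :
    ∃ j, j ≤ q + 2 ∧ ∀ v, ∃ p : Fin n → ℝ, (∀ w, 0 ≤ p w) ∧
      (∀ w, p w ≤ δ * (d * δ) ^ j / n) ∧
      (∀ w, p w ≤ walkOp G K 0 (2 * j) (fun u => if G.Adj w u then 1 else 0) v) ∧
      (1 - 90 * lam) * (δ * (d * δ) ^ j) ≤ ∑ w, p w := by
  obtain ⟨j, hj, hsp⟩ := h.spread 1 le_rfl (by exact_mod_cast h.one_le_d)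
  refine ⟨j, hj, fun v => ?_⟩
  obtain ⟨p, p1, p2, p3, p4⟩ := h.exists_uniform_minorant hj (Finset.card_singleton v)
    (hsp {v} (Finset.card_singleton v) (by
      rw [disc_singleton]
      have := h.eta_pos
      have := h.δ_pos
      positivity) fun _ => []) fun _ _ => True
  refine ⟨p, p1, by simpa using p2, fun w => ?_, ?_⟩
  · simpa [walkOp] using p3 w
  · have h0 : walkSum G K 0 (2 * j) (fun _ _ => (0 : ℝ)) v [] = 0 := by
      have := walkSum_const_mul (G := G) (K := K) 0 (2 * j) (fun _ _ => 0) 0 v []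
      simpa using this
    simpa [h0] using p4

theorem exists_start_weight (h : IsPseudo G K d δ lam L q) {j : ℕ} {x : Fin n} {p : Fin n → ℝ}
    (p0 : ∀ w, 0 ≤ p w) (p1 : ∀ w, p w ≤ δ * (d * δ) ^ j / n)
    (p2 : ∀ w, p w ≤ walkOp G K 0 (2 * j) (fun u => if G.Adj w u then 1 else 0) x)
    (p3 : (1 - 90 * lam) * (δ * (d * δ) ^ j) ≤ ∑ w, p w) :
    ∃ ω : List (Fin n) → ℝ, (∀ l, 0 ≤ ω l) ∧ (∀ l, ω l ≤ 1) ∧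
      (1 - 90 * lam) * (d * δ) ^ (j + 1) ≤
        walkSum G K 0 (2 * (j + 1)) (fun _ l => ω l) x [] ∧
      ∀ φ : Fin n → ℝ, (∀ v, 0 ≤ φ v) →
        walkSum G K 0 (2 * (j + 1)) (fun v l => ω l * φ v) x [] ≤
          (d * δ) ^ (j + 1) / n * ∑ v, φ v := by
  set cnt : Fin n → ℝ := fun w =>
    walkOp G K 0 (2 * j) (fun u => if G.Adj w u then 1 else 0) x with hcnt
  set ω : List (Fin n) → ℝ := fun l => (l.head?.map fun w => p w / cnt w).getD 0 with hω
  have hcnt0 : ∀ w, 0 ≤ cnt w := fun w => (p0 w).trans (p2 w)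
  have key : ∀ φ : Fin n → ℝ, walkSum G K 0 (2 * (j + 1)) (fun v l => ω l * φ v) x [] =
      ∑ w, p w * ∑ v ∈ nb K w, φ v := by
    intro φ
    have hG : altGraph G K (0 + 2 * j) = G := by simp [altGraph]
    have hK : altGraph G K (0 + 2 * j + 1) = K := by
      simp only [altGraph, ite_eq_right_iff]
      omega
    have h1 : walkSum G K (0 + 2 * j) 2 (fun v l => ω l * φ v) = fun u _ =>
        walkOp G K (0 + 2 * j) 1 (fun w => p w / cnt w * ∑ v ∈ nb K w, φ v) u := by
      funext u l
      simp only [walkSum_succ, walkOp_succ, walkSum_zero, walkOp_zero, hK]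
      refine Finset.sum_congr rfl fun w _ => ?_
      simp [hω, Finset.mul_sum]
    rw [show 2 * (j + 1) = 2 * j + 2 by ring, walkSum_add, h1,
      walkSum_eq_walkOp (2 * j) (walkOp G K (0 + 2 * j) 1 _), ← walkOp_add, walkOp_eq_sum, hG]
    refine Finset.sum_congr rfl fun w _ => ?_
    change p w / cnt w * _ * cnt w = _
    by_cases hw : cnt w = 0
    · have h2 : p w = 0 := le_antisymm (hw ▸ p2 w) (p0 w)
      rw [h2, hw]
      simp
    · field_simp
  refine ⟨ω, ?_, ?_, ?_, ?_⟩
  · rintro (_ | ⟨w, l⟩)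
    · simp [hω]
    · simpa [hω] using div_nonneg (p0 w) (hcnt0 w)
  · rintro (_ | ⟨w, l⟩)
    · simp [hω]
    · simpa [hω] using div_le_one_of_le₀ (p2 w) (hcnt0 w)
  · have h1 := key fun _ => 1
    simp only [mul_one, Finset.sum_const, nsmul_eq_mul, h.degK] at h1
    rw [h1, ← Finset.sum_mul]
    have h2 := mul_le_mul_of_nonneg_right p3 h.d_pos.le
    refine le_trans (le_of_eq ?_) h2
    ring
  · intro φ hφ
    rw [key]
    calc ∑ w, p w * ∑ v ∈ nb K w, φ v
        ≤ ∑ w, δ * (d * δ) ^ j / n * ∑ v ∈ nb K w, φ v := by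
          refine Finset.sum_le_sum fun w _ => ?_
          have : 0 ≤ ∑ v ∈ nb K w, φ v := Finset.sum_nonneg fun v _ => hφ v
          exact mul_le_mul_of_nonneg_right (p1 w) this
      _ = δ * (d * δ) ^ j / n * ∑ v, d * φ v := by
          rw [← Finset.mul_sum, sum_nb_comm K fun _ v => φ v]
          simp only [Finset.sum_const, nsmul_eq_mul, h.degK]
      _ = _ := by
          rw [← Finset.mul_sum]
          ring

theorem walkOp_ge_average (h : IsPseudo G K d δ lam L q) {j r : ℕ} {v : Fin n} {p : Fin n → ℝ}
    (p1 : ∀ w, p w ≤ δ * (d * δ) ^ j / n)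
    (p2 : ∀ w, p w ≤ walkOp G K 0 (2 * j) (fun u => if G.Adj w u then 1 else 0) v)
    (p3 : (1 - 90 * lam) * (δ * (d * δ) ^ j) ≤ ∑ w, p w) (hr : ((2 * r + 1 : ℕ) : ℝ) ≤ 25 * L)
    {g : Fin n → ℝ} {θ : ℝ} (g0 : ∀ u, 0 ≤ g u) (g1 : ∀ u, g u ≤ θ) :
    (d * δ) ^ (j + 1 + r) / n * (∑ u, g u - 210 * lam * (n * θ)) ≤
      walkOp G K 0 (2 * (j + 1 + r)) g v := by
  have hl := h.lam_le
  have hl0 := h.lam_pos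
  have hδ := h.δ_pos
  have hd := h.d_pos
  have hn := h.n_pos
  have hD := h.D_pos
  have hθ : 0 ≤ θ := (g0 v).trans (g1 v)
  have hG : altGraph G K (0 + 2 * j) = G := by simp [altGraph]
  set θ₁ := δ * (d * δ) ^ j / n with hθ₁
  have hθ₁0 : 0 ≤ θ₁ := by positivity
  set f := walkOp G K (0 + (2 * j + 1)) (2 * r + 1) g with hf
  have hP : prodDeg d δ (0 + (2 * j + 1)) (2 * r + 1) = d * (d * δ) ^ r := by
    rw [show 2 * r + 1 = 1 + 2 * r by ring, prodDeg_add, prodDeg_two_mul]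
    simp [prodDeg]
  have hf0 : ∀ u, 0 ≤ f u := walkOp_nonneg _ _ g0
  have hf1 : ∀ u, f u ≤ 2 * (d * (d * δ) ^ r) * θ := by
    intro u
    refine (walkOp_le_of_le _ _ g1 u).trans ?_
    rw [mul_comm θ, ← hP]
    exact mul_le_mul_of_nonneg_right (h.walkOp_one_le _ _ hr u) hθ
  have hfs : (1 - 30 * lam) * (d * (d * δ) ^ r) * ∑ u, g u ≤ ∑ w, f w := by
    have h1 := sum_mul_walkOp (G := G) (K := K) (2 * r + 1) g (0 + (2 * j + 1)) fun _ => 1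
    simp only [one_mul] at h1
    rw [hf, h1, Finset.mul_sum]
    refine Finset.sum_le_sum fun u _ => mul_le_mul_of_nonneg_right ?_ (g0 u)
    rw [← hP, prodDeg_congr_mod (s := 0 + (2 * j + 1)) (s' := 0 + (2 * j + 1) + (2 * r + 1) + 1)
      _ (by omega)]
    exact (h.walkOp_one _ _ hr u).1
  have hgs : ∑ u, g u ≤ n * θ := by
    have := Finset.sum_le_card_nsmul Finset.univ g θ fun u _ => g1 u
    simpa using this
  have hw : ∑ w, p w * f w ≤ walkOp G K 0 (2 * (j + 1 + r)) g v := by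
    rw [show 2 * (j + 1 + r) = 2 * j + 1 + (2 * r + 1) by ring, walkOp_add, walkOp_eq_sum, hG]
    refine Finset.sum_le_sum fun w _ => ?_
    rw [mul_comm]
    exact mul_le_mul_of_nonneg_left (p2 w) (hf0 w)
  have hdef : ∑ w, (θ₁ - p w) * f w ≤ 90 * lam * (n * θ₁) * (2 * (d * (d * δ) ^ r) * θ) := by
    calc ∑ w, (θ₁ - p w) * f w ≤ ∑ w, (θ₁ - p w) * (2 * (d * (d * δ) ^ r) * θ) := by
          refine Finset.sum_le_sum fun w _ => mul_le_mul_of_nonneg_left (hf1 w) ?_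
          linarith [p1 w]
      _ = (n * θ₁ - ∑ w, p w) * (2 * (d * (d * δ) ^ r) * θ) := by
          rw [← Finset.sum_mul, Finset.sum_sub_distrib]
          simp
      _ ≤ _ := by
          have : n * θ₁ = δ * (d * δ) ^ j := by rw [hθ₁]; field_simp
          gcongr
          rw [this]
          linarith
  have hsplit : ∑ w, p w * f w = θ₁ * ∑ w, f w - ∑ w, (θ₁ - p w) * f w := by
    rw [Finset.mul_sum, ← Finset.sum_sub_distrib]
    exact Finset.sum_congr rfl fun w _ => by ring
  have hM : θ₁ * (d * (d * δ) ^ r) = (d * δ) ^ (j + 1 + r) / n := by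
    rw [hθ₁]
    ring
  have h1 := mul_le_mul_of_nonneg_left hfs hθ₁0
  have h2 : θ₁ * ((1 - 30 * lam) * (d * (d * δ) ^ r) * ∑ u, g u) =
      (d * δ) ^ (j + 1 + r) / n * ((1 - 30 * lam) * ∑ u, g u) := by
    rw [← hM]; ring
  have h3 : 90 * lam * (n * θ₁) * (2 * (d * (d * δ) ^ r) * θ) =
      (d * δ) ^ (j + 1 + r) / n * (180 * lam * (n * θ)) := by
    rw [← hM]; ring
  have h4 : (d * δ) ^ (j + 1 + r) / n * (∑ u, g u - 210 * lam * (n * θ)) ≤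
      (d * δ) ^ (j + 1 + r) / n * ((1 - 30 * lam) * ∑ u, g u - 180 * lam * (n * θ)) := by
    have := mul_le_mul_of_nonneg_left hgs hl0.le
    exact mul_le_mul_of_nonneg_left (by linarith) (by positivity)
  linarith

end IsPseudo

/-- The list `l` has no repetition and avoids `S`. -/
def good (S : Finset (Fin n)) (l : List (Fin n)) : Prop := l.Nodup ∧ ∀ u ∈ l, u ∉ S

theorem card_inter_le_cum (S : Finset (Fin n)) (l : List (Fin n)) :
    ((S ∩ l.toFinset).card : ℝ) ≤ cum (hitSet S) l := by
  induction l with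
  | nil => simp [cum]
  | cons u l ih =>
    rw [cum, hitSet, List.toFinset_cons]
    by_cases hu : u ∈ S
    · rw [Finset.inter_insert_of_mem hu, if_pos hu]
      have : ((insert u (S ∩ l.toFinset)).card : ℝ) ≤ (S ∩ l.toFinset).card + 1 := by
        exact_mod_cast Finset.card_insert_le _ _
      linarith
    · rw [Finset.inter_insert_of_notMem hu, if_neg hu]
      linarith

namespace IsPseudo

variable {G K : SimpleGraph (Fin n)} {d : ℕ} {δ lam L : ℝ} {q : ℕ}

theorem sum_bad_le (h : IsPseudo G K d δ lam L q) {y : Fin n} {U₀ S F : Finset (Fin n)} {j : ℕ}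
    (hy : y ∉ S) (hU : ∀ z ∈ U₀, z ≠ y ∧ z ∉ S) (hS : (S.card + (2 * j : ℕ) + 2 : ℝ) ≤ 100 * L)
    (hj : ((2 * j : ℕ) : ℝ) ≤ 25 * L) (hF : (F.card : ℝ) ≤ 100 * L) (hyF : y ∉ F) :
    ∑ z ∈ U₀, walkSum G K 0 (2 * j)
      (fun u l => if good (S ∪ F) (u :: l) then 0 else 1) z [y] ≤
      (1202 * lam * U₀.card + 2 * (U₀ ∩ F).card) * (d * δ) ^ j := by
  have h1 : ∀ z ∈ U₀, walkSum G K 0 (2 * j)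
      (fun u l => if good (S ∪ F) (u :: l) then 0 else 1) z [y] ≤
      (1202 * lam + 2 * if z ∈ F then 1 else 0) * (d * δ) ^ j := by
    intro z hz
    obtain ⟨hz1, hz2⟩ := hU z hz
    have e1 := h.walkSum_cum_hitMem_le S z [y] hj (by
      push_cast at hS
      simp only [List.length_singleton]
      push_cast
      linarith)
    have e2 := h.walkSum_cum_hitSet_le F z [y] hj hF
    have e3 : walkSum G K 0 (2 * j)
        (fun u l => if good (S ∪ F) (u :: l) then 0 else 1) z [y] ≤
        walkSum G K 0 (2 * j)
          (fun u l => cum (hitMem S) (u :: l) + cum (hitSet F) (u :: l)) z [y] := by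
      refine walkSum_mono' _ _ _ _ fun u l => ?_
      have c1 := cum_nonneg (hitMem_nonneg S) (u :: l)
      have c2 := cum_nonneg (hitSet_nonneg F) (u :: l)
      split_ifs with hg
      · linarith
      · by_cases hg' : good S (u :: l)
        · have : ∃ a ∈ u :: l, a ∈ F := by
            by_contra! hc
            exact hg ⟨hg'.1, fun a ha => by simp [hg'.2 a ha, hc a ha]⟩
          linarith [one_le_cum_hitSet this]
        · linarith [one_le_cum_hitMem hg']
    rw [walkSum_add_fun] at e3
    rw [prodDeg_two_mul] at e1 e2
    have e4 : cum (hitMem S) [z, y] = 0 := by simp [cum, hitMem, hz1, hz2, hy]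
    have e5 : cum (hitSet F) [z, y] = if z ∈ F then 1 else 0 := by simp [cum, hitSet, hyF]
    rw [e4] at e1
    rw [e5] at e2
    linarith
  refine (Finset.sum_le_sum h1).trans (le_of_eq ?_)
  rw [← Finset.sum_mul, Finset.sum_add_distrib, Finset.sum_const, nsmul_eq_mul,
    ← Finset.mul_sum, Finset.sum_boole, Finset.filter_mem_eq_inter]
  ring

theorem exists_end_weight (h : IsPseudo G K d δ lam L q) {y : Fin n} {U₀ S : Finset (Fin n)}
    {j : ℕ} (hy : y ∉ S) (hU : ∀ z ∈ U₀, z ≠ y ∧ z ∉ S)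
    (hS : (S.card + (2 * j : ℕ) + 2 : ℝ) ≤ 100 * L) (hj' : ((2 * j : ℕ) : ℝ) ≤ 25 * L)
    (hmin : ∀ χ : Fin n → List (Fin n) → Prop,
      ∃ g : Fin n → ℝ, (∀ v, 0 ≤ g v) ∧ (∀ v, g v ≤ δ * (U₀.card * (d * δ) ^ j) / n) ∧
      (∀ v, g v ≤ ∑ z ∈ U₀, walkSum G K 0 (2 * j)
        (fun u l => if χ u l ∧ G.Adj v u then 1 else 0) z [y]) ∧
      (1 - 90 * lam) * (δ * (U₀.card * (d * δ) ^ j)) - 2 * δ * ∑ z ∈ U₀, walkSum G K 0 (2 * j)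
        (fun u l => if χ u l then 0 else 1) z [y] ≤ ∑ v, g v) (F : Finset (Fin n)) :
    ∃ g : Fin n → ℝ, (∀ v, 0 ≤ g v) ∧ (∀ v, g v ≤ δ * (U₀.card * (d * δ) ^ j) / n) ∧
      (∀ v, g v ≤ ∑ z ∈ U₀, walkSum G K 0 (2 * j)
        (fun u l => if good (S ∪ F) (u :: l) ∧ G.Adj v u then 1 else 0) z [y]) ∧
      ((F.card : ℝ) ≤ 100 * L → y ∉ F →
        δ * (d * δ) ^ j * ((1 - 2494 * lam) * U₀.card - 4 * (U₀ ∩ F).card) ≤ ∑ v, g v) := by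
  obtain ⟨g, g1, g2, g3, g4⟩ := hmin fun u l => good (S ∪ F) (u :: l)
  refine ⟨g, g1, g2, g3, fun hF hyF => le_trans ?_ g4⟩
  have h1 := mul_le_mul_of_nonneg_left (h.sum_bad_le hy hU hS hj' hF hyF)
    (by linarith [h.δ_pos] : 0 ≤ 2 * δ)
  linarith

theorem walkOp_indicator_le (h : IsPseudo G K d δ lam L q) {Q : Finset (Fin n)}
    (hQ : (Q.card : ℝ) ≤ 100 * L) {k : ℕ} (hk : ((k + 2 : ℕ) : ℝ) ≤ 25 * L) (v : Fin n) :
    walkOp G K 0 (k + 2) (fun u => if u ∈ Q then 1 else 0) v ≤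
      12 * (lam / L) * prodDeg d δ 0 (k + 2) := by
  have hη := h.eta_pos
  have hD := h.D_pos
  rw [walkOp_add, prodDeg_add, prodDeg_two]
  refine (walkOp_le_of_le 0 k (fun u => h.two_step_hit_small _ Q hQ u) v).trans ?_
  have h1 := h.walkOp_one_le 0 k (by push_cast at hk; linarith) v
  calc _ ≤ 6 * (lam / L) * (d * δ) * (2 * prodDeg d δ 0 k) := by gcongr
    _ = _ := by ring

theorem sum_walkOp_hit_le (h : IsPseudo G K d δ lam L q) {Q : Finset (Fin n)}
    (hQ : (Q.card : ℝ) ≤ 100 * L) {m : ℕ} (hm : 1 ≤ m) (hmL : ((2 * m : ℕ) : ℝ) ≤ 20 * L)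
    (s' : Fin n) :
    ∑ i ∈ Finset.range (2 * m), ∑ v, walkOp G K 0 (i + 1) (fun u => (if u ∈ Q then 1 else 0) *
      walkOp G K (i + 1) (2 * m - (i + 1)) (fun u => if G.Adj u s' then 1 else 0) u) v ≤
      500 * lam * (δ * (d * δ) ^ m) := by
  have hη := h.eta_pos
  have hD := h.D_pos
  have hδ := h.δ_pos
  have hL := h.L_pos
  have hl := h.lam_pos
  have hP : prodDeg d δ 0 (2 * m + 1) = δ * (d * δ) ^ m := by
    rw [prodDeg_add, prodDeg_two_mul]
    simp [prodDeg, mul_comm]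
  have key : ∀ i < 2 * m, ∑ v, walkOp G K 0 (i + 1) (fun u => (if u ∈ Q then 1 else 0) *
      walkOp G K (i + 1) (2 * m - (i + 1)) (fun u => if G.Adj u s' then 1 else 0) u) v ≤
      2 * prodDeg d δ (2 * m - i) (i + 1) *
        walkOp G K 0 (2 * m - i) (fun u => if u ∈ Q then 1 else 0) s' := by
    intro i hi
    have hnn : ∀ u, 0 ≤ (if u ∈ Q then (1 : ℝ) else 0) *
        walkOp G K (i + 1) (2 * m - (i + 1)) (fun u => if G.Adj u s' then 1 else 0) u := by
      intro u
      refine mul_nonneg (by split_ifs <;> norm_num) (walkOp_nonneg _ _ (fun u => ?_) u)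
      split_ifs <;> norm_num
    have e1 := sum_mul_walkOp (G := G) (K := K) (i + 1) (fun u => (if u ∈ Q then 1 else 0) *
      walkOp G K (i + 1) (2 * m - (i + 1)) (fun u => if G.Adj u s' then 1 else 0) u) 0 (fun _ => 1)
    simp only [one_mul] at e1
    have e2 := sum_mul_walkOp (G := G) (K := K) (2 * m - (i + 1))
      (fun u => if G.Adj u s' then 1 else 0) (i + 1) (fun u => if u ∈ Q then 1 else 0)
    have e3 : ∑ u, walkOp G K (i + 1 + (2 * m - (i + 1)) + 1) (2 * m - (i + 1))
        (fun u => if u ∈ Q then 1 else 0) u * (if G.Adj u s' then 1 else 0) =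
        walkOp G K 0 (2 * m - i) (fun u => if u ∈ Q then 1 else 0) s' := by
      rw [show 2 * m - i = 2 * m - (i + 1) + 1 by omega, walkOp_succ]
      simp only [mul_ite, mul_one, mul_zero]
      rw [← Finset.sum_filter]
      refine Finset.sum_congr ?_ fun u _ => walkOp_congr_mod (by omega) _ _ _
      ext u
      simp [mem_nb, altGraph, G.adj_comm]
    rw [e1, ← e3, ← e2, Finset.mul_sum]
    refine Finset.sum_le_sum fun u _ => mul_le_mul_of_nonneg_right ?_ (hnn u)
    rw [prodDeg_congr_mod (s' := 0 + (i + 1) + 1) (i + 1) (by omega)]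
    exact h.walkOp_one_le _ _ (by
      have : ((i + 1 : ℕ) : ℝ) ≤ ((2 * m : ℕ) : ℝ) := by exact_mod_cast hi
      linarith) _
  have hprod : ∀ i < 2 * m, prodDeg d δ 0 (2 * m - i) * prodDeg d δ (2 * m - i) (i + 1) =
      δ * (d * δ) ^ m := by
    intro i hi
    rw [← hP, show 2 * m + 1 = (2 * m - i) + (i + 1) by omega,
      prodDeg_add (2 * m - i) (i + 1), zero_add]
  have hPn : 0 ≤ δ * (d * δ) ^ m := by positivity
  obtain ⟨m, rfl⟩ : ∃ m', m = m' + 1 := ⟨m - 1, by omega⟩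
  rw [show 2 * (m + 1) = 2 * m + 1 + 1 by ring] at *
  rw [Finset.sum_range_succ]
  have hsmall : ∀ i ∈ Finset.range (2 * m + 1), ∑ v, walkOp G K 0 (i + 1) (fun u =>
      (if u ∈ Q then 1 else 0) * walkOp G K (i + 1) (2 * m + 1 + 1 - (i + 1))
        (fun u => if G.Adj u s' then 1 else 0) u) v ≤
      24 * (lam / L) * (δ * (d * δ) ^ (m + 1)) := by
    intro i hi
    rw [Finset.mem_range] at hi
    refine (key i (by omega)).trans ?_
    obtain ⟨k, hk⟩ : ∃ k, 2 * m + 1 + 1 - i = k + 2 := ⟨2 * m - i, by omega⟩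
    have e1 := h.walkOp_indicator_le hQ (k := k) (by
      have : ((k + 2 : ℕ) : ℝ) ≤ ((2 * m + 1 + 1 : ℕ) : ℝ) := by
        exact_mod_cast (by omega : k + 2 ≤ 2 * m + 1 + 1)
      linarith) s'
    rw [← hprod i (by omega), hk]
    calc _ ≤ 2 * prodDeg d δ (k + 2) (i + 1) * (12 * (lam / L) * prodDeg d δ 0 (k + 2)) := by
            have := prodDeg_nonneg (d := d) h.δ_pos.le (i + 1) (k + 2)
            gcongr
      _ = _ := by ring
  have hlast : ∑ v, walkOp G K 0 (2 * m + 1 + 1) (fun u =>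
      (if u ∈ Q then 1 else 0) * walkOp G K (2 * m + 1 + 1) (2 * m + 1 + 1 - (2 * m + 1 + 1))
        (fun u => if G.Adj u s' then 1 else 0) u) v ≤
      2 * lam * (δ * (d * δ) ^ (m + 1)) := by
    refine (key _ (by omega)).trans ?_
    have e1 : walkOp G K 0 1 (fun u => if u ∈ Q then 1 else 0) s' ≤ lam * δ := by
      simp only [walkOp_succ, walkOp_zero, Finset.sum_boole]
      have : (((nb (altGraph G K 0) s').filter (· ∈ Q)).card : ℝ) ≤ Q.card := by
        refine Nat.cast_le.mpr (Finset.card_le_card fun u hu => ?_)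
        simp only [Finset.mem_filter] at hu
        exact hu.2
      linarith [h.δ_large]
    have e2 := hprod (2 * m + 1) (by omega)
    rw [show 2 * m + 1 + 1 - (2 * m + 1) = 1 by omega] at e2 ⊢
    have e3 : prodDeg d δ 0 1 = δ := by simp [prodDeg]
    rw [e3] at e2
    have := prodDeg_nonneg (d := d) h.δ_pos.le (2 * m + 1 + 1) 1
    calc _ ≤ 2 * prodDeg d δ 1 (2 * m + 1 + 1) * (lam * δ) := by gcongr
      _ = 2 * lam * (δ * prodDeg d δ 1 (2 * m + 1 + 1)) := by ring
      _ = _ := by rw [e2]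
  have hs := Finset.sum_le_sum hsmall
  rw [Finset.sum_const, Finset.card_range, nsmul_eq_mul] at hs
  have hc : ((2 * m + 1 : ℕ) : ℝ) * (24 * (lam / L)) ≤ 480 * lam := by
    have : ((2 * m + 1 : ℕ) : ℝ) ≤ 20 * L := by push_cast at hmL ⊢; linarith
    calc _ ≤ 20 * L * (24 * (lam / L)) := by gcongr
      _ = 480 * lam := by field_simp; norm_num
  have hc2 := mul_le_mul_of_nonneg_right hc hPn
  nlinarith [mul_nonneg hl.le hPn]

end IsPseudo

/-- The number of states in `Y` which complete the walk `u :: l` to a path. -/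
def pairCount (G : SimpleGraph (Fin n)) (Z₁ Z₂ : Finset (Fin n))
    (Y : Finset (Fin n × List (Fin n))) (u : Fin n) (l : List (Fin n)) : ℝ :=
  if good Z₁ (u :: l) then ∑ Q ∈ Y, if G.Adj u Q.1 ∧ good Z₂ (Q.1 :: Q.2) ∧
    ∀ a ∈ u :: l, a ∉ Q.1 :: Q.2 then 1 else 0 else 0

theorem pairCount_nonneg (G : SimpleGraph (Fin n)) (Z₁ Z₂ : Finset (Fin n))
    (Y : Finset (Fin n × List (Fin n))) (u : Fin n) (l : List (Fin n)) :
    0 ≤ pairCount G Z₁ Z₂ Y u l := by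
  unfold pairCount
  split_ifs
  · exact Finset.sum_nonneg fun Q _ => by split_ifs <;> norm_num
  · exact le_rfl

/-- The vertices other than `y` of the walk described by the state `Q`. -/
def endSet (y : Fin n) (Q : Fin n × List (Fin n)) : Finset (Fin n) :=
  (Q.1 :: Q.2).toFinset.erase y

/-- A bound for the number of walks with `k` steps from `v` which meet the walk `Q` and end at a
neighbour of the end of `Q`. -/
def hitBound (G K : SimpleGraph (Fin n)) (y : Fin n) (k : ℕ) (Q : Fin n × List (Fin n))
    (v : Fin n) : ℝ :=
  ∑ i ∈ Finset.range k, walkOp G K 0 (i + 1) (fun u => (if u ∈ endSet y Q then 1 else 0) *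
    walkOp G K (i + 1) (k - (i + 1)) (fun u => if G.Adj u Q.1 then 1 else 0) u) v

theorem hitBound_nonneg (G K : SimpleGraph (Fin n)) (y : Fin n) (k : ℕ)
    (Q : Fin n × List (Fin n)) (v : Fin n) : 0 ≤ hitBound G K y k Q v := by
  refine Finset.sum_nonneg fun i _ => walkOp_nonneg _ _ (fun u => ?_) _
  refine mul_nonneg (by split_ifs <;> norm_num) (walkOp_nonneg _ _ (fun u => ?_) u)
  split_ifs <;> norm_num

theorem walkSum_meet_le (G K : SimpleGraph (Fin n)) (Z₂ : Finset (Fin n)) (y : Fin n) (k : ℕ)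
    (Q : Fin n × List (Fin n)) (v : Fin n) (l₀ : List (Fin n)) :
    walkSum G K 0 k (fun u l =>
      (if good (Z₂ ∪ (v :: l₀).toFinset.erase y) (Q.1 :: Q.2) then 1 else 0) *
        ((if G.Adj u Q.1 then 1 else 0) * cum (hitSet (endSet y Q)) (u :: l))) v l₀ ≤
      hitBound G K y k Q v := by
  rw [walkSum_const_mul]
  split_ifs with hg
  · rw [one_mul, walkSum_mul_cum, cum_hitSet_eq_zero, zero_mul, zero_add]
    · refine Finset.sum_le_sum fun i _ => le_of_eq ?_
      rw [zero_add]
      exact walkSum_eq_walkOp _ (fun u => (if u ∈ endSet y Q then 1 else 0) *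
        walkOp G K (i + 1) (k - (i + 1)) (fun u => if G.Adj u Q.1 then 1 else 0) u) _ _ _
    · intro u hu hQ
      simp only [endSet, Finset.mem_erase, List.mem_toFinset] at hQ
      refine hg.2 u hQ.2 (Finset.mem_union_right _ ?_)
      simp only [Finset.mem_erase, List.mem_toFinset]
      exact ⟨hQ.1, hu⟩
  · rw [zero_mul]
    exact hitBound_nonneg _ _ _ _ _ _

theorem walkSum_pairCount_ge {G K : SimpleGraph (Fin n)} {Z₁ Z₂ : Finset (Fin n)}
    {Y : Finset (Fin n × List (Fin n))} {y v : Fin n} {l₀ : List (Fin n)} (hy : y ∈ Z₁) (k : ℕ)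
    {g : Fin n → ℝ} {θ : ℝ} (hθ : 0 ≤ θ) (g1 : ∀ u, g u ≤ θ)
    (g2 : ∀ u, g u ≤ ∑ Q ∈ Y, if good (Z₂ ∪ (v :: l₀).toFinset.erase y) (Q.1 :: Q.2) ∧ G.Adj u Q.1
      then 1 else 0) :
    walkOp G K 0 k g v - θ * walkSum G K 0 k (fun u l => cum (hitMem Z₁) (u :: l)) v l₀ -
      ∑ Q ∈ Y, hitBound G K y k Q v ≤ walkSum G K 0 k (pairCount G Z₁ Z₂ Y) v l₀ := by
  have h1 := Finset.sum_le_sum fun Q (_ : Q ∈ Y) => walkSum_meet_le G K Z₂ y k Q v l₀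
  rw [← walkSum_finset_sum] at h1
  have h2 : walkSum G K 0 k (fun u l => g u - θ * cum (hitMem Z₁) (u :: l) -
      ∑ Q ∈ Y, (if good (Z₂ ∪ (v :: l₀).toFinset.erase y) (Q.1 :: Q.2) then 1 else 0) *
        ((if G.Adj u Q.1 then 1 else 0) * cum (hitSet (endSet y Q)) (u :: l))) v l₀ ≤
      walkSum G K 0 k (pairCount G Z₁ Z₂ Y) v l₀ := by
    refine walkSum_mono' _ _ _ _ fun u l => ?_
    have c1 := cum_nonneg (hitMem_nonneg Z₁) (u :: l)
    have c2 : ∀ Q, 0 ≤ cum (hitSet (endSet y Q)) (u :: l) := fun Q =>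
      cum_nonneg (hitSet_nonneg _) (u :: l)
    have c3 : 0 ≤ ∑ Q ∈ Y,
        (if good (Z₂ ∪ (v :: l₀).toFinset.erase y) (Q.1 :: Q.2) then (1 : ℝ) else 0) *
        ((if G.Adj u Q.1 then 1 else 0) * cum (hitSet (endSet y Q)) (u :: l)) :=
      Finset.sum_nonneg fun Q _ => mul_nonneg (by split_ifs <;> norm_num)
        (mul_nonneg (by split_ifs <;> norm_num) (c2 Q))
    unfold pairCount
    split_ifs with hg
    · have c4 := mul_nonneg hθ c1
      suffices hs : ∑ Q ∈ Y, (if good (Z₂ ∪ (v :: l₀).toFinset.erase y) (Q.1 :: Q.2) ∧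
          G.Adj u Q.1 then (1 : ℝ) else 0) ≤
          ∑ Q ∈ Y, (if G.Adj u Q.1 ∧ good Z₂ (Q.1 :: Q.2) ∧
            ∀ a ∈ u :: l, a ∉ Q.1 :: Q.2 then (1 : ℝ) else 0) +
          ∑ Q ∈ Y, (if good (Z₂ ∪ (v :: l₀).toFinset.erase y) (Q.1 :: Q.2) then (1 : ℝ) else 0) *
            ((if G.Adj u Q.1 then 1 else 0) * cum (hitSet (endSet y Q)) (u :: l)) by
        linarith [g2 u]
      rw [← Finset.sum_add_distrib]
      refine Finset.sum_le_sum fun Q _ => ?_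
      by_cases hG : G.Adj u Q.1
      · by_cases hQ : good (Z₂ ∪ (v :: l₀).toFinset.erase y) (Q.1 :: Q.2)
        · have hQ' : good Z₂ (Q.1 :: Q.2) :=
            ⟨hQ.1, fun a ha hZ => hQ.2 a ha (Finset.mem_union_left _ hZ)⟩
          simp only [hG, hQ, hQ', and_self, if_true, true_and, one_mul]
          split_ifs with hd
          · linarith [c2 Q]
          · push Not at hd
            obtain ⟨a, ha, haQ⟩ := hd
            have : 1 ≤ cum (hitSet (endSet y Q)) (u :: l) := one_le_cum_hitSet ⟨a, ha, by
              simp only [endSet, Finset.mem_erase, List.mem_toFinset]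
              exact ⟨fun hay => hg.2 a ha (hay ▸ hy), haQ⟩⟩
            linarith
        · simp only [hQ, false_and, if_false, zero_mul, add_zero]
          split_ifs <;> norm_num
      · simp [hG]
    · have := one_le_cum_hitMem hg
      nlinarith [g1 u]
  rw [walkSum_sub_fun, walkSum_sub_fun, walkSum_const_mul, walkSum_eq_walkOp] at h2
  linarith

namespace IsPseudo

variable {G K : SimpleGraph (Fin n)} {d : ℕ} {δ lam L : ℝ} {q : ℕ}

theorem sum_hitBound_le (h : IsPseudo G K d δ lam L q) {m : ℕ} (hm : 1 ≤ m)
    (hmL : ((2 * m : ℕ) : ℝ) ≤ 20 * L) {y : Fin n} {Q : Fin n × List (Fin n)}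
    (hQ : (Q.2.length + 1 : ℝ) ≤ 100 * L) :
    ∑ v, hitBound G K y (2 * m) Q v ≤ 500 * lam * (δ * (d * δ) ^ m) := by
  unfold hitBound
  rw [Finset.sum_comm]
  refine h.sum_walkOp_hit_le (le_trans ?_ hQ) hm hmL Q.1
  have h1 : (endSet y Q).card ≤ (Q.1 :: Q.2).length :=
    (Finset.card_le_card (Finset.erase_subset _ _)).trans (List.toFinset_card_le _)
  exact_mod_cast h1

set_option maxHeartbeats 1000000 in
theorem walkSum_pairCount_total (h : IsPseudo G K d δ lam L q) {j r m₂ : ℕ} {x y : Fin n}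
    {p : Fin n → Fin n → ℝ} (p0 : ∀ v w, 0 ≤ p v w)
    (p1 : ∀ v w, p v w ≤ δ * (d * δ) ^ j / n)
    (p2 : ∀ v w, p v w ≤ walkOp G K 0 (2 * j) (fun u => if G.Adj w u then 1 else 0) v)
    (p3 : ∀ v, (1 - 90 * lam) * (δ * (d * δ) ^ j) ≤ ∑ w, p v w)
    (hm₂ : m₂ = j + 1 + r) {j₂ : ℕ} {U₀ Z₁ Z₂ : Finset (Fin n)}
    {Y : Finset (Fin n × List (Fin n))}
    (hm : ((2 * (j + 1 + m₂ + j₂ + 1) : ℕ) : ℝ) ≤ 20 * L) (hY : ∀ Q ∈ Y, Q.2.length = 2 * j₂ + 1)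
    (hYc : (Y.card : ℝ) ≤ 2 * U₀.card * (d * δ) ^ j₂) (hU : U₀.card ≤ d) (hx : x ∉ U₀)
    (hxZ : x ∉ Z₁) (hyZ : y ∈ Z₁) (hZ₁ : (Z₁.card : ℝ) ≤ 50 * L)
    (hend : ∀ F : Finset (Fin n), ∃ g : Fin n → ℝ, (∀ v, 0 ≤ g v) ∧
      (∀ v, g v ≤ δ * (U₀.card * (d * δ) ^ j₂) / n) ∧
      (∀ v, g v ≤ ∑ Q ∈ Y, if good (Z₂ ∪ F) (Q.1 :: Q.2) ∧ G.Adj v Q.1 then 1 else 0) ∧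
      ((F.card : ℝ) ≤ 100 * L → y ∉ F →
        δ * (d * δ) ^ j₂ * ((1 - 2494 * lam) * U₀.card - 4 * (U₀ ∩ F).card) ≤ ∑ v, g v)) :
    (U₀.card / d - 7000 * lam) * ((d * δ) ^ (j + 1 + m₂ + j₂ + 1) / n) ≤
      walkSum G K 0 (2 * (j + 1) + 2 * m₂) (pairCount G Z₁ Z₂ Y) x [] := by
  have hl := h.lam_le
  have hl0 := h.lam_pos
  have hD := h.D_pos
  have hδ := h.δ_pos
  have hd := h.d_pos
  have hn := h.n_pos
  have hL := h.one_le_L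
  push_cast at hm
  choose g g0 g1 g2 g3 using hend
  obtain ⟨ω, ω0, ω1, ω2, ω3⟩ := h.exists_start_weight (p0 x) (p1 x) (p2 x) (p3 x)
  set k : ℝ := (U₀.card : ℝ) with hk
  have hk0 : 0 ≤ k := Nat.cast_nonneg _
  have hkd : k ≤ d := Nat.cast_le.mpr hU
  set D : ℝ := d * δ with hDdef
  set θ : ℝ := δ * (k * D ^ j₂) / n with hθdef
  have hθ : 0 ≤ θ := by positivity
  set c : ℝ := D ^ m₂ / n * (δ * D ^ j₂) with hc
  have hc0 : 0 ≤ c := by positivity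
  set B : Fin n → List (Fin n) → ℝ :=
    walkSum G K 0 (2 * m₂) (fun u l => cum (hitMem Z₁) (u :: l)) with hB
  set φ : Fin n → ℝ := fun v => ∑ Q ∈ Y, hitBound G K y (2 * m₂) Q v with hφ
  have hφ0 : ∀ v, 0 ≤ φ v := fun v => Finset.sum_nonneg fun Q _ => hitBound_nonneg _ _ _ _ _ _
  have hB0 : ∀ v l, 0 ≤ B v l := fun v l =>
    walkSum_nonneg _ _ _ _ fun u l => cum_nonneg (hitMem_nonneg _) _
  have hmain : walkSum G K 0 (2 * (j + 1)) (fun v l =>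
      c * k * (1 - 2704 * lam) * ω l - 4 * c * cum (hitSet U₀) (v :: l) - θ * B v l - ω l * φ v)
      x [] ≤ walkSum G K 0 (2 * (j + 1) + 2 * m₂) (pairCount G Z₁ Z₂ Y) x [] := by
    rw [walkSum_add]
    refine walkSum_mono _ _ _ _ fun v l hlen => ?_
    rw [walkSum_congr_mod (2 * m₂) _ (0 + 2 * (j + 1)) 0 (by omega)]
    set F := (v :: l).toFinset.erase y with hF
    have e1 := walkSum_pairCount_ge (K := K) hyZ (2 * m₂) hθ (g1 F) (g2 F)
    have e0 : 0 ≤ walkSum G K 0 (2 * m₂) (pairCount G Z₁ Z₂ Y) v l :=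
      walkSum_nonneg _ _ _ _ (pairCount_nonneg _ _ _ _)
    have hFc : (F.card : ℝ) ≤ 100 * L := by
      have : F.card ≤ (v :: l).length :=
        (Finset.card_le_card (Finset.erase_subset _ _)).trans (List.toFinset_card_le _)
      have h2 : (F.card : ℝ) ≤ ((v :: l).length : ℝ) := by exact_mod_cast this
      rw [List.length_cons, hlen] at h2
      push_cast [List.length_nil] at h2
      have := (Nat.cast_nonneg m₂ : (0 : ℝ) ≤ m₂)
      have := (Nat.cast_nonneg j₂ : (0 : ℝ) ≤ j₂)
      linarith
    have e2 := g3 F hFc (Finset.notMem_erase _ _)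
    have e3 := h.walkOp_ge_average (p1 v) (p2 v) (p3 v) (r := r) (by
      have : (m₂ : ℝ) = j + 1 + r := by exact_mod_cast hm₂
      have := (Nat.cast_nonneg j : (0 : ℝ) ≤ j)
      have := (Nat.cast_nonneg j₂ : (0 : ℝ) ≤ j₂)
      push_cast
      linarith) (g0 F) (g1 F)
    rw [← hm₂] at e3
    have e4 : ((U₀ ∩ F).card : ℝ) ≤ cum (hitSet U₀) (v :: l) := by
      refine le_trans (Nat.cast_le.mpr (Finset.card_le_card ?_)) (card_inter_le_cum U₀ (v :: l))
      exact Finset.inter_subset_inter_left (Finset.erase_subset _ _)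
    set t := cum (hitSet U₀) (v :: l)
    have ht : 0 ≤ t := cum_nonneg (hitSet_nonneg _) _
    have hnθ : n * θ = δ * D ^ j₂ * k := by
      rw [hθdef]
      field_simp
    have e5 : c * (k * (1 - 2704 * lam) - 4 * t) ≤ walkOp G K 0 (2 * m₂) (g F) v := by
      refine le_trans ?_ e3
      rw [hc, mul_assoc]
      refine mul_le_mul_of_nonneg_left ?_ (by positivity)
      rw [hnθ]
      have e6 : δ * D ^ j₂ * (U₀ ∩ F).card ≤ δ * D ^ j₂ * t := by gcongr
      linarith
    have hω0 := ω0 l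
    have hω1 := ω1 l
    have e7 : ω l * (c * (k * (1 - 2704 * lam) - 4 * t) - θ * B v l - φ v) ≤
        walkSum G K 0 (2 * m₂) (pairCount G Z₁ Z₂ Y) v l := by
      refine le_trans (mul_le_mul_of_nonneg_left (?_ : _ ≤
        walkSum G K 0 (2 * m₂) (pairCount G Z₁ Z₂ Y) v l) hω0) (by nlinarith)
      simp only [hB, hφ]
      linarith
    refine le_trans ?_ e7
    have e8 : ω l * (4 * c * t + θ * B v l) ≤ 1 * (4 * c * t + θ * B v l) := by
      have := mul_nonneg hθ (hB0 v l)
      gcongr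
    linarith
  rw [walkSum_sub_fun, walkSum_sub_fun, walkSum_sub_fun, walkSum_const_mul, walkSum_const_mul,
    walkSum_const_mul] at hmain
  refine le_trans ?_ hmain
  have hj0 := (Nat.cast_nonneg j : (0 : ℝ) ≤ j)
  have hm0 := (Nat.cast_nonneg m₂ : (0 : ℝ) ≤ m₂)
  have hj20 := (Nat.cast_nonneg j₂ : (0 : ℝ) ≤ j₂)
  have f1 := h.walkSum_cum_hitSet_le_of_card_le_d U₀ (k := 2 * (j + 1)) x [] (by
    push_cast; linarith) hU
  rw [show cum (hitSet U₀) [x] = 0 by simp [cum, hitSet, hx], prodDeg_two_mul] at f1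
  have f2 : walkSum G K 0 (2 * (j + 1)) B x [] ≤ 601 * lam * D ^ (j + 1 + m₂) := by
    have f3 := h.walkSum_cum_hitMem_le Z₁ (k := 2 * (j + 1) + 2 * m₂) x [] (by
      push_cast; linarith) (by push_cast [List.length_nil]; linarith)
    rw [show cum (hitMem Z₁) [x] = 0 by simp [cum, hitMem, hxZ], walkSum_add,
      ← mul_add 2 (j + 1) m₂, prodDeg_two_mul] at f3
    have f4 : walkSum G K (0 + 2 * (j + 1)) (2 * m₂) (fun u l => cum (hitMem Z₁) (u :: l)) = B := by
      funext v l
      exact walkSum_congr_mod _ _ _ _ (by omega) _ _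
    rw [f4] at f3
    linarith
  have f5 := ω3 φ hφ0
  have f6 : ∑ v, φ v ≤ 2 * k * D ^ j₂ * (500 * lam * (δ * D ^ m₂)) := by
    simp only [hφ]
    rw [Finset.sum_comm]
    refine (Finset.sum_le_sum fun Q hQ => h.sum_hitBound_le (y := y) (m := m₂) (by omega) (by
      push_cast; linarith) (by
      rw [hY Q hQ]
      push_cast
      linarith)).trans ?_
    rw [Finset.sum_const, nsmul_eq_mul]
    gcongr
  set E := D ^ (j + 1 + m₂ + j₂ + 1) / n with hE
  have hE0 : 0 ≤ E := by positivity
  have b1 : c * D ^ (j + 1) = E / d := by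
    rw [hc, hE, hDdef]
    field_simp
    ring
  have b2 : θ * D ^ (j + 1 + m₂) = k / d * E := by
    rw [hθdef, hE, hDdef]
    field_simp
    ring
  have b3 : D ^ (j + 1) / n * (k * D ^ j₂ * (δ * D ^ m₂)) = k / d * E := by
    rw [hE, hDdef]
    field_simp
    ring
  set κ := k / d with hκ
  have hκ0 : 0 ≤ κ := by positivity
  have hκ1 : κ ≤ 1 := by rw [hκ, div_le_one hd]; exact hkd
  have a1 : c * k * (1 - 2704 * lam) * ((1 - 90 * lam) * D ^ (j + 1)) ≤
      c * k * (1 - 2704 * lam) * walkSum G K 0 (2 * (j + 1)) (fun _ l => ω l) x [] := by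
    refine mul_le_mul_of_nonneg_left ω2 (mul_nonneg (by positivity) (by linarith))
  have a1' : c * k * (1 - 2704 * lam) * ((1 - 90 * lam) * D ^ (j + 1)) =
      κ * E * ((1 - 2704 * lam) * (1 - 90 * lam)) := by
    calc _ = c * D ^ (j + 1) * k * ((1 - 2704 * lam) * (1 - 90 * lam)) := by ring
      _ = _ := by rw [b1, hκ]; ring
  have a2 : 4 * c * walkSum G K 0 (2 * (j + 1)) (fun v l => cum (hitSet U₀) (v :: l)) x [] ≤
      2404 * lam * E := by
    calc _ ≤ 4 * c * ((2 * 0 + 601 * lam * d) * D ^ (j + 1)) := by gcongr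
      _ = 2404 * lam * d * (c * D ^ (j + 1)) := by ring
      _ = _ := by rw [b1]; field_simp
  have a3 : θ * walkSum G K 0 (2 * (j + 1)) B x [] ≤ 601 * lam * (κ * E) := by
    calc _ ≤ θ * (601 * lam * D ^ (j + 1 + m₂)) := by gcongr
      _ = 601 * lam * (θ * D ^ (j + 1 + m₂)) := by ring
      _ = _ := by rw [b2]
  have a4 : walkSum G K 0 (2 * (j + 1)) (fun v l => ω l * φ v) x [] ≤ 1000 * lam * (κ * E) := by
    refine f5.trans ?_
    calc _ ≤ D ^ (j + 1) / n * (2 * k * D ^ j₂ * (500 * lam * (δ * D ^ m₂))) := by gcongr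
      _ = 1000 * lam * (D ^ (j + 1) / n * (k * D ^ j₂ * (δ * D ^ m₂))) := by ring
      _ = _ := by rw [b3]
  have a5 : κ * E ≤ E := by nlinarith
  have a6 : 0 ≤ κ * E := by positivity
  have a7 : lam * (κ * E) ≤ lam * E := by gcongr
  have a8 : 0 ≤ lam * lam * (κ * E) := by positivity
  have a9 : κ * E * ((1 - 2704 * lam) * (1 - 90 * lam)) =
      κ * E - 2794 * (lam * (κ * E)) + 243360 * (lam * lam * (κ * E)) := by ring
  have a10 : (κ - 7000 * lam) * E = κ * E - 7000 * (lam * E) := by ring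
  have a11 : 0 ≤ lam * E := by positivity
  linarith
end IsPseudo

/-- The states reached by alternating walks with `k` steps from the vertices of `U`, which are
preceded by `y`. -/
def endStates (G K : SimpleGraph (Fin n)) (U : Finset (Fin n)) (y : Fin n) (k : ℕ) :
    Finset (Fin n × List (Fin n)) := U.biUnion fun z => walkSet G K 0 k z [y]

theorem sum_endStates {G K : SimpleGraph (Fin n)} (U : Finset (Fin n)) (y : Fin n) (k : ℕ)
    (f : Fin n → List (Fin n) → ℝ) :
    ∑ Q ∈ endStates G K U y k, f Q.1 Q.2 = ∑ z ∈ U, walkSum G K 0 k f z [y] := by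
  rw [endStates, Finset.sum_biUnion]
  · exact Finset.sum_congr rfl fun z _ => (walkSum_eq_sum_walkSet _ _ _ _ _).symm
  · intro z _ z' _ hzz
    rw [Function.onFun, Finset.disjoint_left]
    intro w hw hw'
    have h1 := (walkSet_suffix _ _ _ _ _ hw).1
    have h2 := (walkSet_suffix _ _ _ _ _ hw').1
    have h3 := (List.suffix_of_suffix_length_le h1 h2 (by simp)).eq_of_length (by simp)
    simp only [List.cons.injEq] at h3
    exact hzz h3.1

namespace IsPseudo

variable {G K : SimpleGraph (Fin n)} {d : ℕ} {δ lam L : ℝ} {q : ℕ}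

theorem exists_walkSum_pairCount_ge (h : IsPseudo G K d δ lam L q) {x y : Fin n} (hxy : x ≠ y)
    (Z : Finset (Fin n)) (hZ : (Z.card : ℝ) ≤ 40 * L) {ℓ : ℕ} (hℓ : 10 * (q + 1) ≤ ℓ)
    (hℓL : (ℓ : ℝ) ≤ 10 * L) :
    ∃ m j : ℕ, m + j + 1 = ℓ ∧
      (1 - 7000 * lam - ((insert x Z ∩ nb K y).card : ℝ) / d) * ((d * δ) ^ ℓ / n) ≤
        walkSum G K 0 (2 * m) (pairCount G (insert y (Z.erase x)) (insert x (Z.erase y))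
          (endStates G K (nb K y \ insert x Z) y (2 * j))) x [] := by
  have hL := h.one_le_L
  have hd := h.d_pos
  have hδ := h.δ_pos
  have hD := h.D_pos
  set U₀ := nb K y \ insert x Z with hU₀
  have hcard : ∀ a b : Fin n, ((insert a (Z.erase b)).card : ℝ) ≤ 40 * L + 1 := by
    intro a b
    have h1 := Finset.card_insert_le a (Z.erase b)
    have h2 := Finset.card_le_card (Finset.erase_subset b Z)
    have h3 : ((insert a (Z.erase b)).card : ℝ) ≤ Z.card + 1 := by exact_mod_cast h1.trans (by omega)
    linarith
  have hk : (U₀.card : ℝ) + (insert x Z ∩ nb K y).card = d := by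
    rw [Finset.inter_comm, ← h.card_nb_K y]
    exact_mod_cast Finset.card_sdiff_add_card_inter (nb K y) (insert x Z)
  have hkd : U₀.card ≤ d := by
    rw [← h.degK y]
    exact Finset.card_le_card Finset.sdiff_subset
  have hZi : ((insert x Z ∩ nb K y).card : ℝ) ≤ 40 * L + 1 := by
    have h1 := Finset.card_le_card (Finset.inter_subset_left (s₁ := insert x Z) (s₂ := nb K y))
    have h2 := Finset.card_insert_le x Z
    have h3 : ((insert x Z ∩ nb K y).card : ℝ) ≤ Z.card + 1 := by exact_mod_cast h1.trans h2
    linarith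
  have hd' := h.d_large
  have hk2 : (d : ℝ) ≤ 4 * U₀.card := by linarith
  have hk1 : 1 ≤ U₀.card := by
    have : (0 : ℝ) < U₀.card := by linarith
    exact_mod_cast this
  have hdisc : disc G U₀ ≤ 2 * (lam / L) * δ * U₀.card := by
    refine h.disc_G U₀ {y} (by simpa using hk2) (fun u hu => ?_) ?_
    · simp only [hU₀, Finset.mem_sdiff] at hu
      simp [hu.1]
    · have h1 := h.n_bound (a := 1) (b := 1) (c := 1) (by norm_num) (by norm_num) le_rfl
      have h2 : (U₀.card : ℝ) ≤ d := Nat.cast_le.mpr hkd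
      rw [le_div_iff₀ (by positivity)]
      have h3 : (U₀.card : ℝ) * (100 * δ * L) ≤ d * (100 * δ * L) := by gcongr
      have h4 : 0 ≤ d * δ * L := by positivity
      simp only [pow_one] at h1
      linarith
  obtain ⟨j, hj, hv⟩ := h.exists_vertex_minorant
  obtain ⟨j₂, hj₂, hsp⟩ := h.spread U₀.card hk1 hkd
  choose p p0 p1 p2 p3 using hv
  have hq : (j₂ : ℝ) ≤ L + 2 := by
    have h1 : (j₂ : ℝ) ≤ q + 2 := by exact_mod_cast hj₂
    linarith [h.q_le]
  obtain ⟨r, hr⟩ : ∃ r, ℓ = (j + 1) + (j + 1 + r) + j₂ + 1 :=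
    ⟨ℓ - (2 * (j + 1) + j₂ + 1), by omega⟩
  have hyU : ∀ z ∈ U₀, z ≠ y ∧ z ∉ insert x (Z.erase y) := by
    intro z hz
    simp only [hU₀, Finset.mem_sdiff, mem_nb, Finset.mem_insert, not_or] at hz
    refine ⟨hz.1.ne', ?_⟩
    simp [hz.2]
  refine ⟨(j + 1) + (j + 1 + r), j₂, hr.symm, ?_⟩
  have hmain := h.walkSum_pairCount_total (x := x) (y := y) p0 p1 p2 p3 (m₂ := j + 1 + r) rfl
    (j₂ := j₂) (U₀ := U₀) (Z₁ := insert y (Z.erase x)) (Z₂ := insert x (Z.erase y))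
    (Y := endStates G K U₀ y (2 * j₂)) (by rw [← hr]; push_cast; linarith)
    (by
      intro Q hQ
      simp only [endStates, Finset.mem_biUnion] at hQ
      obtain ⟨z, _, hz⟩ := hQ
      simpa using (walkSet_suffix _ _ _ _ _ hz).2)
    (by
      have h1 := sum_endStates (G := G) (K := K) U₀ y (2 * j₂) fun _ _ => 1
      rw [Finset.sum_const, nsmul_one] at h1
      suffices h2 : ∀ z ∈ U₀, walkSum G K 0 (2 * j₂) (fun _ _ => 1) z [y] ≤ 2 * (d * δ) ^ j₂ by
        refine le_trans (h1.le.trans (Finset.sum_le_card_nsmul _ _ _ h2)) (le_of_eq ?_)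
        rw [nsmul_eq_mul]
        ring
      intro z _
      rw [walkSum_eq_walkOp (2 * j₂) (fun _ => 1)]
      refine (h.walkOp_one_le 0 (2 * j₂) ?_ z).trans (le_of_eq (by rw [prodDeg_two_mul]))
      push_cast
      linarith)
    hkd (by simp [hU₀]) (by simp [hxy]) (by simp) (by linarith [hcard y x])
    (by
      intro F
      obtain ⟨g, g0, g1, g2, g3⟩ := h.exists_end_weight (y := y) (U₀ := U₀)
        (S := insert x (Z.erase y)) (j := j₂) (by simp [hxy.symm]) hyU
        (by push_cast; linarith [hcard x y]) (by push_cast; linarith)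
        (fun χ => h.exists_uniform_minorant hj₂ rfl (hsp U₀ rfl hdisc fun _ => [y]) χ) F
      refine ⟨g, g0, g1, fun v => ?_, g3⟩
      exact (g2 v).trans (le_of_eq (sum_endStates U₀ y (2 * j₂) _).symm))
  rw [← hr, ← mul_add 2 (j + 1)] at hmain
  refine le_trans (le_of_eq ?_) hmain
  congr 1
  rw [← hk]
  have : (U₀.card : ℝ) + (insert x Z ∩ nb K y).card ≠ 0 := by linarith
  field_simp
  ring

end IsPseudo

theorem walkSet_congr_mod {G K : SimpleGraph (Fin n)} (k : ℕ) :
    ∀ (s s' : ℕ), s % 2 = s' % 2 → ∀ (v : Fin n) (l : List (Fin n)),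
      walkSet G K s k v l = walkSet G K s' k v l := by
  induction k with
  | zero => intro s s' _ v l; rfl
  | succ k ih =>
    intro s s' h v l
    rw [walkSet, walkSet, altGraph_congr h]
    congr 1
    funext u
    exact ih _ _ (by omega) _ _

theorem endStates_subset {G K : SimpleGraph (Fin n)} {U : Finset (Fin n)} {y : Fin n}
    (hU : U ⊆ nb K y) (k : ℕ) : endStates G K U y k ⊆ walkSet G K 1 (k + 1) y [] := by
  intro Q hQ
  simp only [endStates, Finset.mem_biUnion] at hQ
  obtain ⟨z, hz, hQ⟩ := hQ
  rw [walkSet, Finset.mem_biUnion]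
  exact ⟨z, hU hz, walkSet_congr_mod k 0 (1 + 1) rfl z [y] ▸ hQ⟩

theorem getD_of_mem_walkSet {G K : SimpleGraph (Fin n)} (x : Fin n) {s k : ℕ} {v : Fin n}
    {l : List (Fin n)} {w : Fin n × List (Fin n)} (hw : w ∈ walkSet G K s k v l) :
    (w.1 :: w.2).getD k x = v := by
  obtain ⟨⟨A, hA⟩, h2⟩ := walkSet_suffix _ _ _ _ _ hw
  have h3 := congrArg List.length hA
  simp only [List.length_append, List.length_cons] at h3
  have h4 : A.length = k := by omega
  rw [← hA, ← h4]
  simp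

theorem adj_of_mem_walkSet {G K : SimpleGraph (Fin n)} (x : Fin n) (k : ℕ) :
    ∀ (s : ℕ) (v : Fin n) (l : List (Fin n)) (w : Fin n × List (Fin n)),
      w ∈ walkSet G K s k v l → ∀ i < k,
      (altGraph G K (s + k - 1 - i)).Adj ((w.1 :: w.2).getD (i + 1) x)
        ((w.1 :: w.2).getD i x) := by
  induction k with
  | zero => intro s v l w _ i hi; omega
  | succ k ih =>
    intro s v l w hw i hi
    have hv := getD_of_mem_walkSet x hw
    rw [walkSet, Finset.mem_biUnion] at hw
    obtain ⟨u, hu, hw⟩ := hw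
    rcases Nat.lt_succ_iff_lt_or_eq.mp hi with hik | rfl
    · have := ih _ _ _ _ hw i hik
      rwa [show s + 1 + k - 1 - i = s + (k + 1) - 1 - i by omega] at this
    · rw [getD_of_mem_walkSet x hw, hv, show s + (i + 1) - 1 - i = s by omega]
      exact mem_nb.mp hu

/-- The vertex sequence of the path formed by two walks. -/
def joinList (W : (Fin n × List (Fin n)) × (Fin n × List (Fin n))) : List (Fin n) :=
  (W.1.1 :: W.1.2).reverse ++ (W.2.1 :: W.2.2)

theorem getD_append_reverse {R S : List (Fin n)} {a : ℕ} (hR : R.length = a + 1) (x : Fin n) :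
    (∀ i ≤ a, (R.reverse ++ S).getD i x = R.getD (a - i) x) ∧
      ∀ i, (R.reverse ++ S).getD (a + 1 + i) x = S.getD i x := by
  constructor
  · intro i hi
    rw [List.getD_append _ _ _ _ (by simp; omega), List.getD_reverse _ (by omega), hR]
    congr 1
  · intro i
    rw [List.getD_append_right _ _ _ _ (by simp; omega)]
    congr 1
    simp
    omega

theorem isAltSeq_joinList {G K : SimpleGraph (Fin n)} {Z : Finset (Fin n)} {x y : Fin n}
    {m j ℓ : ℕ} (hℓ : m + j + 1 = ℓ) {W : (Fin n × List (Fin n)) × (Fin n × List (Fin n))}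
    (h1 : W.1 ∈ walkSet G K 0 (2 * m) x []) (h2 : W.2 ∈ walkSet G K 1 (2 * j + 1) y [])
    (hg1 : good (insert y (Z.erase x)) (W.1.1 :: W.1.2)) (hadj : G.Adj W.1.1 W.2.1)
    (hg2 : good (insert x (Z.erase y)) (W.2.1 :: W.2.2))
    (hd : ∀ a ∈ W.1.1 :: W.1.2, a ∉ W.2.1 :: W.2.2) :
    let P : Fin (2 * ℓ + 1) → Fin n := fun i => (joinList W).getD i x
    IsAltSeq G K (2 * ℓ) P ∧ P 0 = x ∧ P (Fin.last (2 * ℓ)) = y ∧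
      ∀ i : Fin (2 * ℓ + 1), i ≠ 0 → i ≠ Fin.last (2 * ℓ) → P i ∉ Z := by
  intro P
  have l1 : (W.1.1 :: W.1.2).length = 2 * m + 1 := by
    simpa using (walkSet_suffix _ _ _ _ _ h1).2
  have l2 : (W.2.1 :: W.2.2).length = 2 * j + 2 := by
    simpa using (walkSet_suffix _ _ _ _ _ h2).2
  obtain ⟨g1, g2⟩ := getD_append_reverse (S := W.2.1 :: W.2.2) l1 x
  have hlen : (joinList W).length = 2 * ℓ + 1 := by
    rw [joinList, List.length_append, List.length_reverse, l1, l2]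
    omega
  have hnd : (joinList W).Nodup := by
    rw [joinList, List.nodup_append']
    exact ⟨List.nodup_reverse.mpr hg1.1, hg2.1, fun a ha => hd a (List.mem_reverse.mp ha)⟩
  have hPe : ∀ i : Fin (2 * ℓ + 1), P i = (joinList W)[i.val]'(by omega) := fun i =>
    List.getD_eq_getElem _ _ _
  have hinj : Function.Injective P := by
    intro i i' hii
    rw [hPe, hPe, hnd.getElem_inj_iff] at hii
    exact Fin.ext hii
  have hP0 : P 0 = x := by
    refine (g1 0 (by omega)).trans ?_
    exact getD_of_mem_walkSet x h1
  have hPl : P (Fin.last (2 * ℓ)) = y := by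
    have := g2 (2 * j + 1)
    rw [show 2 * m + 1 + (2 * j + 1) = 2 * ℓ by omega, getD_of_mem_walkSet x h2] at this
    exact this
  refine ⟨⟨hinj, fun i => ?_⟩, hP0, hPl, fun i hi0 hil => ?_⟩
  · have key : (altGraph G K i).Adj ((joinList W).getD i x) ((joinList W).getD (i + 1) x) := by
      have hi := i.isLt
      rcases lt_trichotomy i.val (2 * m) with him | him | him
      · have e1 := adj_of_mem_walkSet x _ _ _ _ _ h1 (2 * m - (i + 1)) (by omega)
        rw [joinList, g1 _ him.le, g1 (i + 1) (by omega)]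
        rw [show 0 + 2 * m - 1 - (2 * m - (i.val + 1)) = i by omega,
          show 2 * m - (i.val + 1) + 1 = 2 * m - i by omega] at e1
        exact e1
      · have e1 := g2 0
        rw [him, joinList, g1 _ le_rfl, show 2 * m + 1 = 2 * m + 1 + 0 by ring, e1]
        simpa [altGraph] using hadj
      · obtain ⟨i', hi'⟩ : ∃ i', i.val = 2 * m + 1 + i' := ⟨i - (2 * m + 1), by omega⟩
        have e1 := adj_of_mem_walkSet x _ _ _ _ _ h2 i' (by omega)
        rw [hi', joinList, g2, show 2 * m + 1 + i' + 1 = 2 * m + 1 + (i' + 1) by ring, g2]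
        rw [altGraph_congr (j := 2 * m + 1 + i') (by omega)] at e1
        exact e1.symm
    unfold altGraph at key
    split_ifs at key ⊢ <;> exact key
  · have hmem : P i ∈ joinList W := by
      rw [hPe]
      exact List.getElem_mem _
    have hix : P i ≠ x := fun h => hi0 (hinj (h.trans hP0.symm))
    have hiy : P i ≠ y := fun h => hil (hinj (h.trans hPl.symm))
    rw [joinList, List.mem_append, List.mem_reverse] at hmem
    intro hZ
    rcases hmem with hmem | hmem
    · exact hg1.2 _ hmem (by simp [hix, hZ])
    · exact hg2.2 _ hmem (by simp [hiy, hZ])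

theorem walkSum_pairCount_le {G K : SimpleGraph (Fin n)} {Z U : Finset (Fin n)} {x y : Fin n}
    (hU : U ⊆ nb K y) {m j ℓ : ℕ} (hℓ : m + j + 1 = ℓ) :
    walkSum G K 0 (2 * m) (pairCount G (insert y (Z.erase x)) (insert x (Z.erase y))
      (endStates G K U y (2 * j))) x [] ≤ (altPathCount G K (2 * ℓ) x y Z : ℝ) := by
  set Y := endStates G K U y (2 * j) with hY
  have hYs : ∀ Q ∈ Y, Q ∈ walkSet G K 1 (2 * j + 1) y [] := fun Q hQ =>
    endStates_subset hU _ hQ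
  set good₂ : (Fin n × List (Fin n)) × (Fin n × List (Fin n)) → Prop := fun W =>
    good (insert y (Z.erase x)) (W.1.1 :: W.1.2) ∧ G.Adj W.1.1 W.2.1 ∧
      good (insert x (Z.erase y)) (W.2.1 :: W.2.2) ∧
      ∀ a ∈ W.1.1 :: W.1.2, a ∉ W.2.1 :: W.2.2 with hgood
  set T := (walkSet G K 0 (2 * m) x [] ×ˢ Y).filter good₂ with hT
  have h1 : walkSum G K 0 (2 * m) (pairCount G (insert y (Z.erase x)) (insert x (Z.erase y)) Y)
      x [] = T.card := by
    rw [walkSum_eq_sum_walkSet, hT, ← Finset.sum_boole, Finset.sum_product]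
    refine Finset.sum_congr rfl fun w _ => ?_
    unfold pairCount
    split_ifs with hg
    · refine Finset.sum_congr rfl fun Q _ => ?_
      congr 1
      simp [hg]
    · symm
      refine Finset.sum_eq_zero fun Q _ => if_neg fun hQ => hg hQ.1
  rw [h1, altPathCount, Nat.card_eq_fintype_card, Fintype.card_subtype]
  refine Nat.cast_le.mpr (Finset.card_le_card_of_injOn
    (fun W (i : Fin (2 * ℓ + 1)) => (joinList W).getD i x) (fun W hW => ?_) ?_)
  · simp only [hT, Finset.coe_filter, Finset.mem_product, Set.mem_ofPred_eq] at hW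
    obtain ⟨⟨hW1, hW2⟩, hW3, hW4, hW5, hW6⟩ := hW
    simp only [Finset.coe_filter, Finset.mem_univ, true_and, Set.mem_ofPred_eq]
    exact isAltSeq_joinList hℓ hW1 (hYs _ hW2) hW3 hW4 hW5 hW6
  · intro W hW W' hW' hWW
    simp only [hT, Finset.coe_filter, Finset.mem_product, Set.mem_ofPred_eq] at hW hW'
    have l1 := (walkSet_suffix _ _ _ _ _ hW.1.1).2
    have l2 := (walkSet_suffix _ _ _ _ _ (hYs _ hW.1.2)).2
    have l1' := (walkSet_suffix _ _ _ _ _ hW'.1.1).2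
    have l2' := (walkSet_suffix _ _ _ _ _ (hYs _ hW'.1.2)).2
    simp only [List.length_nil] at l1 l2 l1' l2'
    have hl : (joinList W).length = 2 * ℓ + 1 := by simp [joinList]; omega
    have hl' : (joinList W').length = 2 * ℓ + 1 := by simp [joinList]; omega
    have hlist : joinList W = joinList W' := by
      refine List.ext_getElem (hl.trans hl'.symm) fun i hi hi' => ?_
      have := congrFun hWW ⟨i, by omega⟩
      simp only at this
      rwa [List.getD_eq_getElem _ _ hi, List.getD_eq_getElem _ _ hi'] at this
    have := List.append_inj hlist (by simp [l1, l1'])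
    rw [List.reverse_inj] at this
    simp only [List.cons.injEq] at this
    ext1
    · exact Prod.ext this.1.1 this.1.2
    · exact Prod.ext this.2.1 this.2.2

theorem deg_eq_card_nb (H : SimpleGraph (Fin n)) (v : Fin n) : deg H v = (nb H v).card := by
  rw [deg, nb, Nat.card_eq_fintype_card, ← Fintype.card_subtype]
  rfl

theorem doubleDegSum_eq_sum_nb (F K : SimpleGraph (Fin n)) (v : Fin n) :
    doubleDegSum F K v =
      ∑ u ∈ nb (F \ K) v, ∑ u' ∈ nb K u, ((nb (F \ K) u').card : ℝ) := by
  simp only [doubleDegSum, deg_eq_card_nb, nb, Finset.sum_filter]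
  congr!

theorem disc_le_E2count_add_edgesWithin (H : SimpleGraph (Fin n)) (U : Finset (Fin n)) :
    disc H U ≤ 2 * ((E2count H U : ℝ) + edgesWithin H U) := by
  set S := (Finset.univ : Finset (Fin n × Fin n)).filter
    fun p => p.1 ∈ U ∧ p.2 ∈ nb H p.1 \ uniq H U with hS
  have h1 : disc H U = S.card := by
    have : S = U.biUnion fun x => (nb H x \ uniq H U).image fun z => (x, z) := by
      ext ⟨x, z⟩
      simp [hS]
    rw [this, Finset.card_biUnion, disc, Nat.cast_sum]
    · refine Finset.sum_congr rfl fun x _ => ?_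
      rw [Finset.card_image_of_injective _ (Prod.mk_right_injective x)]
    · intro x _ x' _ hxx
      simp only [Finset.disjoint_left, Finset.mem_image, not_exists, not_and]
      rintro _ ⟨z, _, rfl⟩ z' _ h
      exact hxx (congrArg Prod.fst h).symm
  have h2 : S.card ≤ 2 * (S.image fun p => s(p.1, p.2)).card := by
    refine Finset.card_le_mul_card_image S 2 fun e _ => ?_
    induction e with
    | _ a b =>
      refine (Finset.card_le_card (t := {(a, b), (b, a)}) ?_).trans Finset.card_le_two
      rintro ⟨x, z⟩ hp
      have := (Finset.mem_filter.mp hp).2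
      simpa [Prod.ext_iff] using this
  have h3 : (S.image fun p => s(p.1, p.2)).card ≤ E2count H U + edgesWithin H U := by
    rw [← Set.ncard_coe_finset, E2count, edgesWithin]
    refine (Set.ncard_le_ncard ?_ (Set.toFinite _)).trans (Set.ncard_union_le _ _)
    intro e he
    obtain ⟨⟨x, z⟩, hp, rfl⟩ := Finset.mem_image.mp (Finset.mem_coe.mp he)
    obtain ⟨hx, hz⟩ := (Finset.mem_filter.mp hp).2
    rw [Finset.mem_sdiff, mem_nb] at hz
    by_cases hzU : z ∈ U
    · right
      refine ⟨hz.1, ?_⟩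
      intro v hv
      rcases Sym2.mem_iff.mp hv with rfl | rfl
      exacts [hx, hzU]
    · left
      refine ⟨hz.1, x, z, rfl, hx, hzU, ?_⟩
      have hxm : x ∈ nb H z ∩ U := Finset.mem_inter.mpr ⟨mem_nb.mpr hz.1.symm, hx⟩
      have hne : (nb H z ∩ U).card ≠ 1 := fun hc =>
        hz.2 (Finset.mem_filter.mpr ⟨Finset.mem_univ _, hzU, hc⟩)
      have hpos := Finset.card_pos.mpr ⟨x, hxm⟩
      obtain ⟨x', hx', hxx⟩ := Finset.exists_mem_ne (by omega : 1 < (nb H z ∩ U).card) x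
      rw [Finset.mem_inter, mem_nb] at hx'
      exact ⟨x', hx'.2, hxx, hx'.1.symm⟩
  rw [h1]
  exact_mod_cast h2.trans (Nat.mul_le_mul_left 2 h3)

theorem edgesBetween_eq_sum (H : SimpleGraph (Fin n)) (U V : Finset (Fin n)) :
    edgesBetween H U V = ∑ v ∈ V, (nb H v ∩ U).card := by
  have : {p : Fin n × Fin n | p.1 ∈ (U : Set (Fin n)) ∧ p.2 ∈ (V : Set (Fin n)) ∧
      H.Adj p.1 p.2} = (V.biUnion fun v => (nb H v ∩ U).image fun u => (u, v) :
        Finset (Fin n × Fin n)) := by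
    ext ⟨u, v⟩
    simp only [Set.mem_ofPred_eq, Finset.mem_coe, Finset.mem_biUnion, Finset.mem_image,
      Finset.mem_inter, mem_nb, Prod.mk.injEq]
    constructor
    · rintro ⟨hu, hv, h⟩
      exact ⟨v, hv, u, ⟨h.symm, hu⟩, rfl, rfl⟩
    · rintro ⟨v, hv, u, ⟨h, hu⟩, rfl, rfl⟩
      exact ⟨hu, hv, h.symm⟩
  rw [edgesBetween, this, Set.ncard_coe_finset, Finset.card_biUnion]
  · refine Finset.sum_congr rfl fun v _ => ?_
    rw [Finset.card_image_of_injective _ (Prod.mk_left_injective v)]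
  · intro v _ v' _ hvv
    simp only [Finset.disjoint_left, Finset.mem_image, not_exists, not_and]
    rintro _ ⟨z, _, rfl⟩ z' _ h
    exact hvv (congrArg Prod.snd h).symm

theorem subset_union_nbhd {H : SimpleGraph (Fin n)} {U U' : Finset (Fin n)}
    (h : U ⊆ U' ∪ U'.biUnion (nb H)) : (U : Set (Fin n)) ⊆ U' ∪ nbhd H U' := by
  intro v hv
  by_cases hv' : v ∈ U'
  · exact Or.inl hv'
  · right
    have := h hv
    simp only [Finset.mem_union, hv', false_or, Finset.mem_biUnion, mem_nb] at this
    exact ⟨hv', this⟩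

theorem eventually_log_pow_le :
    ∀ᶠ n : ℕ in Filter.atTop, 1 ≤ Real.log n ∧
      10 ^ 20 * Real.log n ^ 4 ≤ (n : ℝ) ^ (2 / 5 : ℝ) := by
  have h1 : ∀ᶠ t : ℝ in Filter.atTop, 1 ≤ Real.log t :=
    Real.tendsto_log_atTop.eventually_ge_atTop 1
  have h2 := (isLittleO_log_rpow_rpow_atTop 4 (s := 2 / 5) (by norm_num)).bound
    (show (0 : ℝ) < 1 / 10 ^ 20 by norm_num)
  filter_upwards [tendsto_natCast_atTop_atTop.eventually h1,
    tendsto_natCast_atTop_atTop.eventually h2] with n h1 h2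
  refine ⟨h1, ?_⟩
  rw [Real.norm_of_nonneg (by positivity), Real.norm_of_nonneg (by positivity)] at h2
  have h3 : Real.log n ^ (4 : ℝ) = Real.log n ^ 4 := by exact_mod_cast Real.rpow_natCast _ 4
  rw [h3] at h2
  linarith

theorem cube_mul_cube_le {d δ lam σ : ℝ} (hL : 1 ≤ Real.log n)
    (hn : 10 ^ 20 * Real.log n ^ 4 ≤ (n : ℝ) ^ (2 / 5 : ℝ)) (hσ : σ ≤ 1 / 10) (hd : 0 ≤ d)
    (hdn : d ≤ (n : ℝ) ^ σ) (hδ : 0 ≤ δ) (hδn : δ ≤ (n : ℝ) ^ σ)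
    (hlam : (Real.log n ^ 3)⁻¹ ≤ lam) :
    10 ^ 20 * d ^ 3 * δ ^ 3 * Real.log n ≤ lam * n := by
  have hn1 : (1 : ℝ) ≤ n := by
    rcases Nat.eq_zero_or_pos n with rfl | h
    · simp at hL
      linarith
    · exact_mod_cast h
  have hp : (n : ℝ) ^ σ ≤ (n : ℝ) ^ (1 / 10 : ℝ) := Real.rpow_le_rpow_of_exponent_le hn1 hσ
  have h6 : ((n : ℝ) ^ (1 / 10 : ℝ)) ^ 6 = (n : ℝ) ^ (3 / 5 : ℝ) := by
    rw [← Real.rpow_natCast, ← Real.rpow_mul (by linarith)]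
    norm_num
  have h7 : (n : ℝ) ^ (3 / 5 : ℝ) * (n : ℝ) ^ (2 / 5 : ℝ) = n := by
    rw [← Real.rpow_add (by linarith)]
    norm_num
  have h8 : d ^ 3 * δ ^ 3 ≤ (n : ℝ) ^ (3 / 5 : ℝ) := by
    rw [← h6, show 6 = 3 + 3 by rfl, pow_add]
    exact mul_le_mul (pow_le_pow_left₀ hd (hdn.trans hp) 3)
      (pow_le_pow_left₀ hδ (hδn.trans hp) 3) (by positivity) (by positivity)
  have hL0 : 0 < Real.log n := by linarith
  calc 10 ^ 20 * d ^ 3 * δ ^ 3 * Real.log n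
      = (Real.log n ^ 3)⁻¹ * ((d ^ 3 * δ ^ 3) * (10 ^ 20 * Real.log n ^ 4)) := by
        field_simp
    _ ≤ lam * ((n : ℝ) ^ (3 / 5 : ℝ) * (n : ℝ) ^ (2 / 5 : ℝ)) := by
        refine mul_le_mul hlam (mul_le_mul h8 hn (by positivity) (by positivity))
          (by positivity) (le_trans (by positivity) hlam)
    _ = lam * n := by rw [h7]

theorem isPseudo_of_pseudorandom {K F : SimpleGraph (Fin n)} {d q : ℕ} {δ lam σ : ℝ}
    (hL : 1 ≤ Real.log n) (hn : 10 ^ 20 * Real.log n ^ 4 ≤ (n : ℝ) ^ (2 / 5 : ℝ))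
    (hσ : σ ≤ 1 / 10) (hd : 10 ^ 10 * Real.log n ≤ d) (hdn : (d : ℝ) ≤ (n : ℝ) ^ σ)
    (hδ : 0 < δ) (hδn : δ ≤ (n : ℝ) ^ σ) (hlam : (Real.log n ^ 3)⁻¹ ≤ lam)
    (hlam' : lam ≤ 1 / 10 ^ 10) (hlδ : 10 ^ 10 * Real.log n ≤ lam * δ)
    (hK : IsRegularGraph K d)
    (hD1 : ∀ v, (1 - lam) * δ ≤ (deg (F \ K) v : ℝ) ∧ (deg (F \ K) v : ℝ) ≤ (1 + lam) * δ)
    (hD2 : ∀ v, (1 - lam / Real.log n) * (deg (F \ K) v : ℝ) * δ * d ≤ doubleDegSum F K v ∧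
      doubleDegSum F K v ≤ (1 + lam / Real.log n) * (deg (F \ K) v : ℝ) * δ * d)
    (hD3 : ∀ U : Set (Fin n), (∃ U' : Set (Fin n), (U'.ncard : ℝ) ≤ 4 * U.ncard / δ ∧
      U ⊆ U' ∪ nbhd (F \ K) U') →
        (((U.ncard : ℝ) ≤ lam * n / (10 ^ 6 * d * Real.log n) →
          (E2count K U : ℝ) + (edgesWithin K U : ℝ) ≤ lam / Real.log n * d * U.ncard) ∧
        ((U.ncard : ℝ) ≤ lam * n / (10 ^ 6 * d) →
          (E2count K U : ℝ) + (edgesWithin K U : ℝ) ≤ lam * d * U.ncard)))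
    (hD4 : ∀ U : Set (Fin n), (U.ncard : ℝ) ≤ lam * n / (100 * δ * Real.log n) →
      (∃ U' : Set (Fin n), (U'.ncard : ℝ) ≤ 4 * U.ncard / d ∧ U ⊆ U' ∪ nbhd K U') →
        (E2count (F \ K) U : ℝ) + (edgesWithin (F \ K) U : ℝ) ≤
          lam / Real.log n * δ * U.ncard)
    (hD6 : ∀ U V : Set (Fin n), Disjoint U V → lam * n / 10 ^ 8 ≤ (U.ncard : ℝ) →
      lam * n / 10 ^ 8 ≤ (V.ncard : ℝ) →
        (1 - lam) * (δ / n) * U.ncard * V.ncard ≤ (edgesBetween (F \ K) U V : ℝ))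
    (hq : (q : ℝ) ≤ Real.log n) (hnq : (n : ℝ) ≤ (d * δ) ^ q) :
    IsPseudo (F \ K) K d δ lam (Real.log n) q where
  lam_pos := lt_of_lt_of_le (by positivity) hlam
  lam_le := hlam'
  one_le_L := hL
  d_large := hd
  δ_large := hlδ
  n_large := cube_mul_cube_le hL hn hσ (Nat.cast_nonneg d) hdn hδ.le hδn hlam
  q_le := hq
  n_le := hnq
  degK v := (deg_eq_card_nb K v).symm.trans (hK v)
  degG_ge v := by
    rw [← deg_eq_card_nb]
    exact (hD1 v).1
  degG_le v := by
    rw [← deg_eq_card_nb]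
    exact (hD1 v).2
  two_step_ge v := by
    rw [← doubleDegSum_eq_sum_nb, ← deg_eq_card_nb]
    exact le_trans (le_of_eq (by ring)) (hD2 v).1
  two_step_le v := by
    rw [← doubleDegSum_eq_sum_nb, ← deg_eq_card_nb]
    exact (hD2 v).2.trans (le_of_eq (by ring))
  disc_K U U' hc hs hU := by
    have h1 := (hD3 U ⟨U', by
      rw [Set.ncard_coe_finset, Set.ncard_coe_finset, le_div_iff₀' hδ]
      exact hc, subset_union_nbhd hs⟩).1 (by rwa [Set.ncard_coe_finset])
    rw [Set.ncard_coe_finset] at h1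
    linarith [disc_le_E2count_add_edgesWithin K U]
  disc_K' U U' hc hs hU := by
    have h1 := (hD3 U ⟨U', by
      rw [Set.ncard_coe_finset, Set.ncard_coe_finset, le_div_iff₀' hδ]
      exact hc, subset_union_nbhd hs⟩).2 (by rwa [Set.ncard_coe_finset])
    rw [Set.ncard_coe_finset] at h1
    linarith [disc_le_E2count_add_edgesWithin K U]
  disc_G U U' hc hs hU := by
    have hd0 : (0 : ℝ) < d := lt_of_lt_of_le (by positivity) hd
    have h1 := hD4 U (by rwa [Set.ncard_coe_finset]) ⟨U', by
      rw [Set.ncard_coe_finset, Set.ncard_coe_finset, le_div_iff₀' hd0]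
      exact hc, subset_union_nbhd hs⟩
    rw [Set.ncard_coe_finset] at h1
    linarith [disc_le_E2count_add_edgesWithin (F \ K) U]
  mix U V hUV hU hV := by
    have h1 := hD6 U V (Finset.disjoint_coe.mpr hUV) (by rwa [Set.ncard_coe_finset])
      (by rwa [Set.ncard_coe_finset])
    rw [Set.ncard_coe_finset, Set.ncard_coe_finset, edgesBetween_eq_sum] at h1
    exact_mod_cast h1

/-- **Lemma 6.2.** There is `c* > 0` such that for every `C₀ ≥ 1/c*` and every
`σ ∈ (0,c*]` there is `C > 0` such that for all sufficiently large `n`: given `d ≥ C log n`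
with `d ≤ n^σ`, `0 < δ ≤ n^σ`, `λ` with `(log n)⁻³ ≤ λ ≤ c*` and `λδ ≥ C₀ log n`,
`K ∈ 𝒦_d(n)` and a graph `F` satisfying the pseudorandomness conditions (D1)–(D6), and
`ℓ₀` the smallest integer with `δ^{ℓ₀−1} d^{ℓ₀−1} ≥ n`, for all distinct `x, y`, every `Z`
with `|Z| ≤ 40 log n` and every `10ℓ₀ ≤ ℓ ≤ 10 log n`, the number of `(F∖K,K)`-alternating
`x,y`-paths of length `2ℓ` avoiding `Z` internally is at least
`(1 − C₀λ − |(Z∪{x})∩N_K(y)|/d)·d^ℓ δ^ℓ/n`. -/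
theorem lower_bound_paths_pseudorandom :
    ∃ cstar : ℝ, 0 < cstar ∧
      ∀ C₀ : ℝ, 1 / cstar ≤ C₀ →
        ∀ σ : ℝ, 0 < σ → σ ≤ cstar →
          ∃ C : ℝ, 0 < C ∧
            ∃ n₀ : ℕ, ∀ n : ℕ, n₀ ≤ n →
              ∀ d : ℕ, ∀ δ lam : ℝ,
                C * Real.log n ≤ (d : ℝ) → (d : ℝ) ≤ (n : ℝ) ^ σ →
                0 < δ → δ ≤ (n : ℝ) ^ σ →
                ((Real.log n) ^ 3)⁻¹ ≤ lam → lam ≤ cstar → C₀ * Real.log n ≤ lam * δ →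
                ∀ K F : SimpleGraph (Fin n), IsRegularGraph K d →
                  (∀ v, (1 - lam) * δ ≤ (deg (F \ K) v : ℝ) ∧
                    (deg (F \ K) v : ℝ) ≤ (1 + lam) * δ) →
                  (∀ v, (1 - lam / Real.log n) * (deg (F \ K) v : ℝ) * δ * d ≤
                      doubleDegSum F K v ∧
                    doubleDegSum F K v ≤
                      (1 + lam / Real.log n) * (deg (F \ K) v : ℝ) * δ * d) →
                  (∀ U : Set (Fin n),
                    (∃ U' : Set (Fin n), (U'.ncard : ℝ) ≤ 4 * U.ncard / δ ∧
                        U ⊆ U' ∪ nbhd (F \ K) U') →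
                      (((U.ncard : ℝ) ≤ lam * n / (10 ^ 6 * d * Real.log n) →
                          (E2count K U : ℝ) + (edgesWithin K U : ℝ) ≤
                            lam / Real.log n * d * U.ncard) ∧
                        ((U.ncard : ℝ) ≤ lam * n / (10 ^ 6 * d) →
                          (E2count K U : ℝ) + (edgesWithin K U : ℝ) ≤ lam * d * U.ncard))) →
                  (∀ U : Set (Fin n), (U.ncard : ℝ) ≤ lam * n / (100 * δ * Real.log n) →
                    (∃ U' : Set (Fin n), (U'.ncard : ℝ) ≤ 4 * U.ncard / d ∧
                        U ⊆ U' ∪ nbhd K U') →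
                      (E2count (F \ K) U : ℝ) + (edgesWithin (F \ K) U : ℝ) ≤
                        lam / Real.log n * δ * U.ncard) →
                  (∀ U : Set (Fin n), (U.ncard : ℝ) ≤ 100 * Real.log n →
                    ({v : Fin n | v ∉ U ∧
                        10 ≤ ((F \ K).neighborSet v ∩ U).ncard}.ncard : ℝ) ≤
                      100 * Real.log n) →
                  (∀ U V : Set (Fin n), Disjoint U V →
                    lam * n / 10 ^ 8 ≤ (U.ncard : ℝ) → lam * n / 10 ^ 8 ≤ (V.ncard : ℝ) →
                      (1 - lam) * (δ / n) * U.ncard * V.ncard ≤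
                        (edgesBetween (F \ K) U V : ℝ)) →
                  ∀ ℓ₀ : ℕ,
                    IsLeast {L : ℕ | (n : ℝ) ≤ δ ^ (L - 1) * (d : ℝ) ^ (L - 1)} ℓ₀ →
                    ∀ x y : Fin n, x ≠ y →
                      ∀ Z : Set (Fin n), (Z.ncard : ℝ) ≤ 40 * Real.log n →
                        ∀ ℓ : ℕ, 10 * ℓ₀ ≤ ℓ → (ℓ : ℝ) ≤ 10 * Real.log n →
                          (1 - C₀ * lam -
                              (((Z ∪ {x}) ∩ K.neighborSet y).ncard : ℝ) / d) *
                              (d : ℝ) ^ ℓ * δ ^ ℓ / n ≤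
                            (altPathCount (F \ K) K (2 * ℓ) x y Z : ℝ) := by
  refine ⟨1 / 10 ^ 10, by norm_num, fun C₀ hC₀ σ _ hσ => ⟨10 ^ 10, by norm_num, ?_⟩⟩
  obtain ⟨n₀, hn₀⟩ := Filter.eventually_atTop.mp eventually_log_pow_le
  refine ⟨n₀, ?_⟩
  intro n hn d δ lam hd hdn hδ hδn hlam hlam' hlδ K F hK hD1 hD2 hD3 hD4 _ hD6 ℓ₀ hℓ₀ x y hxy Z hZ
    ℓ hℓ hℓL
  obtain ⟨hL, hn⟩ := hn₀ n hn
  rw [one_div_one_div] at hC₀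
  obtain ⟨q, rfl⟩ : ∃ q, ℓ₀ = q + 1 := by
    refine Nat.exists_eq_succ_of_ne_zero ?_
    rintro rfl
    have h1 : (n : ℝ) ≤ 1 := by simpa using hℓ₀.1
    linarith [Real.log_nonpos (Nat.cast_nonneg n) h1]
  have h := isPseudo_of_pseudorandom hL hn (hσ.trans (by norm_num)) hd hdn hδ hδn hlam hlam'
    (le_trans (by gcongr) hlδ) hK hD1 hD2 hD3 hD4 hD6 (q := q)
    (by
      have : (10 * (q + 1) : ℝ) ≤ ℓ := by exact_mod_cast hℓ
      linarith)
    (by simpa [mul_pow, mul_comm] using hℓ₀.1)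
  have hZf : (Z.toFinset : Set (Fin n)) = Z := Set.coe_toFinset Z
  obtain ⟨m, j, hmj, hw⟩ := h.exists_walkSum_pairCount_ge hxy Z.toFinset
    (by rwa [← Set.ncard_coe_finset, hZf]) hℓ hℓL
  have hle := hw.trans (walkSum_pairCount_le Finset.sdiff_subset hmj)
  rw [hZf] at hle
  have hcard : ((Z ∪ {x}) ∩ K.neighborSet y).ncard = (insert x Z.toFinset ∩ nb K y).card := by
    rw [← Set.ncard_coe_finset]
    congr 1
    ext v
    simp [mem_nb]
  rw [hcard]
  refine le_trans ?_ hle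
  rw [mul_assoc, ← mul_pow, mul_div_assoc]
  refine mul_le_mul_of_nonneg_right ?_ (by positivity)
  have := mul_le_mul_of_nonneg_right hC₀ h.lam_pos.le
  linarith [h.lam_pos]

end Sandwich
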